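/- arXiv:2208.10572 — 3 statements merged into one kernel-verified Lean document; each statement's English description precedes it below -/
import Mathlib

section
/- (Key Lemma) Let r, h, ℓ be positive integers with h ≥ r ≥ 2. Let H be an r-partite r-uniform hypergraph with h vertices and ℓ edges. Let α, A be positive reals such that for each n, every n-vertex r-graph G with m ≥ A·n^α edges contains at least f(n,m) copies of H, where f is a function satisfying: (1) there is a constant δ > 0 such that for all p ∈ (0,1] and all positive reals n, m one has f(n,m) ≥ δ·m^{(h−α)/(r−α)} / n^{α(h−r)/(r−α)} and f(np, m·p^r) ≥ δ·f(n,m)·p^h; (2) for fixed n, f(n,m) is increasing and convex in m. Then there exist constants k₀ = k₀(H) and C = C(H) ≥ 1 such that if G is an n-vertex r-graph with k·n^α edges, where k ≥ k₀, then G contains a family 𝓕 of copies of H satisfying: (1) |𝓕| ≥ δ·f(n, e(G)/8); (2) for every S ⊆ E(G) with 1 ≤ |S| ≤ ℓ − 1, d_𝓕(S) ≤ C·k^{−λ*(α,H)(|S|−1)}·|𝓕|/e(G), where λ*(α,H) = 1/(m*_r(H)(r−α)). -/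
set_option autoImplicit false

open Finset Filter MeasureTheory

/-- `G` is an `r`-uniform hypergraph: every edge has exactly `r` vertices. -/
def UniformHG (r : ℕ) {V : Type*} (G : Finset (Finset V)) : Prop :=
  ∀ e ∈ G, e.card = r

/-- The set of vertices spanned by an edge set. -/
def vertsHG {V : Type*} [DecidableEq V] (G : Finset (Finset V)) : Finset V :=
  G.biUnion id

/-- `A` is (the edge set of) a copy of `H` in `G`. -/
def IsCopy {V W : Type*} [DecidableEq V] [DecidableEq W]
    (H : Finset (Finset V)) (G : Finset (Finset W)) (A : Finset (Finset W)) : Prop :=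
  ∃ f : V → W, Function.Injective f ∧ A = H.image (fun e => e.image f) ∧ A ⊆ G

/-- The set of copies of `H` in `G`, each copy identified with its edge set. -/
def copies {V W : Type*} [DecidableEq V] [DecidableEq W]
    (H : Finset (Finset V)) (G : Finset (Finset W)) : Set (Finset (Finset W)) :=
  {A | IsCopy H G A}

/-- `G` contains no copy of `H`. -/
def HFree {V W : Type*} [DecidableEq V] [DecidableEq W]
    (H : Finset (Finset V)) (G : Finset (Finset W)) : Prop :=
  ∀ A, ¬ IsCopy H G A

/-- The extremal number `ex(n, H)`: the maximum number of edges in an `H`-free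
`r`-uniform hypergraph on `n` vertices. -/
noncomputable def exN {V : Type*} [DecidableEq V] (r : ℕ) (H : Finset (Finset V)) (n : ℕ) : ℕ :=
  sSup {m | ∃ G : Finset (Finset (Fin n)), UniformHG r G ∧ HFree H G ∧ G.card = m}

/-- The degree `d_F(S)` of an edge set `S` in a family `F` of copies. -/
def degF {W : Type*} [DecidableEq W]
    (F : Finset (Finset (Finset W))) (S : Finset (Finset W)) : ℕ :=
  (F.filter fun B => S ⊆ B).card

/-- `H` is `r`-partite: the vertices can be `r`-colored so that every edge meets each
color class in exactly one vertex. -/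
def MultipartiteHG (r : ℕ) {V : Type*} (H : Finset (Finset V)) : Prop :=
  ∃ c : V → Fin r, ∀ e ∈ H, ∀ i : Fin r, ∃! v, v ∈ e ∧ c v = i

/-- The `r`-density `m_r(H)`. -/
noncomputable def mDen (r : ℕ) {V : Type*} [DecidableEq V] (H : Finset (Finset V)) : ℝ :=
  sSup {x : ℝ | ∃ F, F ⊆ H ∧ r < (vertsHG F).card ∧
    x = ((F.card : ℝ) - 1) / (((vertsHG F).card : ℝ) - (r : ℝ))}

/-- The proper `r`-density `m*_r(H)`. -/
noncomputable def mDenStar (r : ℕ) {V : Type*} [DecidableEq V] (H : Finset (Finset V)) : ℝ :=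
  sSup {x : ℝ | ∃ F, F ⊂ H ∧ r < (vertsHG F).card ∧
    x = ((F.card : ℝ) - 1) / (((vertsHG F).card : ℝ) - (r : ℝ))}

/-- `λ(α,H) = 1/(m_r(H)(r−α))`. -/
noncomputable def lamHG (r : ℕ) {V : Type*} [DecidableEq V] (α : ℝ) (H : Finset (Finset V)) : ℝ :=
  1 / (mDen r H * ((r : ℝ) - α))

/-- `λ*(α,H) = 1/(m*_r(H)(r−α))`. -/
noncomputable def lamStarHG (r : ℕ) {V : Type*} [DecidableEq V] (α : ℝ) (H : Finset (Finset V)) : ℝ :=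
  1 / (mDenStar r H * ((r : ℝ) - α))

/-- The copies of `H` in `G`, as a finset. -/
noncomputable def copyFinset {V W : Type*} [DecidableEq V] [DecidableEq W]
    (H : Finset (Finset V)) (G : Finset (Finset W)) : Finset (Finset (Finset W)) := by
  classical exact G.powerset.filter (IsCopy H G)

lemma card_image_image {V W : Type*} [DecidableEq W] {f : V → W} (hf : Function.Injective f)
    (H : Finset (Finset V)) : (H.image fun e => e.image f).card = H.card :=
  Finset.card_image_of_injective _ (Finset.image_injective hf)

section Copies

variable {V W X : Type*} [DecidableEq V] [DecidableEq W] [DecidableEq X]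

lemma mem_copyFinset {H : Finset (Finset V)} {G B : Finset (Finset W)} :
    B ∈ copyFinset H G ↔ IsCopy H G B := by
  classical
  simp only [copyFinset, Finset.mem_filter, Finset.mem_powerset, and_iff_right_iff_imp]
  rintro ⟨f, -, -, h⟩
  exact h

lemma ncard_copies (H : Finset (Finset V)) (G : Finset (Finset W)) :
    (copies H G).ncard = (copyFinset H G).card := by
  rw [← Set.ncard_coe_finset]
  congr 1
  ext B
  simp [copies, mem_copyFinset]

lemma IsCopy.subset {H : Finset (Finset V)} {G B : Finset (Finset W)} (hB : IsCopy H G B) :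
    B ⊆ G := by
  obtain ⟨f, -, -, h⟩ := hB
  exact h

lemma IsCopy.mono {H : Finset (Finset V)} {G G' B : Finset (Finset W)} (hB : IsCopy H G B)
    (h : B ⊆ G') : IsCopy H G' B := by
  obtain ⟨f, hf, hB, -⟩ := hB
  exact ⟨f, hf, hB, h⟩

lemma IsCopy.nonempty {H : Finset (Finset V)} {G B : Finset (Finset W)} (hB : IsCopy H G B)
    (hH : H.Nonempty) : B.Nonempty := by
  obtain ⟨f, hf, rfl, -⟩ := hB
  exact hH.image _

lemma vertsHG_image_image (f : V → W) (H : Finset (Finset V)) :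
    vertsHG (H.image fun e => e.image f) = (vertsHG H).image f := by
  ext w
  simp only [vertsHG, Finset.mem_biUnion, Finset.mem_image, id]
  constructor
  · rintro ⟨e, ⟨e', he', rfl⟩, hw⟩
    obtain ⟨v, hv, rfl⟩ := Finset.mem_image.1 hw
    exact ⟨v, ⟨e', he', hv⟩, rfl⟩
  · rintro ⟨v, ⟨e', he', hv⟩, rfl⟩
    exact ⟨_, ⟨e', he', rfl⟩, Finset.mem_image_of_mem f hv⟩

lemma vertsHG_mono {G G' : Finset (Finset W)} (h : G ⊆ G') : vertsHG G ⊆ vertsHG G' :=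
  Finset.biUnion_subset_biUnion_of_subset_left _ h

lemma vertsHG_subset_iff {G : Finset (Finset W)} {U : Finset W} :
    vertsHG G ⊆ U ↔ ∀ e ∈ G, e ⊆ U := by
  simp [vertsHG]

/-- An injection of vertex sets cannot decrease the number of copies. -/
lemma card_copyFinset_le_of_injective (H : Finset (Finset V)) {φ : W → X}
    (hφ : Function.Injective φ) (G : Finset (Finset W)) :
    (copyFinset H G).card ≤ (copyFinset H (G.image fun e => e.image φ)).card := by
  refine Finset.card_le_card_of_injOn (fun B => B.image fun e => e.image φ) ?_
    (Finset.image_injective (Finset.image_injective hφ)).injOn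
  intro B hB
  obtain ⟨f, hf, rfl, hBG⟩ := mem_copyFinset.1 hB
  refine mem_copyFinset.2 ⟨φ ∘ f, hφ.comp hf, ?_, Finset.image_subset_image hBG⟩
  simp [Finset.image_image, Function.comp_def]

/-- Splitting the edges into disjoint blocks of size `z`, each of which contains `c` copies. -/
lemma mul_le_card_copyFinset {H : Finset (Finset V)} (hH : H.Nonempty) {z : ℕ} {c : ℝ} (j : ℕ) :
    ∀ G : Finset (Finset W),
      (∀ G' ⊆ G, G'.card = z → c ≤ ((copyFinset H G').card : ℝ)) → j * z ≤ G.card →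
      j * c ≤ ((copyFinset H G).card : ℝ) := by
  induction j with
  | zero => intro G _ _; simp
  | succ j ih =>
    intro G hG hj
    obtain ⟨G₁, hG₁, hz⟩ := Finset.exists_subset_card_eq (s := G) (n := z) (by nlinarith)
    have h1 := hG G₁ hG₁ hz
    have h2 := ih (G \ G₁) (fun G' h => hG G' (h.trans Finset.sdiff_subset)) (by
      rw [Finset.card_sdiff_of_subset hG₁, hz]
      have : (j + 1) * z = j * z + z := by ring
      omega)
    have hdisj : Disjoint (copyFinset H G₁) (copyFinset H (G \ G₁)) := by
      rw [Finset.disjoint_left]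
      intro B hB hB'
      obtain ⟨e, he⟩ := (mem_copyFinset.1 hB).nonempty hH
      exact (Finset.mem_sdiff.1 ((mem_copyFinset.1 hB').subset he)).2
        ((mem_copyFinset.1 hB).subset he)
    have h3 : (copyFinset H G₁).card + (copyFinset H (G \ G₁)).card ≤ (copyFinset H G).card := by
      rw [← Finset.card_union_of_disjoint hdisj]
      refine Finset.card_le_card (Finset.union_subset ?_ ?_) <;> intro B hB
      · exact mem_copyFinset.2 ((mem_copyFinset.1 hB).mono
          ((mem_copyFinset.1 hB).subset.trans hG₁))
      · exact mem_copyFinset.2 ((mem_copyFinset.1 hB).mono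
          ((mem_copyFinset.1 hB).subset.trans Finset.sdiff_subset))
    have h3' : ((copyFinset H G₁).card : ℝ) + (copyFinset H (G \ G₁)).card
        ≤ (copyFinset H G).card := by exact_mod_cast h3
    push_cast
    linarith

lemma sub_one_mul_le_card_copyFinset {H : Finset (Finset V)} (hH : H.Nonempty) {z : ℕ}
    (hz : 0 < z) {c : ℝ} (hc : 0 ≤ c) (G : Finset (Finset W))
    (hG : ∀ G' ⊆ G, G'.card = z → c ≤ ((copyFinset H G').card : ℝ)) :
    ((G.card : ℝ) / z - 1) * c ≤ ((copyFinset H G).card : ℝ) := by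
  refine le_trans ?_ (mul_le_card_copyFinset hH (G.card / z) G hG (Nat.div_mul_le_self _ _))
  gcongr
  rw [sub_le_iff_le_add, div_le_iff₀ (by positivity)]
  have := (Nat.lt_div_mul_add (a := G.card) hz).le
  have h : (G.card : ℝ) ≤ ((G.card / z : ℕ) : ℝ) * z + z := by exact_mod_cast this
  linarith

end Copies

section Sampling

/-- The number of `q`-subsets of `Fin n` containing a given `t`-set. -/
lemma card_powersetCard_filter_superset {n q : ℕ} (T : Finset (Fin n)) (hT : T.card ≤ q) :
    ((powersetCard q univ).filter (T ⊆ ·)).card = (n - T.card).choose (q - T.card) := by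
  have : (n - T.card) = (Tᶜ).card := by rw [Finset.card_compl, Fintype.card_fin]
  rw [this, ← Finset.card_powersetCard]
  refine Finset.card_bij' (fun U _ => U \ T) (fun U _ => U ∪ T) ?_ ?_ ?_ ?_
  · intro U hU
    simp only [Finset.mem_filter, Finset.mem_powersetCard] at hU ⊢
    refine ⟨fun x hx => ?_, ?_⟩
    · simp_all
    · rw [Finset.card_sdiff_of_subset hU.2, hU.1.2]
  · intro U hU
    simp only [Finset.mem_filter, Finset.mem_powersetCard] at hU ⊢
    refine ⟨⟨Finset.subset_univ _, ?_⟩, Finset.subset_union_right⟩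
    rw [Finset.card_union_of_disjoint, hU.2]
    · omega
    · rw [Finset.disjoint_left]
      intro x hx
      simpa using hU.1 hx
  · intro U hU
    simp only [Finset.mem_filter] at hU
    exact Finset.sdiff_union_of_subset hU.2
  · intro U hU
    simp only [Finset.mem_powersetCard] at hU
    refine Finset.union_sdiff_cancel_right ?_
    rw [Finset.disjoint_left]
    intro x hx
    simpa using hU.1 hx

lemma choose_sub_succ {n q t : ℕ} (htq : t < q) (hqn : q ≤ n) :
    ((n : ℝ) - t) * ((n - (t + 1)).choose (q - (t + 1)) : ℝ)
      = ((q : ℝ) - t) * ((n - t).choose (q - t) : ℝ) := by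
  obtain ⟨b, rfl⟩ := Nat.exists_eq_add_of_lt htq
  obtain ⟨a, rfl⟩ := Nat.exists_eq_add_of_le hqn
  have h := Nat.add_one_mul_choose_eq (b + a) b
  have e1 : t + b + 1 + a - (t + 1) = b + a := by omega
  have e2 : t + b + 1 - (t + 1) = b := by omega
  have e3 : t + b + 1 + a - t = b + a + 1 := by omega
  have e4 : t + b + 1 - t = b + 1 := by omega
  rw [e1, e2, e3, e4]
  have h' : ((b : ℝ) + a + 1) * ((b + a).choose b : ℝ)
      = ((b + a + 1).choose (b + 1) : ℝ) * ((b : ℝ) + 1) := by exact_mod_cast h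
  push_cast
  linear_combination h'

lemma choose_sub_le {n q : ℕ} (hqn : q ≤ n) (hn : 0 < n) {t : ℕ} (htq : t ≤ q) :
    ((n - t).choose (q - t) : ℝ) ≤ ((q : ℝ) / n) ^ t * (n.choose q : ℝ) := by
  induction t with
  | zero => simp
  | succ t ih =>
    have ih := ih (by omega)
    have hs := choose_sub_succ (t := t) (by omega) hqn
    have hqn' : (q : ℝ) ≤ n := by exact_mod_cast hqn
    have htq' : (t : ℝ) + 1 ≤ q := by exact_mod_cast htq
    have hn' : (0 : ℝ) < n := by exact_mod_cast hn
    have hpos : (0 : ℝ) < n - t := by linarith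
    have hq : ((n - (t + 1)).choose (q - (t + 1)) : ℝ)
        = ((q : ℝ) - t) / (n - t) * ((n - t).choose (q - t) : ℝ) := by
      field_simp
      linarith
    have hle : ((q : ℝ) - t) / (n - t) ≤ q / n := by
      rw [div_le_div_iff₀ hpos hn']
      nlinarith [(Nat.cast_nonneg t : (0 : ℝ) ≤ t)]
    rw [hq, pow_succ', mul_assoc]
    exact mul_le_mul hle ih (by positivity) (by positivity)

lemma le_choose_sub {n q : ℕ} (hqn : q ≤ n) (hn : 0 < n) (hq : 0 < q) {r t : ℕ} (hrq : r ≤ q)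
    (htr : t ≤ r) :
    (1 - (r : ℝ) / q) ^ t * ((q : ℝ) / n) ^ t * (n.choose q : ℝ)
      ≤ ((n - t).choose (q - t) : ℝ) := by
  induction t with
  | zero => simp
  | succ t ih =>
    have ih := ih (by omega)
    have hs := choose_sub_succ (t := t) (by omega) hqn
    have hqn' : (q : ℝ) ≤ n := by exact_mod_cast hqn
    have htr' : (t : ℝ) + 1 ≤ r := by exact_mod_cast htr
    have hrq' : (r : ℝ) ≤ q := by exact_mod_cast hrq
    have hn' : (0 : ℝ) < n := by exact_mod_cast hn
    have hq' : (0 : ℝ) < q := by exact_mod_cast hq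
    have hpos : (0 : ℝ) < n - t := by linarith
    have ht0 : (0 : ℝ) ≤ t := Nat.cast_nonneg t
    have hq : ((n - (t + 1)).choose (q - (t + 1)) : ℝ)
        = ((q : ℝ) - t) / (n - t) * ((n - t).choose (q - t) : ℝ) := by
      field_simp
      linarith
    have hle : (1 - (r : ℝ) / q) * (q / n) ≤ ((q : ℝ) - t) / (n - t) := by
      have : (1 - (r : ℝ) / q) * (q / n) = (q - r) / n := by field_simp
      rw [this, div_le_div_iff₀ hn' hpos]
      nlinarith
    have h0 : 0 ≤ (1 - (r : ℝ) / q) := by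
      rw [sub_nonneg, div_le_one hq']; exact hrq'
    rw [hq]
    calc _ = ((1 - (r : ℝ) / q) * (q / n)) *
          ((1 - (r : ℝ) / q) ^ t * ((q : ℝ) / n) ^ t * (n.choose q : ℝ)) := by ring
      _ ≤ _ := mul_le_mul hle ih (by positivity)
        (div_nonneg (by linarith) hpos.le)

lemma half_le_choose_sub {n q r : ℕ} (hqn : q ≤ n) (hr : 0 < r) (hrq : 2 * r ^ 2 ≤ q) :
    1 / 2 * ((q : ℝ) / n) ^ r * (n.choose q : ℝ) ≤ ((n - r).choose (q - r) : ℝ) := by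
  have hrq1 : r ≤ q := by nlinarith
  have hq : 0 < q := by omega
  refine le_trans ?_ (le_choose_sub hqn (by omega) hq hrq1 le_rfl)
  have hq' : (0 : ℝ) < q := by exact_mod_cast hq
  gcongr
  have hb := one_add_mul_le_pow (a := -((r : ℝ) / q)) (by
    have : (r : ℝ) / q ≤ 1 := by
      rw [div_le_one hq']; exact_mod_cast hrq1
    linarith) r
  have h2 : (r : ℝ) * ((r : ℝ) / q) ≤ 1 / 2 := by
    rw [← mul_div_assoc, div_le_iff₀ hq']
    have : (2 : ℝ) * r ^ 2 ≤ q := by exact_mod_cast hrq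
    nlinarith
  rw [sub_eq_add_neg]
  linarith

end Sampling

lemma vertsHG_eq_univ {h : ℕ} {H : Finset (Finset (Fin h))} (hcov : ∀ v : Fin h, ∃ e ∈ H, v ∈ e) :
    vertsHG H = univ := by
  ext v
  simpa [vertsHG] using hcov v

lemma IsCopy.card_vertsHG {h : ℕ} {W : Type*} [DecidableEq W] {H : Finset (Finset (Fin h))}
    (hcov : ∀ v : Fin h, ∃ e ∈ H, v ∈ e) {G B : Finset (Finset W)} (hB : IsCopy H G B) :
    (vertsHG B).card = h := by
  obtain ⟨f, hf, rfl, -⟩ := hB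
  rw [vertsHG_image_image, Finset.card_image_of_injective _ hf, vertsHG_eq_univ hcov]
  simp

/-- If few sets of edges are forbidden, measured by the expected number of them that survive in a
random `q`-subset of the vertices, then many copies of `H` avoid all of them. -/
lemma le_card_filter_avoiding {r h n q z : ℕ} {H : Finset (Finset (Fin h))} (hH : H.Nonempty)
    (hcov : ∀ v : Fin h, ∃ e ∈ H, v ∈ e) {G : Finset (Finset (Fin n))} (hG : UniformHG r G)
    (hqn : q ≤ n) (hr : 0 < r) (hrq : 2 * r ^ 2 ≤ q) (hhq : h ≤ q) (hz : 0 < z) {c : ℝ}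
    (hc0 : 0 ≤ c)
    (hc : ∀ G' ⊆ G, ∀ U : Finset (Fin n), U.card = q → (∀ e ∈ G', e ⊆ U) → G'.card = z →
      c ≤ ((copyFinset H G').card : ℝ))
    (Z : Finset (Finset (Finset (Fin n))))
    (hZ : ∀ S ∈ Z, S.Nonempty ∧ (vertsHG S).card ≤ q)
    (hsum : ∑ S ∈ Z, ((q : ℝ) / n) ^ (vertsHG S).card ≤ G.card * ((q : ℝ) / n) ^ r / 8)
    (hz2 : 2 * (z : ℝ) ≤ 3 / 8 * G.card * ((q : ℝ) / n) ^ r) :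
    c ≤ ((q : ℝ) / n) ^ h *
      (((copyFinset H G).filter fun B => ∀ S ∈ Z, ¬ S ⊆ B).card : ℝ) := by
  classical
  have hrq1 : r ≤ q := by nlinarith
  have hn : 0 < n := by omega
  have hpick : ∀ S : Finset (Finset (Fin n)), ∃ e, S ∈ Z → e ∈ S := by
    intro S
    by_cases hS : S ∈ Z
    · obtain ⟨e, he⟩ := (hZ S hS).1
      exact ⟨e, fun _ => he⟩
    · exact ⟨∅, fun h => absurd h hS⟩
  choose pick hpick using hpick
  set 𝒰 : Finset (Finset (Fin n)) := powersetCard q univ with h𝒰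
  set N : ℝ := (n.choose q : ℝ) with hN
  have hNpos : 0 < N := by
    rw [hN]; exact_mod_cast Nat.choose_pos hqn
  have hNcard : ((𝒰.card : ℕ) : ℝ) = N := by
    rw [h𝒰, Finset.card_powersetCard, Finset.card_univ, Fintype.card_fin]
  set p : ℝ := (q : ℝ) / n with hp
  let G' : Finset (Fin n) → Finset (Finset (Fin n)) := fun U =>
    G.filter fun e => e ⊆ U ∧ ∀ S ∈ Z, vertsHG S ⊆ U → e ≠ pick S
  let good := (copyFinset H G).filter fun B => ∀ S ∈ Z, ¬ S ⊆ B
  -- the edges deleted inside `U`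
  have hdel : ∀ U : Finset (Fin n), ((G.filter (· ⊆ U)).card : ℝ)
      - ((Z.filter (vertsHG · ⊆ U)).card : ℝ) ≤ ((G' U).card : ℝ) := by
    intro U
    have h1 : G.filter (· ⊆ U) ⊆ G' U ∪ (Z.filter (vertsHG · ⊆ U)).image pick := by
      intro e he
      rw [Finset.mem_filter] at he
      rw [Finset.mem_union]
      by_cases hS : ∃ S ∈ Z, vertsHG S ⊆ U ∧ e = pick S
      · obtain ⟨S, hS, hSU, rfl⟩ := hS
        exact Or.inr (Finset.mem_image_of_mem _ (Finset.mem_filter.2 ⟨hS, hSU⟩))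
      · push Not at hS
        exact Or.inl (Finset.mem_filter.2 ⟨he.1, he.2, hS⟩)
    have h2 := (Finset.card_le_card h1).trans (Finset.card_union_le _ _)
    have h3 := h2.trans (Nat.add_le_add_left Finset.card_image_le _)
    have h4 : ((G.filter (· ⊆ U)).card : ℝ) ≤ (G' U).card + (Z.filter (vertsHG · ⊆ U)).card := by
      exact_mod_cast h3
    linarith
  have hcop : ∀ U : Finset (Fin n), copyFinset H (G' U) ⊆ good.filter (vertsHG · ⊆ U) := by
    intro U B hB
    have hB' := mem_copyFinset.1 hB
    have hBG' := hB'.subset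
    have hBU : vertsHG B ⊆ U := vertsHG_subset_iff.2 fun e he =>
      (Finset.mem_filter.1 (hBG' he)).2.1
    refine Finset.mem_filter.2 ⟨Finset.mem_filter.2
      ⟨mem_copyFinset.2 (hB'.mono (hBG'.trans (Finset.filter_subset _ _))), ?_⟩, hBU⟩
    intro S hS hSB
    exact (Finset.mem_filter.1 (hBG' (hSB (hpick S hS)))).2.2 S hS
      ((vertsHG_mono hSB).trans hBU) rfl
  have hlin : ∀ U ∈ 𝒰, (((G.filter (· ⊆ U)).card : ℝ) / z
      - ((Z.filter (vertsHG · ⊆ U)).card : ℝ) / z - 1) * c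
        ≤ ((good.filter (vertsHG · ⊆ U)).card : ℝ) := by
    intro U hU
    have hUq : U.card = q := (Finset.mem_powersetCard.1 hU).2
    have h1 := sub_one_mul_le_card_copyFinset hH hz hc0 (G' U) (fun G'' hG'' =>
      hc G'' (hG''.trans (Finset.filter_subset _ _)) U hUq
        (fun e he => (Finset.mem_filter.1 (hG'' he)).2.1))
    have h2 : ((copyFinset H (G' U)).card : ℝ) ≤ (good.filter (vertsHG · ⊆ U)).card := by
      exact_mod_cast Finset.card_le_card (hcop U)
    refine le_trans ?_ (h1.trans h2)
    rw [← sub_div]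
    gcongr
    exact hdel U
  have hswap : ∀ (T : Finset (Finset (Finset (Fin n)))),
      ∑ U ∈ 𝒰, ((T.filter (vertsHG · ⊆ U)).card : ℝ)
        = ∑ S ∈ T, ((𝒰.filter (vertsHG S ⊆ ·)).card : ℝ) := by
    intro T
    exact_mod_cast Finset.sum_card_bipartiteAbove_eq_sum_card_bipartiteBelow (s := 𝒰) (t := T)
      (fun U S => vertsHG S ⊆ U)
  have hswapG : ∑ U ∈ 𝒰, ((G.filter (· ⊆ U)).card : ℝ)
        = ∑ e ∈ G, ((𝒰.filter (e ⊆ ·)).card : ℝ) := by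
    exact_mod_cast Finset.sum_card_bipartiteAbove_eq_sum_card_bipartiteBelow (s := 𝒰) (t := G)
      (fun U e => e ⊆ U)
  have hsumG : 1 / 2 * p ^ r * N * G.card ≤ ∑ U ∈ 𝒰, ((G.filter (· ⊆ U)).card : ℝ) := by
    rw [hswapG, mul_comm, ← nsmul_eq_mul]
    refine Finset.card_nsmul_le_sum _ _ _ fun e he => ?_
    rw [card_powersetCard_filter_superset e (by rw [hG e he]; exact hrq1), hG e he]
    exact half_le_choose_sub hqn hr hrq
  have hsumZ : ∑ U ∈ 𝒰, ((Z.filter (vertsHG · ⊆ U)).card : ℝ) ≤ G.card * p ^ r / 8 * N := by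
    rw [hswap]
    refine le_trans (Finset.sum_le_sum (g := fun S => p ^ (vertsHG S).card * N) fun S hS => ?_) ?_
    · rw [card_powersetCard_filter_superset _ (hZ S hS).2]
      exact choose_sub_le hqn hn (hZ S hS).2
    · rw [← Finset.sum_mul]
      gcongr
  have hsumB : ∑ U ∈ 𝒰, ((good.filter (vertsHG · ⊆ U)).card : ℝ) ≤ p ^ h * good.card * N := by
    rw [hswap]
    have : ∀ B ∈ good, ((𝒰.filter (vertsHG B ⊆ ·)).card : ℝ) ≤ p ^ h * N := by
      intro B hB
      have hBh := (mem_copyFinset.1 (Finset.mem_filter.1 hB).1).card_vertsHG hcov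
      rw [card_powersetCard_filter_superset _ (hBh ▸ hhq), hBh]
      exact choose_sub_le hqn hn hhq
    refine (Finset.sum_le_card_nsmul _ _ _ this).trans_eq ?_
    rw [nsmul_eq_mul]; ring
  have hall := Finset.sum_le_sum hlin
  rw [← Finset.sum_mul, Finset.sum_sub_distrib, Finset.sum_sub_distrib, ← Finset.sum_div,
    ← Finset.sum_div, Finset.sum_const, nsmul_eq_mul, mul_one, hNcard] at hall
  have hz' : (0 : ℝ) < z := by exact_mod_cast hz
  have hfac : N ≤ (∑ U ∈ 𝒰, ((G.filter (· ⊆ U)).card : ℝ)) / z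
      - (∑ U ∈ 𝒰, ((Z.filter (vertsHG · ⊆ U)).card : ℝ)) / z - N := by
    rw [← sub_div, le_sub_iff_add_le, le_div_iff₀ hz']
    nlinarith
  have := ((mul_le_mul_of_nonneg_right hfac hc0).trans hall).trans hsumB
  have h3 : c * N ≤ p ^ h * good.card * N := by linarith
  exact le_of_mul_le_mul_right h3 hNpos

lemma degF_insert_le {W : Type*} [DecidableEq W] (F : Finset (Finset (Finset W)))
    (B S : Finset (Finset W)) : degF (insert B F) S ≤ degF F S + 1 := by
  unfold degF
  rw [Finset.filter_insert]
  split_ifs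
  · exact Finset.card_insert_le _ _
  · omega

lemma degF_insert_of_not_subset {W : Type*} [DecidableEq W] (F : Finset (Finset (Finset W)))
    {B S : Finset (Finset W)} (h : ¬ S ⊆ B) : degF (insert B F) S = degF F S := by
  unfold degF
  rw [Finset.filter_insert, if_neg h]

lemma exists_superset_of_degF_pos {W : Type*} [DecidableEq W] {F : Finset (Finset (Finset W))}
    {S : Finset (Finset W)} (h : 0 < degF F S) : ∃ B ∈ F, S ⊆ B := by
  obtain ⟨B, hB⟩ := Finset.card_pos.1 h
  exact ⟨B, Finset.mem_filter.1 hB⟩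

lemma sum_degF_le {W : Type*} [DecidableEq W] {F : Finset (Finset (Finset W))} {ℓ : ℕ}
    (hF : ∀ B ∈ F, B.card = ℓ) (Z : Finset (Finset (Finset W))) :
    ∑ S ∈ Z, degF F S ≤ F.card * 2 ^ ℓ := by
  classical
  have h := Finset.sum_card_bipartiteAbove_eq_sum_card_bipartiteBelow (s := Z) (t := F)
    (fun S B => S ⊆ B)
  refine (le_of_eq h).trans ?_
  rw [← smul_eq_mul]
  refine Finset.sum_le_card_nsmul _ _ _ fun B hB => ?_
  rw [← hF B hB, ← Finset.card_powerset]
  exact Finset.card_le_card fun S hS => Finset.mem_powerset.2 (Finset.mem_filter.1 hS).2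

lemma UniformHG.le_card_vertsHG {r : ℕ} {W : Type*} [DecidableEq W] {S : Finset (Finset W)}
    (hS : UniformHG r S) (hne : S.Nonempty) : r ≤ (vertsHG S).card := by
  obtain ⟨e, he⟩ := hne
  rw [← hS e he]
  exact Finset.card_le_card (Finset.subset_biUnion_of_mem id he)

lemma UniformHG.card_vertsHG_of_card_eq_one {r : ℕ} {W : Type*} [DecidableEq W]
    {S : Finset (Finset W)} (hS : UniformHG r S) (h1 : S.card = 1) : (vertsHG S).card = r := by
  obtain ⟨e, rfl⟩ := Finset.card_eq_one.1 h1
  simpa [vertsHG] using hS e (Finset.mem_singleton_self e)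

lemma UniformHG.lt_card_vertsHG {r : ℕ} {W : Type*} [DecidableEq W] {S : Finset (Finset W)}
    (hS : UniformHG r S) (h2 : 1 < S.card) : r < (vertsHG S).card := by
  obtain ⟨e, he, e', he', hne⟩ := Finset.one_lt_card.1 h2
  by_contra! hle
  have hsub : ∀ x ∈ S, x = vertsHG S := fun x hx =>
    Finset.eq_of_subset_of_card_le (Finset.subset_biUnion_of_mem id hx) (by rw [hS x hx]; exact hle)
  exact hne ((hsub e he).trans (hsub e' he').symm)

/-- Greedy construction of a family of `M` copies of `H` in which every set of edges spanning `v`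
vertices lies in at most `Δ v` members. -/
lemma exists_balanced_family {r h n q z : ℕ} {H : Finset (Finset (Fin h))} (hH : H.Nonempty)
    (hcov : ∀ v : Fin h, ∃ e ∈ H, v ∈ e) {G : Finset (Finset (Fin n))} (hG : UniformHG r G)
    (hqn : q ≤ n) (hr : 0 < r) (hrq : 2 * r ^ 2 ≤ q) (hhq : h ≤ q) (hz : 0 < z) {c : ℝ}
    (hc0 : 0 ≤ c)
    (hc : ∀ G' ⊆ G, ∀ U : Finset (Fin n), U.card = q → (∀ e ∈ G', e ⊆ U) → G'.card = z →
      c ≤ ((copyFinset H G').card : ℝ))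
    (hz2 : 2 * (z : ℝ) ≤ 3 / 8 * G.card * ((q : ℝ) / n) ^ r)
    {Δ : ℕ → ℝ} (hΔ2 : ∀ v, r ≤ v → v ≤ h → 2 ≤ Δ v) {β : ℝ} (hβ : 0 ≤ β)
    (hΔp : ∀ v, r ≤ v → v ≤ h → ((q : ℝ) / n) ^ v ≤ β * Δ v) {M : ℕ}
    (hM : β * 2 * (M * 2 ^ H.card) ≤ G.card * ((q : ℝ) / n) ^ r / 8)
    (hMc : ∀ j : ℕ, j < M → j * ((q : ℝ) / n) ^ h < c) :
    ∃ F : Finset (Finset (Finset (Fin n))), F.card = M ∧ (∀ B ∈ F, IsCopy H G B) ∧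
      ∀ S : Finset (Finset (Fin n)), S.Nonempty → 0 < degF F S →
        (degF F S : ℝ) ≤ Δ (vertsHG S).card := by
  classical
  have hn : 0 < n := by nlinarith
  have hp : 0 < (q : ℝ) / n := by
    have : 0 < q := by nlinarith
    positivity
  suffices hmain : ∀ j ≤ M, ∃ F : Finset (Finset (Finset (Fin n))), F.card = j ∧
      (∀ B ∈ F, IsCopy H G B) ∧ ∀ S : Finset (Finset (Fin n)), S.Nonempty → 0 < degF F S →
        (degF F S : ℝ) ≤ Δ (vertsHG S).card from hmain M le_rfl
  intro j
  induction j with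
  | zero =>
    intro _
    exact ⟨∅, rfl, by simp, fun S _ hS => by simp [degF] at hS⟩
  | succ j ih =>
    intro hjM
    obtain ⟨F, hFj, hF, hdeg⟩ := ih (by omega)
    have hcard : ∀ B ∈ F, B.card = H.card := by
      intro B hB
      obtain ⟨f, hf, rfl, -⟩ := hF B hB
      exact card_image_image hf H
    -- the saturated sets
    set Z := G.powerset.filter fun S => S.Nonempty ∧ (vertsHG S).card ≤ h ∧
      Δ (vertsHG S).card < (degF F S : ℝ) + 1 with hZdef
    have hZr : ∀ S ∈ Z, r ≤ (vertsHG S).card := by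
      intro S hS
      simp only [hZdef, Finset.mem_filter, Finset.mem_powerset] at hS
      exact UniformHG.le_card_vertsHG (fun e he => hG e (hS.1 he)) hS.2.1
    have hsum : ∑ S ∈ Z, ((q : ℝ) / n) ^ (vertsHG S).card
        ≤ G.card * ((q : ℝ) / n) ^ r / 8 := by
      have h1 : ∑ S ∈ Z, ((q : ℝ) / n) ^ (vertsHG S).card
          ≤ ∑ S ∈ Z, β * 2 * (degF F S : ℝ) := by
        refine Finset.sum_le_sum fun S hS => ?_
        have hr' := hZr S hS
        simp only [hZdef, Finset.mem_filter] at hS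
        refine (hΔp _ hr' hS.2.2.1).trans ?_
        rw [mul_assoc]
        refine mul_le_mul_of_nonneg_left ?_ hβ
        have := hΔ2 _ hr' hS.2.2.1
        linarith [hS.2.2.2]
      have h2 : ∑ S ∈ Z, (degF F S : ℝ) ≤ M * 2 ^ H.card := by
        have h3 : ∑ S ∈ Z, (degF F S : ℝ) ≤ F.card * 2 ^ H.card := by
          exact_mod_cast sum_degF_le hcard Z
        refine h3.trans ?_
        rw [hFj]
        gcongr
        omega
      rw [← Finset.mul_sum] at h1
      exact (h1.trans (mul_le_mul_of_nonneg_left h2 (by positivity))).trans hM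
    have hgood := le_card_filter_avoiding hH hcov hG hqn hr hrq hhq hz hc0 hc Z (fun S hS => by
      simp only [hZdef, Finset.mem_filter] at hS
      exact ⟨hS.2.1, hS.2.2.1.trans hhq⟩) hsum hz2
    have hlt : F.card < ((copyFinset H G).filter fun B => ∀ S ∈ Z, ¬ S ⊆ B).card := by
      have h1 := (hMc j (by omega)).trans_le hgood
      rw [mul_comm] at h1
      rw [hFj]
      exact_mod_cast lt_of_mul_lt_mul_left h1 (by positivity)
    obtain ⟨B, hB, hBF⟩ := Finset.exists_mem_notMem_of_card_lt_card hlt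
    rw [Finset.mem_filter, mem_copyFinset] at hB
    refine ⟨insert B F, by rw [Finset.card_insert_of_notMem hBF, hFj], ?_, ?_⟩
    · intro B' hB'
      rcases Finset.mem_insert.1 hB' with rfl | hB'
      · exact hB.1
      · exact hF B' hB'
    · intro S hS hpos
      by_cases hSB : S ⊆ B
      · have hSZ : S ∉ Z := fun h => hB.2 S h hSB
        simp only [hZdef, Finset.mem_filter, Finset.mem_powerset, not_and, not_lt] at hSZ
        have hSh : (vertsHG S).card ≤ h :=
          (Finset.card_le_card (vertsHG_mono hSB)).trans_eq (hB.1.card_vertsHG hcov)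
        refine le_trans ?_ (hSZ (hSB.trans hB.1.subset) hS hSh)
        exact_mod_cast degF_insert_le F B S
      · rw [degF_insert_of_not_subset F hSB] at hpos ⊢
        exact hdeg S hS hpos

/-- A hypergraph inside a `q`-set of vertices can be moved to `Fin q`. -/
lemma exists_uniformHG_fin {r h n q : ℕ} (H : Finset (Finset (Fin h))) {G : Finset (Finset (Fin n))}
    (hG : UniformHG r G) {U : Finset (Fin n)} (hU : U.card = q) (hGU : ∀ e ∈ G, e ⊆ U) :
    ∃ G' : Finset (Finset (Fin q)), UniformHG r G' ∧ G'.card = G.card ∧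
      (copyFinset H G').card ≤ (copyFinset H G).card := by
  classical
  set φ : Fin q → Fin n := ⇑(U.orderEmbOfFin hU) with hφ
  have hinj : Function.Injective φ := (U.orderEmbOfFin hU).injective
  set G' : Finset (Finset (Fin q)) := univ.filter fun e => e.image φ ∈ G with hG'
  have himg : (G'.image fun e => e.image φ) = G := by
    ext e
    simp only [hG', Finset.mem_image, Finset.mem_filter, Finset.mem_univ, true_and]
    constructor
    · rintro ⟨e', he', rfl⟩; exact he'
    · intro he
      have heq : (univ.filter fun x => φ x ∈ e).image φ = e := by
        ext x
        simp only [Finset.mem_image, Finset.mem_filter, Finset.mem_univ, true_and]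
        constructor
        · rintro ⟨y, hy, rfl⟩; exact hy
        · intro hx
          have : x ∈ Set.range φ := by
            rw [hφ, Finset.range_orderEmbOfFin]; exact hGU e he hx
          obtain ⟨y, rfl⟩ := this
          exact ⟨y, hx, rfl⟩
      exact ⟨_, by rw [heq]; exact he, heq⟩
  refine ⟨G', ?_, ?_, ?_⟩
  · intro e he
    rw [← hG _ (Finset.mem_filter.1 he).2, Finset.card_image_of_injective _ hinj]
  · rw [← card_image_image hinj G', himg]
  · have := card_copyFinset_le_of_injective H hinj G'
    rwa [himg] at this

/-- A proper subset of a copy of `H` corresponds to a proper subset of `H`. -/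
lemma IsCopy.exists_ssubset {V W : Type*} [DecidableEq V] [DecidableEq W]
    {H : Finset (Finset V)} {G B S : Finset (Finset W)} (hB : IsCopy H G B) (hSB : S ⊆ B)
    (hS : S.card < H.card) :
    ∃ F, F ⊂ H ∧ F.card = S.card ∧ (vertsHG F).card = (vertsHG S).card := by
  obtain ⟨f, hf, rfl, -⟩ := hB
  set F := H.filter fun e => e.image f ∈ S with hF
  have himg : (F.image fun e => e.image f) = S := by
    ext e
    simp only [hF, Finset.mem_image, Finset.mem_filter]
    constructor
    · rintro ⟨e', ⟨-, he'⟩, rfl⟩; exact he'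
    · intro he
      obtain ⟨e', he', rfl⟩ := Finset.mem_image.1 (hSB he)
      exact ⟨e', ⟨he', he⟩, rfl⟩
  have hcard : F.card = S.card := by rw [← himg, card_image_image hf]
  refine ⟨F, ⟨Finset.filter_subset _ _, fun h => ?_⟩, hcard, ?_⟩
  · have := Finset.card_le_card h
    omega
  · rw [← himg, vertsHG_image_image, Finset.card_image_of_injective _ hf]

lemma le_mDenStar {r : ℕ} {V : Type*} [DecidableEq V] {H F : Finset (Finset V)} (hF : F ⊂ H)
    (hr : r < (vertsHG F).card) :
    ((F.card : ℝ) - 1) / (((vertsHG F).card : ℝ) - (r : ℝ)) ≤ mDenStar r H := by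
  refine le_csSup ?_ ⟨F, hF, hr, rfl⟩
  refine ((H.powerset.image fun F : Finset (Finset V) => ((F.card : ℝ) - 1) /
    (((vertsHG F).card : ℝ) - (r : ℝ))).finite_toSet.subset ?_).bddAbove
  rintro x ⟨F, hF, -, rfl⟩
  exact Finset.mem_coe.2 (Finset.mem_image_of_mem _ (Finset.mem_powerset.2 hF.1))

lemma rpow_pow_le_rpow_lamStarHG {r : ℕ} {V W : Type*} [DecidableEq V] [DecidableEq W]
    {H : Finset (Finset V)} {G B S : Finset (Finset W)} (hG : UniformHG r G) (hB : IsCopy H G B)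
    (hSB : S ⊆ B) (hS1 : 1 ≤ S.card) (hS : S.card < H.card) {α k : ℝ} (hα : α < r)
    (hk : 1 ≤ k) :
    (k ^ (-(1 / ((r : ℝ) - α)))) ^ ((vertsHG S).card - r)
      ≤ k ^ (-(lamStarHG r α H) * ((S.card : ℝ) - 1)) := by
  have hSu : UniformHG r S := fun e he => hG e (hB.subset (hSB he))
  have hd : 0 < (r : ℝ) - α := by linarith
  rcases hS1.eq_or_lt with h1 | h1
  · rw [hSu.card_vertsHG_of_card_eq_one h1.symm, ← h1]
    simp
  · have hv := hSu.lt_card_vertsHG h1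
    obtain ⟨F, hF, hFc, hFv⟩ := hB.exists_ssubset hSB hS
    have hm := le_mDenStar hF (hFv ▸ hv)
    rw [hFc, hFv] at hm
    have hv' : (0 : ℝ) < ((vertsHG S).card : ℝ) - r := by
      rw [sub_pos]; exact_mod_cast hv
    have hs' : (0 : ℝ) < (S.card : ℝ) - 1 := by
      rw [sub_pos]; exact_mod_cast h1
    have hmpos : 0 < mDenStar r H := lt_of_lt_of_le (by positivity) hm
    rw [div_le_iff₀ hv'] at hm
    rw [← Real.rpow_natCast, ← Real.rpow_mul (by linarith), Nat.cast_sub hv.le]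
    refine Real.rpow_le_rpow_of_exponent_le hk ?_
    have : lamStarHG r α H * ((S.card : ℝ) - 1)
        ≤ 1 / ((r : ℝ) - α) * (((vertsHG S).card : ℝ) - r) := by
      unfold lamStarHG
      rw [div_mul_eq_mul_div, div_mul_eq_mul_div, one_mul, one_mul,
        div_le_div_iff₀ (by positivity) hd]
      nlinarith
    linarith

lemma card_le_pow_of_uniformHG {r n : ℕ} {G : Finset (Finset (Fin n))} (hG : UniformHG r G) :
    G.card ≤ n ^ r := by
  have h : G ⊆ powersetCard r univ := fun e he =>
    Finset.mem_powersetCard.2 ⟨Finset.subset_univ _, hG e he⟩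
  refine (Finset.card_le_card h).trans ?_
  rw [Finset.card_powersetCard, Finset.card_univ, Fintype.card_fin]
  exact Nat.choose_le_pow n r

/-- In a sufficiently dense hypergraph there is a family of `M` copies of `H`, for `M ≤ ⌈L⌉` with
`L = δ f(n, e(G)/8)`, with controlled degrees. Here `P = k ^ (-1/(r-α))`, and `q` is the size of the
random sets of vertices. -/
lemma exists_family_of_sampling {r h n q M : ℕ} {H : Finset (Finset (Fin h))} (hH : H.Nonempty)
    (hr : 0 < r) (hcov : ∀ v : Fin h, ∃ e ∈ H, v ∈ e)
    {α A : ℝ} {f : ℝ → ℝ → ℝ} {δ : ℝ}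
    (hcount : ∀ (n : ℕ) (G : Finset (Finset (Fin n))), UniformHG r G →
      A * (n : ℝ) ^ α ≤ (G.card : ℝ) → f n G.card ≤ ((copies H G).ncard : ℝ))
    (hpos : ∀ n m : ℝ, 0 < n → 0 < m → 0 ≤ f n m)
    (hf2 : ∀ p ∈ Set.Ioc (0 : ℝ) 1, ∀ n m : ℝ, 0 < n → 0 < m →
      δ * f n m * p ^ h ≤ f (n * p) (m * p ^ r))
    (hmono : ∀ n : ℝ, MonotoneOn (f n) (Set.Ici 0))
    {G : Finset (Finset (Fin n))} (hG : UniformHG r G) (hGpos : 0 < G.card) (hMpos : 0 < M)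
    (hqn : q ≤ n) (hrq : 2 * r ^ 2 ≤ q) (hhq : h ≤ q)
    (hm16 : 16 ≤ (G.card : ℝ) * ((q : ℝ) / n) ^ r)
    (hmA : 8 * A * (q : ℝ) ^ α ≤ (G.card : ℝ) * ((q : ℝ) / n) ^ r)
    {P K C : ℝ} (hP : 0 < P) (hK : 1 ≤ K) (hpP : (q : ℝ) / n ≤ K * P)
    (hC : 2 ^ (H.card + 4) * K ^ h ≤ C)
    (hΔ2 : ∀ v, r ≤ v → v ≤ h → 2 ≤ C * P ^ (v - r) * M / G.card)
    (hM : ∀ j : ℕ, j < M → (j : ℝ) < δ * f n ((G.card : ℝ) / 8)) :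
    ∃ F : Finset (Finset (Finset (Fin n))), F.card = M ∧ (∀ B ∈ F, IsCopy H G B) ∧
      ∀ S : Finset (Finset (Fin n)), S.Nonempty → 0 < degF F S →
        (degF F S : ℝ) ≤ C * P ^ ((vertsHG S).card - r) * M / G.card := by
  have hq : 0 < q := by nlinarith
  have hn : 0 < n := by omega
  have hq' : (0 : ℝ) < q := by exact_mod_cast hq
  have hn' : (0 : ℝ) < n := by exact_mod_cast hn
  have hG' : (0 : ℝ) < G.card := by exact_mod_cast hGpos
  have hM' : (0 : ℝ) < M := by exact_mod_cast hMpos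
  have hC0 : 0 < C := lt_of_lt_of_le (by positivity) hC
  have hp : 0 < (q : ℝ) / n := by positivity
  have hp1 : (q : ℝ) / n ≤ 1 := by
    rw [div_le_one hn']; exact_mod_cast hqn
  set y : ℝ := (G.card : ℝ) * ((q : ℝ) / n) ^ r with hy
  set z : ℕ := ⌈y / 8⌉₊ with hz
  have hzy : y / 8 ≤ z := Nat.le_ceil _
  have hzy' : (z : ℝ) < y / 8 + 1 := Nat.ceil_lt_add_one (by linarith)
  have hz0' : (0 : ℝ) < z := by linarith
  have hz0 : 0 < z := by exact_mod_cast hz0'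
  have hfz : δ * f n ((G.card : ℝ) / 8) * ((q : ℝ) / n) ^ h ≤ f q z := by
    refine (hf2 _ ⟨hp, hp1⟩ n _ hn' (by positivity)).trans ?_
    rw [mul_div_cancel₀ _ hn'.ne']
    have : (G.card : ℝ) / 8 * ((q : ℝ) / n) ^ r = y / 8 := by rw [hy]; ring
    rw [this]
    exact hmono _ (Set.mem_Ici.2 (by linarith)) (Set.mem_Ici.2 hz0'.le) hzy
  refine exists_balanced_family (q := q) (z := z) (c := f q z)
    (Δ := fun v => C * P ^ (v - r) * M / G.card)
    (β := ((q : ℝ) / n) ^ r * K ^ h * G.card / (C * M)) hH hcov hG hqn hr hrq hhq hz0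
    (hpos _ _ hq' hz0') ?_ ?_ hΔ2 (by positivity) ?_ ?_ ?_
  · intro G₁ hG₁ U hU hGU hz₁
    obtain ⟨G₂, hu, hc, hle⟩ := exists_uniformHG_fin H (fun e he => hG e (hG₁ he)) hU hGU
    have h1 := hcount q G₂ hu (by
      rw [hc, hz₁]
      linarith)
    rw [hc, hz₁, ncard_copies] at h1
    exact h1.trans (by exact_mod_cast hle)
  · rw [mul_assoc, ← hy]
    linarith
  · intro v hrv hvh
    obtain ⟨t, rfl⟩ := Nat.exists_eq_add_of_le hrv
    have e : ((q : ℝ) / n) ^ r * K ^ h * G.card / (C * M) * (C * P ^ (r + t - r) * M / G.card)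
        = ((q : ℝ) / n) ^ r * (K ^ h * P ^ t) := by
      rw [Nat.add_sub_cancel_left]
      field_simp
    rw [e, pow_add]
    gcongr
    calc ((q : ℝ) / n) ^ t ≤ (K * P) ^ t := by gcongr
      _ = K ^ t * P ^ t := mul_pow _ _ _
      _ ≤ K ^ h * P ^ t := by gcongr; omega
  · have e : ((q : ℝ) / n) ^ r * K ^ h * G.card / (C * M) * 2 * (M * 2 ^ H.card)
        = y / 8 * (2 ^ (H.card + 4) * K ^ h / C) := by
      rw [hy, pow_add]
      field_simp
      norm_num
    rw [e]
    exact mul_le_of_le_one_right (by positivity) ((div_le_one hC0).2 hC)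
  · intro j hj
    exact lt_of_lt_of_le (mul_lt_mul_of_pos_right (hM j hj) (by positivity)) hfz

/-- The growth condition on `f`, in terms of the ratio `k = m / n ^ α`. -/
lemma growth_bound {r h : ℕ} (hrh : r ≤ h) {α : ℝ} (hα : α < r) {f : ℝ → ℝ → ℝ} {δ : ℝ}
    (hf1 : ∀ n m : ℝ, 0 < n → 0 < m →
      δ * m ^ (((h : ℝ) - α) / ((r : ℝ) - α)) / n ^ (α * ((h : ℝ) - (r : ℝ)) / ((r : ℝ) - α))
        ≤ f n m) {n m k : ℝ} (hn : 0 < n) (hk : 0 < k) (hm : m = k * n ^ α) :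
    δ * (8 : ℝ)⁻¹ ^ (((h : ℝ) - α) / ((r : ℝ) - α)) * m
      ≤ f n (m / 8) * (k ^ (-(1 / ((r : ℝ) - α)))) ^ (h - r) := by
  have hd : 0 < (r : ℝ) - α := by linarith
  have hm0 : 0 < m := by rw [hm]; positivity
  have h1 := hf1 n (m / 8) hn (by positivity)
  set t : ℝ := ((h : ℝ) - r) / ((r : ℝ) - α) with ht
  have e1 : ((h : ℝ) - α) / ((r : ℝ) - α) = 1 + t := by
    rw [ht]; field_simp; ring
  have e2 : α * ((h : ℝ) - (r : ℝ)) / ((r : ℝ) - α) = α * t := by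
    rw [ht]; ring
  have e3 : (k ^ (-(1 / ((r : ℝ) - α)))) ^ (h - r) = k ^ (-t) := by
    rw [← Real.rpow_natCast, ← Real.rpow_mul hk.le, Nat.cast_sub hrh, ht]
    congr 1
    ring
  have e4 : m ^ (1 + t) = m * (k ^ t * n ^ (α * t)) := by
    rw [Real.rpow_add hm0, Real.rpow_one, Real.rpow_mul hn.le,
      ← Real.mul_rpow hk.le (by positivity), ← hm]
  rw [e1, e2, div_eq_mul_inv m, Real.mul_rpow hm0.le (by norm_num), e4] at h1
  rw [e1, e3]
  refine le_trans (le_of_eq ?_) (mul_le_mul_of_nonneg_right h1 (by positivity))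
  rw [Real.rpow_neg hk.le]
  field_simp

set_option maxHeartbeats 1000000 in
/-- **Key Lemma.** Given a supersaturation counting function `f` for `H`
satisfying the scaling, growth, monotonicity and convexity conditions, every sufficiently
dense `n`-vertex `r`-graph `G` contains a large family of copies of `H` whose codegrees on
sets of `1 ≤ |S| ≤ ℓ−1` edges are controlled in terms of `λ*(α,H)`. -/
theorem key_lemma {r h ℓ : ℕ} (hr : 2 ≤ r) (hrh : r ≤ h) (hℓ : 1 ≤ ℓ)
    (H : Finset (Finset (Fin h))) (hHu : UniformHG r H) (hHp : MultipartiteHG r H)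
    (hcov : ∀ v : Fin h, ∃ e ∈ H, v ∈ e) (hHe : H.card = ℓ)
    (α A : ℝ) (hα : 0 < α) (hA : 0 < A)
    (f : ℝ → ℝ → ℝ) (δ : ℝ) (hδ : 0 < δ)
    (hcount : ∀ (n : ℕ) (G : Finset (Finset (Fin n))), UniformHG r G →
      A * (n : ℝ) ^ α ≤ (G.card : ℝ) → f n G.card ≤ ((copies H G).ncard : ℝ))
    (hf1 : ∀ n m : ℝ, 0 < n → 0 < m →
      δ * m ^ (((h : ℝ) - α) / ((r : ℝ) - α)) / n ^ (α * ((h : ℝ) - (r : ℝ)) / ((r : ℝ) - α))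
        ≤ f n m)
    (hf2 : ∀ p ∈ Set.Ioc (0 : ℝ) 1, ∀ n m : ℝ, 0 < n → 0 < m →
      δ * f n m * p ^ h ≤ f (n * p) (m * p ^ r))
    (hmono : ∀ n : ℝ, MonotoneOn (f n) (Set.Ici 0))
    (hconv : ∀ n : ℝ, ConvexOn ℝ (Set.Ici 0) (f n)) :
    ∃ k₀ C : ℝ, 0 < k₀ ∧ 1 ≤ C ∧
      ∀ (n : ℕ) (k : ℝ) (G : Finset (Finset (Fin n))),
        UniformHG r G → k₀ ≤ k → (G.card : ℝ) = k * (n : ℝ) ^ α →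
        ∃ 𝓕 : Finset (Finset (Finset (Fin n))),
          (∀ B ∈ 𝓕, IsCopy H G B) ∧
          δ * f n ((G.card : ℝ) / 8) ≤ (𝓕.card : ℝ) ∧
          ∀ S : Finset (Finset (Fin n)), S ⊆ G → 1 ≤ S.card → S.card ≤ ℓ - 1 →
            (degF 𝓕 S : ℝ) ≤
              C * k ^ (-(lamStarHG r α H) * ((S.card : ℝ) - 1)) * (𝓕.card : ℝ) / (G.card : ℝ) := by
  classical
  have hr0 : 0 < r := by omega
  have hH : H.Nonempty := Finset.card_pos.1 (by omega)
  -- on no vertices the empty family works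
  have hzero : ∀ G : Finset (Finset (Fin 0)), UniformHG r G → G = ∅ := by
    intro G hG
    refine Finset.eq_empty_of_forall_notMem fun e he => ?_
    have h1 := hG e he
    rw [Finset.eq_empty_of_isEmpty e, Finset.card_empty] at h1
    omega
  have hf00 : f 0 0 ≤ 0 := by
    have h1 := hcount 0 ∅ (by simp [UniformHG]) (by simp [Real.zero_rpow hα.ne'])
    rw [ncard_copies] at h1
    have h2 : copyFinset H (∅ : Finset (Finset (Fin 0))) = ∅ := by
      refine Finset.eq_empty_of_forall_notMem fun B hB => ?_
      have h3 := mem_copyFinset.1 hB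
      exact (h3.nonempty hH).ne_empty (Finset.subset_empty.1 h3.subset)
    simpa [h2] using h1
  have hempty : ∀ (C k : ℝ) (G : Finset (Finset (Fin 0))), UniformHG r G →
      ∃ 𝓕 : Finset (Finset (Finset (Fin 0))),
          (∀ B ∈ 𝓕, IsCopy H G B) ∧
          δ * f (0 : ℕ) ((G.card : ℝ) / 8) ≤ (𝓕.card : ℝ) ∧
          ∀ S : Finset (Finset (Fin 0)), S ⊆ G → 1 ≤ S.card → S.card ≤ ℓ - 1 →
            (degF 𝓕 S : ℝ) ≤
              C * k ^ (-(lamStarHG r α H) * ((S.card : ℝ) - 1)) * (𝓕.card : ℝ) / (G.card : ℝ) := by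
    intro C k G hG
    obtain rfl := hzero G hG
    refine ⟨∅, by simp, ?_, fun S _ _ _ => by simp [degF]⟩
    simp only [Finset.card_empty, Nat.cast_zero, zero_div]
    exact mul_nonpos_of_nonneg_of_nonpos hδ.le hf00
  rcases le_or_gt (r : ℝ) α with hrα | hαr
  · refine ⟨2, 1, by norm_num, le_rfl, ?_⟩
    intro n k G hG hk hGk
    rcases Nat.eq_zero_or_pos n with rfl | hn
    · exact hempty _ _ G hG
    · exfalso
      have hn1 : (1 : ℝ) ≤ n := by exact_mod_cast hn
      have h1 : (G.card : ℝ) ≤ (n : ℝ) ^ α := by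
        refine le_trans ?_ (Real.rpow_le_rpow_of_exponent_le hn1 hrα)
        rw [Real.rpow_natCast]
        exact_mod_cast card_le_pow_of_uniformHG hG
      have h2 : (0 : ℝ) < (n : ℝ) ^ α := by positivity
      nlinarith
  have hd : 0 < (r : ℝ) - α := by linarith
  set d : ℝ := (r : ℝ) - α with hddef
  have hpos : ∀ n m : ℝ, 0 < n → 0 < m → 0 < f n m := fun n m hn hm =>
    lt_of_lt_of_le (by positivity) (hf1 n m hn hm)
  set K : ℝ := h + 2 * r ^ 2 + (8 * A + 16) ^ (1 / d) with hK
  have hK0 : 0 ≤ (8 * A + 16) ^ (1 / d) := by positivity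
  have hKh : (h : ℝ) ≤ K := by rw [hK]; nlinarith [sq_nonneg (r : ℝ)]
  have hKr : 2 * (r : ℝ) ^ 2 ≤ K := by rw [hK]; linarith [(Nat.cast_nonneg h : (0 : ℝ) ≤ h)]
  have hr1 : (2 : ℝ) ≤ r := by exact_mod_cast hr
  have hK1 : 1 ≤ K := by nlinarith
  have hKd : 8 * A + 16 ≤ K ^ d := by
    have h1 : ((8 * A + 16) ^ (1 / d)) ^ d ≤ K ^ d := by
      refine Real.rpow_le_rpow hK0 ?_ hd.le
      rw [hK]; linarith [(Nat.cast_nonneg h : (0 : ℝ) ≤ h), sq_nonneg (r : ℝ)]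
    rwa [← Real.rpow_mul (by positivity), one_div_mul_cancel hd.ne', Real.rpow_one] at h1
  set c₁ : ℝ := δ * (δ * (8 : ℝ)⁻¹ ^ (((h : ℝ) - α) / d)) with hc₁
  have hc₁0 : 0 < c₁ := by positivity
  set C : ℝ := 1 + 2 / c₁ + 2 ^ (H.card + 4) * (2 * K) ^ h with hC
  have hC1 : 1 ≤ C := by
    have : 0 < 2 / c₁ := by positivity
    have : 0 < 2 ^ (H.card + 4) * (2 * K) ^ h := by positivity
    linarith
  refine ⟨K ^ d + 1, C, by positivity, hC1, ?_⟩
  intro n k G hG hk hGk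
  rcases Nat.eq_zero_or_pos n with rfl | hn
  · exact hempty _ _ G hG
  have hn' : (0 : ℝ) < n := by exact_mod_cast hn
  have hk1 : 1 ≤ k := by
    have : 0 ≤ K ^ d := by positivity
    linarith
  have hk0 : 0 < k := by linarith
  have hG' : (0 : ℝ) < G.card := by rw [hGk]; positivity
  have hGpos : 0 < G.card := by exact_mod_cast hG'
  set P : ℝ := k ^ (-(1 / d)) with hP
  have hP0 : 0 < P := by positivity
  have hPd : P ^ d = k⁻¹ := by
    rw [hP, ← Real.rpow_mul hk0.le, neg_mul, one_div_mul_cancel hd.ne', Real.rpow_neg_one]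
  have hP1 : P ≤ 1 := Real.rpow_le_one_of_one_le_of_nonpos hk1 (by
    rw [neg_nonpos]; positivity)
  have hKP1 : K * P ≤ 1 := by
    by_contra! hlt
    have h1 : 1 < (K * P) ^ d := Real.one_lt_rpow hlt hd
    rw [Real.mul_rpow (by positivity) hP0.le, hPd, ← div_eq_mul_inv, one_lt_div hk0] at h1
    linarith
  have hPn : 1 ≤ P * n := by
    by_contra! hlt
    have h1 : (P * n) ^ d < 1 := Real.rpow_lt_one (by positivity) hlt hd
    rw [Real.mul_rpow hP0.le hn'.le, hPd, inv_mul_lt_iff₀ hk0, mul_one, hddef,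
      Real.rpow_sub hn', Real.rpow_natCast, div_lt_iff₀ (by positivity), ← hGk] at h1
    have h2 : (G.card : ℝ) ≤ (n : ℝ) ^ r := by exact_mod_cast card_le_pow_of_uniformHG hG
    linarith
  set q : ℕ := ⌈K * P * n⌉₊ with hq
  have hKPn : K ≤ K * P * n := by nlinarith
  have hq1 : K * P * n ≤ q := Nat.le_ceil _
  have hq2 : (q : ℝ) < K * P * n + 1 := Nat.ceil_lt_add_one (by positivity)
  have hKq : K ≤ q := hKPn.trans hq1
  have hq0 : (0 : ℝ) < q := by linarith
  have hqn : q ≤ n := Nat.ceil_le.2 (mul_le_of_le_one_left hn'.le hKP1)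
  have hp1 : K * P ≤ (q : ℝ) / n := by rwa [le_div_iff₀ hn']
  have hp2 : (q : ℝ) / n ≤ 2 * K * P := by
    rw [div_le_iff₀ hn']; linarith
  have hy : K ^ d * (q : ℝ) ^ α ≤ (G.card : ℝ) * ((q : ℝ) / n) ^ r := by
    have e : (G.card : ℝ) * ((q : ℝ) / n) ^ r = k * ((q : ℝ) / n) ^ d * (q : ℝ) ^ α := by
      have e1 : ((q : ℝ) / n) ^ r = ((q : ℝ) / n) ^ d * ((q : ℝ) / n) ^ α := by
        rw [← Real.rpow_add (by positivity), hddef, sub_add_cancel, Real.rpow_natCast]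
      rw [e1, hGk, Real.div_rpow hq0.le hn'.le α]
      field_simp
    rw [e]
    gcongr
    have h1 : (K * P) ^ d ≤ ((q : ℝ) / n) ^ d := Real.rpow_le_rpow (by positivity) hp1 hd.le
    rw [Real.mul_rpow (by positivity) hP0.le, hPd] at h1
    calc K ^ d = k * (K ^ d * k⁻¹) := by field_simp
      _ ≤ _ := by gcongr
  have hqα : 1 ≤ (q : ℝ) ^ α := Real.one_le_rpow (hK1.trans hKq) hα.le
  have hfpos : 0 < δ * f n ((G.card : ℝ) / 8) := mul_pos hδ (hpos _ _ hn' (by positivity))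
  set M : ℕ := ⌈δ * f n ((G.card : ℝ) / 8)⌉₊ with hM
  have hMle : δ * f n ((G.card : ℝ) / 8) ≤ M := Nat.le_ceil _
  have hMpos : 0 < M := Nat.ceil_pos.2 hfpos
  have hgrow := growth_bound hrh hαr hf1 hn' hk0 hGk
  rw [← hddef, ← hP] at hgrow
  have hgrow' : c₁ * G.card ≤ M * P ^ (h - r) := by
    calc c₁ * G.card = δ * (δ * (8 : ℝ)⁻¹ ^ (((h : ℝ) - α) / d) * G.card) := by rw [hc₁]; ring
      _ ≤ δ * (f n ((G.card : ℝ) / 8) * P ^ (h - r)) := by gcongr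
      _ = δ * f n ((G.card : ℝ) / 8) * P ^ (h - r) := by ring
      _ ≤ _ := by gcongr
  obtain ⟨F, hFM, hF, hdeg⟩ := exists_family_of_sampling (q := q) (M := M) (P := P) (K := 2 * K)
    (C := C) hH hr0 hcov hcount (fun n m hn hm => (hpos n m hn hm).le) hf2 hmono hG hGpos hMpos
    hqn (by exact_mod_cast hKr.trans hKq) (by exact_mod_cast hKh.trans hKq)
    (by nlinarith) (by nlinarith) hP0 (by linarith) hp2
    (by
      have : 0 < 2 / c₁ := by positivity
      linarith)
    (by
      intro v hrv hvh
      rw [le_div_iff₀ hG']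
      have h1 : P ^ (h - r) ≤ P ^ (v - r) := pow_le_pow_of_le_one hP0.le hP1 (by omega)
      have h2 : 2 / c₁ ≤ C := by
        have : 0 < 2 ^ (H.card + 4) * (2 * K) ^ h := by positivity
        linarith
      calc 2 * (G.card : ℝ) = 2 / c₁ * (c₁ * G.card) := by field_simp
        _ ≤ C * (M * P ^ (h - r)) := by gcongr
        _ ≤ C * (M * P ^ (v - r)) := by gcongr
        _ = C * P ^ (v - r) * M := by ring)
    (fun j hj => Nat.lt_ceil.1 hj)
  refine ⟨F, hF, by rw [hFM]; exact hMle, ?_⟩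
  intro S hSG hS1 hSℓ
  rcases Nat.eq_zero_or_pos (degF F S) with h0 | hdpos
  · rw [h0, Nat.cast_zero]
    positivity
  · obtain ⟨B, hB, hSB⟩ := exists_superset_of_degF_pos hdpos
    refine (hdeg S (Finset.card_pos.1 hS1) hdpos).trans ?_
    rw [hFM]
    gcongr
    exact rpow_pow_le_rpow_lamStarHG hG (hF B hB) hSB hS1 (by omega) hαr hk1
end

section
/- Let H be an r-uniform hypergraph and let α and A be positive constants. Suppose that α > r − 1/m_r(H) and that ex(n,H) ≤ A·n^α for all n. Then there exists a constant C depending only on α, A, and H such that for all n, there are at most 2^{C·n^α} H-free r-uniform hypergraphs on n vertices. -/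
set_option autoImplicit false

open Finset Filter MeasureTheory

/-- The probability that a `q`-random subset of `X` equals `R`. -/
noncomputable def randWeight {V : Type*} (X : Finset V) (q : ℝ) (R : Finset V) : ℝ :=
  q ^ R.card * (1 - q) ^ (X.card - R.card)

/-- The probability that a `q`-random subset of `X` belongs to `D`. -/
noncomputable def randMeas {V : Type*} (X : Finset V) (q : ℝ) (D : Finset (Finset V)) : ℝ :=
  ∑ R ∈ D, randWeight X q R

/-- The subsets of `X` whose union with `L` belongs to `D`. -/
def linkFamily {V : Type*} [DecidableEq V] (X : Finset V) (D : Finset (Finset V))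
    (L : Finset V) : Finset (Finset V) :=
  X.powerset.filter fun R => R ∪ L ∈ D

section RandomSubset

variable {V : Type*} {X : Finset V} {q : ℝ} {D : Finset (Finset V)}

lemma randWeight_nonneg (h0 : 0 ≤ q) (h1 : q ≤ 1) (R : Finset V) : 0 ≤ randWeight X q R :=
  mul_nonneg (pow_nonneg h0 _) (pow_nonneg (by linarith) _)

lemma randMeas_mono (h0 : 0 ≤ q) (h1 : q ≤ 1) {D' : Finset (Finset V)} (h : D' ⊆ D) :
    randMeas X q D' ≤ randMeas X q D :=
  sum_le_sum_of_subset_of_nonneg h fun _ _ _ => randWeight_nonneg h0 h1 _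

lemma randMeas_le_one (h0 : 0 ≤ q) (h1 : q ≤ 1) (hD : D ⊆ X.powerset) :
    randMeas X q D ≤ 1 := by
  refine (randMeas_mono h0 h1 hD).trans ?_
  simp only [randMeas, randWeight]
  rw [Finset.sum_pow_mul_eq_add_pow]
  simp

lemma pow_le_randMeas (h0 : 0 ≤ q) (h1 : q ≤ 1) (hD : ∅ ∈ D) :
    (1 - q) ^ X.card ≤ randMeas X q D := by
  have := single_le_sum (f := randWeight X q) (fun R _ => randWeight_nonneg h0 h1 R) hD
  simpa [randMeas, randWeight] using this

variable [DecidableEq V]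

lemma sum_randWeight_filter_mem (F : Finset V → ℝ) {a : V} (ha : a ∈ X) :
    ∑ R ∈ X.powerset, randWeight X q R * (if a ∈ R then F R else 0) =
      q * ∑ R ∈ X.powerset, randWeight X q R * F (insert a R) := by
  obtain ⟨Y, haY, rfl⟩ : ∃ Y, a ∉ Y ∧ insert a Y = X := ⟨X.erase a, by simp, by simp [ha]⟩
  rw [sum_powerset_insert haY, sum_powerset_insert haY, ← sum_add_distrib, ← sum_add_distrib,
    mul_sum]
  refine sum_congr rfl fun R hR => ?_
  have hRY : R ⊆ Y := mem_powerset.1 hR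
  have haR : a ∉ R := fun h => haY (hRY h)
  have hc : R.card ≤ Y.card := card_le_card hRY
  simp only [randWeight, haR, if_false, mem_insert_self, if_true, card_insert_of_notMem haR,
    card_insert_of_notMem haY, insert_idem]
  rw [show Y.card + 1 - R.card = (Y.card - R.card) + 1 by omega,
    show Y.card + 1 - (R.card + 1) = Y.card - R.card by omega]
  ring

lemma sum_randWeight_filter_subset (F : Finset V → ℝ) {A : Finset V} (hA : A ⊆ X) :
    ∑ R ∈ X.powerset, randWeight X q R * (if A ⊆ R then F R else 0) =
      q ^ A.card * ∑ R ∈ X.powerset, randWeight X q R * F (R ∪ A) := by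
  induction A using Finset.induction_on generalizing F with
  | empty => simp
  | insert a A ha ih =>
    have hA' : A ⊆ X := (subset_insert _ _).trans hA
    have haX : a ∈ X := hA (mem_insert_self _ _)
    have h1 := ih (fun R => if a ∈ R then F R else 0) hA'
    have h2 := sum_randWeight_filter_mem (q := q) (fun R => F (R ∪ A)) haX
    rw [card_insert_of_notMem ha, pow_succ, mul_assoc]
    calc _ = ∑ R ∈ X.powerset,
          randWeight X q R * (if A ⊆ R then (if a ∈ R then F R else 0) else 0) := by
            refine sum_congr rfl fun R _ => ?_
            simp only [insert_subset_iff]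
            by_cases h : a ∈ R <;> by_cases h' : A ⊆ R <;> simp [h, h']
      _ = _ := by
        rw [h1]
        congr 1
        simp only [mem_union, ha, or_false]
        rw [h2]
        congr 1
        refine sum_congr rfl fun R _ => ?_
        rw [insert_union, union_insert]

/-- Conditioning a random subset on containing `A`. -/
lemma sum_filter_subset_eq_randMeas_linkFamily (hD : D ⊆ X.powerset) {A : Finset V}
    (hA : A ⊆ X) :
    ∑ R ∈ D, randWeight X q R * (if A ⊆ R then 1 else 0) =
      q ^ A.card * randMeas X q (linkFamily X D A) := by
  have h := sum_randWeight_filter_subset (q := q) (fun R => if R ∈ D then (1 : ℝ) else 0) hA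
  rw [randMeas, linkFamily, sum_filter]
  calc _ = ∑ R ∈ X.powerset,
        randWeight X q R * (if A ⊆ R then (if R ∈ D then (1 : ℝ) else 0) else 0) := by
          rw [← sum_subset hD]
          · refine sum_congr rfl fun R hR => by simp [hR]
          · intro R _ hR
            simp [hR]
    _ = _ := by
      rw [h]
      congr 1
      refine sum_congr rfl fun R _ => by simp

lemma linkFamily_subset (hlow : ∀ R ∈ D, ∀ R' ⊆ R, R' ∈ D) (L : Finset V) :
    linkFamily X D L ⊆ D := by
  intro R hR
  exact hlow _ (mem_filter.1 hR).2 _ subset_union_left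

end RandomSubset

section Container

variable {V : Type*} [DecidableEq V] {X : Finset V} {q ε δ : ℝ} {k : ℕ}
  {D : Finset (Finset V)}

/-- No small member of `D` has an atypically light link family. -/
def LinkStable (X : Finset V) (q ε : ℝ) (k : ℕ) (D : Finset (Finset V)) : Prop :=
  ∀ L ∈ D, L.card < k → (1 - ε) * randMeas X q D ≤ randMeas X q (linkFamily X D L)

/-- The minimal subsets of `X` outside `D`, of size at most `k`. -/
def minNonmembers (X : Finset V) (k : ℕ) (D : Finset (Finset V)) : Finset (Finset V) :=
  X.powerset.filter fun E => E ∉ D ∧ E.card ≤ k ∧ ∀ E' ∈ E.ssubsets, E' ∈ D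

lemma exists_linkStable_fingerprint (hq0 : 0 < q) (hq1 : q < 1) (hε : 0 < ε) (hε1 : ε < 1)
    (D : Finset (Finset V)) (hD : D ⊆ X.powerset) (hlow : ∀ R ∈ D, ∀ R' ⊆ R, R' ∈ D) :
    ∃ f : Finset V → Finset (Finset V), ∀ I ∈ D, ∃ S ⊆ I,
      ε * S.card ≤ k * (Real.log (randMeas X q D) - Real.log ((1 - q) ^ X.card)) ∧
      ∀ T, S ⊆ T → T ⊆ I → I ∈ f T ∧ f T ⊆ D ∧ (∀ R ∈ f T, ∀ R' ⊆ R, R' ∈ f T) ∧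
        LinkStable X q ε k (f T) := by
  induction hc : D.card using Nat.strong_induction_on generalizing D with
  | _ c ih =>
  have hpow : 0 < (1 - q) ^ X.card := pow_pos (by linarith) _
  by_cases hst : LinkStable X q ε k D
  · refine ⟨fun _ => D, fun I hI => ⟨∅, empty_subset _, ?_, fun T _ _ => ⟨hI, subset_rfl, hlow, hst⟩⟩⟩
    have := Real.log_le_log hpow
      (pow_le_randMeas (X := X) hq0.le hq1.le (hlow I hI ∅ (empty_subset _)))
    simp only [card_empty, Nat.cast_zero, mul_zero]
    exact mul_nonneg (Nat.cast_nonneg _) (by linarith)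
  · simp only [LinkStable, not_forall, not_le] at hst
    obtain ⟨L, hL, hLk, hlt⟩ := hst
    have hsubY : linkFamily X D L ⊆ D := linkFamily_subset hlow L
    have hssY : linkFamily X D L ⊂ D := by
      refine hsubY.ssubset_of_ne fun h => ?_
      rw [h] at hlt
      have : 0 ≤ randMeas X q D := hpow.le.trans
        (pow_le_randMeas hq0.le hq1.le (hlow L hL ∅ (empty_subset _)))
      nlinarith
    have hssN : D.filter (fun R => ¬ L ⊆ R) ⊂ D := by
      refine (filter_subset _ _).ssubset_of_ne fun h => ?_
      have := h ▸ hL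
      simp at this
    have hlowY : ∀ R ∈ linkFamily X D L, ∀ R' ⊆ R, R' ∈ linkFamily X D L := by
      intro R hR R' hR'
      rw [linkFamily, mem_filter, mem_powerset] at hR ⊢
      exact ⟨hR'.trans hR.1, hlow _ hR.2 _ (union_subset_union_left hR')⟩
    have hlowN : ∀ R ∈ D.filter (fun R => ¬ L ⊆ R), ∀ R' ⊆ R,
        R' ∈ D.filter (fun R => ¬ L ⊆ R) := by
      intro R hR R' hR'
      rw [mem_filter] at hR ⊢
      exact ⟨hlow _ hR.1 _ hR', fun h => hR.2 (h.trans hR')⟩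
    obtain ⟨fY, hfY⟩ := ih _ (hc ▸ card_lt_card hssY) _ (hsubY.trans hD) hlowY rfl
    obtain ⟨fN, hfN⟩ := ih _ (hc ▸ card_lt_card hssN) _ ((filter_subset _ _).trans hD) hlowN rfl
    refine ⟨fun T => if L ⊆ T then fY T else fN T, fun I hI => ?_⟩
    by_cases hLI : L ⊆ I
    · have hIY : I ∈ linkFamily X D L := by
        rw [linkFamily, mem_filter, union_eq_left.2 hLI]
        exact ⟨hD hI, hI⟩
      obtain ⟨S, hSI, hS, hST⟩ := hfY I hIY
      refine ⟨S ∪ L, union_subset hSI hLI, ?_, fun T h1 h2 => ?_⟩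
      · have hposY : 0 < randMeas X q (linkFamily X D L) := hpow.trans_le
          (pow_le_randMeas hq0.le hq1.le (hlowY I hIY ∅ (empty_subset _)))
        have hposD : 0 < randMeas X q D := hpow.trans_le
          (pow_le_randMeas hq0.le hq1.le (hlow I hI ∅ (empty_subset _)))
        have h3 : Real.log (randMeas X q (linkFamily X D L)) ≤
            Real.log (randMeas X q D) - ε := by
          have h4 := Real.log_le_log hposY hlt.le
          rw [Real.log_mul (by linarith) hposD.ne'] at h4
          have h5 := Real.log_le_sub_one_of_pos (show 0 < 1 - ε by linarith)
          linarith
        have h6 : ((S ∪ L).card : ℝ) ≤ S.card + k := by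
          exact_mod_cast (card_union_le S L).trans (by omega)
        have hk : (0 : ℝ) ≤ k := Nat.cast_nonneg _
        nlinarith
      · have hLT : L ⊆ T := subset_union_right.trans h1
        simp only [hLT, if_true]
        obtain ⟨h4, h5, h6⟩ := hST T (subset_union_left.trans h1) h2
        exact ⟨h4, h5.trans hsubY, h6⟩
    · have hIN : I ∈ D.filter (fun R => ¬ L ⊆ R) := mem_filter.2 ⟨hI, hLI⟩
      obtain ⟨S, hSI, hS, hST⟩ := hfN I hIN
      refine ⟨S, hSI, hS.trans ?_, fun T h1 h2 => ?_⟩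
      · have hposN : 0 < randMeas X q (D.filter (fun R => ¬ L ⊆ R)) := hpow.trans_le
          (pow_le_randMeas hq0.le hq1.le (hlowN I hIN ∅ (empty_subset _)))
        gcongr
        exact randMeas_mono hq0.le hq1.le (filter_subset _ _)
      · have hLT : ¬ L ⊆ T := fun h => hLI (h.trans h2)
        simp only [hLT, if_false]
        obtain ⟨h4, h5, h6⟩ := hST T h1 h2
        exact ⟨h4, h5.trans (filter_subset _ _), h6⟩

/-- The weighted degree of a set `T` in the hypergraph `G`. -/
noncomputable def weightedDeg (q : ℝ) (G : Finset (Finset V)) (T : Finset V) : ℝ :=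
  ∑ E ∈ G.filter (T ⊆ ·), q ^ (E \ T).card

lemma weightedDeg_nonneg (hq0 : 0 ≤ q) (G : Finset (Finset V)) (T : Finset V) :
    0 ≤ weightedDeg q G T :=
  sum_nonneg fun _ _ => pow_nonneg hq0 _

lemma mem_minNonmembers {E : Finset V} :
    E ∈ minNonmembers X k D ↔ E ⊆ X ∧ E ∉ D ∧ E.card ≤ k ∧ ∀ E' ⊂ E, E' ∈ D := by
  simp [minNonmembers]

lemma weightedDeg_of_mem {T : Finset V} (hT : T ∈ minNonmembers X k D) :
    weightedDeg q (minNonmembers X k D) T = 1 := by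
  rw [weightedDeg, show (minNonmembers X k D).filter (T ⊆ ·) = {T} from ?_]
  · simp
  ext E
  simp only [mem_filter, mem_singleton]
  constructor
  · rintro ⟨hE, hTE⟩
    by_contra hne
    exact (mem_minNonmembers.1 hT).2.1
      ((mem_minNonmembers.1 hE).2.2.2 T (hTE.ssubset_of_ne (Ne.symm hne)))
  · rintro rfl
    exact ⟨hT, subset_rfl⟩

/-- Second moment bound for the number of edges at `T` completed by a random member of `D`. -/
lemma sq_weightedDeg_le (hq0 : 0 < q) (hq1 : q < 1) (hε1 : ε < 1)
    (hD : D ⊆ X.powerset) (hlow : ∀ R ∈ D, ∀ R' ⊆ R, R' ∈ D) (hemp : ∅ ∈ D)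
    (hst : LinkStable X q ε k D) {T : Finset V} (hT : T.Nonempty) (hTD : T ∈ D)
    (hTk : T.card < k) :
    ((1 - ε) * weightedDeg q (minNonmembers X k D) T) ^ 2 ≤
      ε * ∑ E ∈ (minNonmembers X k D).filter (T ⊆ ·),
        ∑ E' ∈ (minNonmembers X k D).filter (T ⊆ ·), q ^ (E \ T ∪ E' \ T).card := by
  set G := (minNonmembers X k D).filter (T ⊆ ·) with hG
  set Z := randMeas X q D with hZ
  have hZpos : 0 < Z := (pow_pos (by linarith) _).trans_le
    (pow_le_randMeas (X := X) hq0.le hq1.le hemp)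
  set N : Finset V → ℝ := fun R => ∑ E ∈ G, (if E \ T ⊆ R then 1 else 0) with hN
  have hw := fun R => randWeight_nonneg (X := X) hq0.le hq1.le R
  have hEX : ∀ E ∈ G, E ⊆ X := fun E hE => (mem_minNonmembers.1 (mem_filter.1 hE).1).1
  have hN0 : ∀ R ∈ linkFamily X D T, N R = 0 := by
    intro R hR
    refine sum_eq_zero fun E hE => ?_
    rw [if_neg]
    intro hsub
    have h1 : R ∪ T ∈ D := (mem_filter.1 hR).2
    refine (mem_minNonmembers.1 (mem_filter.1 hE).1).2.1 (hlow _ h1 _ ?_)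
    rw [← sdiff_union_of_subset (mem_filter.1 hE).2]
    exact union_subset_union_left hsub
  have hlower : (1 - ε) * Z * weightedDeg q (minNonmembers X k D) T ≤
      ∑ R ∈ D, randWeight X q R * N R := by
    simp only [hN, mul_sum, weightedDeg]
    rw [sum_comm]
    refine sum_le_sum fun E hE => ?_
    rw [sum_filter_subset_eq_randMeas_linkFamily hD (sdiff_subset.trans (hEX E hE)), mul_comm]
    obtain ⟨hE1, hTE⟩ := mem_filter.1 hE
    obtain ⟨_, _, hEk, hmin⟩ := mem_minNonmembers.1 hE1
    have hss : E \ T ⊂ E := sdiff_ssubset hTE hT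
    exact mul_le_mul_of_nonneg_left (hst _ (hmin _ hss) ((card_lt_card hss).trans_le hEk))
      (pow_nonneg hq0.le _)
  have hupper : ∑ R ∈ D, randWeight X q R * N R ^ 2 ≤
      Z * ∑ E ∈ G, ∑ E' ∈ G, q ^ (E \ T ∪ E' \ T).card := by
    simp only [hN, sq, Finset.sum_mul_sum]
    simp only [mul_sum]
    rw [sum_comm]
    refine sum_le_sum fun E hE => ?_
    rw [sum_comm]
    refine sum_le_sum fun E' hE' => ?_
    have h1 := sum_filter_subset_eq_randMeas_linkFamily (q := q) hD
      (A := E \ T ∪ E' \ T) (union_subset (sdiff_subset.trans (hEX E hE))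
        (sdiff_subset.trans (hEX E' hE')))
    have h2 : ∑ R ∈ D, randWeight X q R *
        ((if E \ T ⊆ R then (1 : ℝ) else 0) * (if E' \ T ⊆ R then 1 else 0)) =
        ∑ R ∈ D, randWeight X q R * (if E \ T ∪ E' \ T ⊆ R then 1 else 0) := by
      refine sum_congr rfl fun R _ => ?_
      by_cases h3 : E \ T ⊆ R <;> by_cases h4 : E' \ T ⊆ R <;> simp [union_subset_iff, h3, h4]
    rw [h2, h1, mul_comm]
    exact mul_le_mul_of_nonneg_right (randMeas_mono hq0.le hq1.le (linkFamily_subset hlow _))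
      (pow_nonneg hq0.le _)
  set B := D \ linkFamily X D T with hB
  have hmassB : ∑ R ∈ B, randWeight X q R ≤ ε * Z := by
    have h1 := sum_sdiff (f := randWeight X q) (linkFamily_subset (X := X) hlow T)
    have h2 := hst T hTD hTk
    simp only [randMeas] at h2 hZ
    rw [hB]
    simp only [← hZ] at h1 h2
    linarith
  have hsumB : ∑ R ∈ D, randWeight X q R * N R = ∑ R ∈ B, randWeight X q R * N R := by
    refine (sum_subset sdiff_subset fun R hR hRB => ?_).symm
    have : R ∈ linkFamily X D T := by simpa [hB, hR] using hRB
    rw [hN0 R this, mul_zero]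
  have hCS : (∑ R ∈ B, randWeight X q R * N R) ^ 2 ≤
      (∑ R ∈ B, randWeight X q R) * ∑ R ∈ B, randWeight X q R * N R ^ 2 := by
    refine sum_sq_le_sum_mul_sum_of_sq_le_mul B (fun R _ => hw R)
      (fun R _ => mul_nonneg (hw R) (sq_nonneg _)) fun R _ => le_of_eq (by ring)
  have hBD : ∑ R ∈ B, randWeight X q R * N R ^ 2 ≤ ∑ R ∈ D, randWeight X q R * N R ^ 2 :=
    sum_le_sum_of_subset_of_nonneg sdiff_subset fun R _ _ => mul_nonneg (hw R) (sq_nonneg _)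
  set Q := ∑ E ∈ G, ∑ E' ∈ G, q ^ (E \ T ∪ E' \ T).card
  have hd0 := weightedDeg_nonneg hq0.le (minNonmembers X k D) T
  have hfin : ((1 - ε) * Z * weightedDeg q (minNonmembers X k D) T) ^ 2 ≤ (ε * Z) * (Z * Q) := by
    calc _ ≤ (∑ R ∈ D, randWeight X q R * N R) ^ 2 := by
          refine pow_le_pow_left₀ ?_ hlower 2
          exact mul_nonneg (mul_nonneg (by linarith) hZpos.le) hd0
      _ ≤ _ := by
        rw [hsumB]
        refine hCS.trans (mul_le_mul hmassB (hBD.trans hupper) ?_ ?_)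
        · exact sum_nonneg fun R _ => mul_nonneg (hw R) (sq_nonneg _)
        · exact (sum_nonneg fun R _ => hw R).trans hmassB
  have hZ2 : 0 < Z ^ 2 := by positivity
  refine le_of_mul_le_mul_left ?_ hZ2
  calc _ = ((1 - ε) * Z * weightedDeg q (minNonmembers X k D) T) ^ 2 := by ring
    _ ≤ _ := hfin
    _ = _ := by ring

lemma weightedDeg_le (hq0 : 0 < q) (hq1 : q < 1) (hδ0 : 0 < δ) (hδ1 : δ ≤ 1)
    (hD : D ⊆ X.powerset) (hlow : ∀ R ∈ D, ∀ R' ⊆ R, R' ∈ D) (hemp : ∅ ∈ D)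
    (hst : LinkStable X q (δ / 2 ^ (k + 3)) k D) (T : Finset V) (hT : T.Nonempty)
    (hTG : T ∉ minNonmembers X k D) :
    weightedDeg q (minNonmembers X k D) T ≤ δ := by
  induction hc : k + 1 - T.card using Nat.strong_induction_on generalizing T with
  | _ c ih =>
  set ε := δ / 2 ^ (k + 3) with hεdef
  have hpow : (0 : ℝ) < 2 ^ k := by positivity
  have hε0 : 0 < ε := by positivity
  have hε2 : ε * 2 ^ k = δ / 8 := by
    rw [hεdef, pow_add]; field_simp; norm_num
  have hε8 : ε ≤ 1 / 8 := by
    have : (1 : ℝ) ≤ 2 ^ k := one_le_pow₀ (by norm_num)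
    nlinarith
  by_cases hne : ((minNonmembers X k D).filter (T ⊆ ·)).Nonempty
  swap
  · rw [weightedDeg, not_nonempty_iff_eq_empty.1 hne, sum_empty]
    exact hδ0.le
  obtain ⟨E₀, hE₀⟩ := hne
  obtain ⟨hE₀G, hTE₀⟩ := mem_filter.1 hE₀
  obtain ⟨_, _, hE₀k, hmin⟩ := mem_minNonmembers.1 hE₀G
  have hss : T ⊂ E₀ := hTE₀.ssubset_of_ne (fun h => hTG (h ▸ hE₀G))
  have hTD : T ∈ D := hmin T hss
  have hTk : T.card < k := (card_lt_card hss).trans_le hE₀k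
  have hsq := sq_weightedDeg_le hq0 hq1 (by linarith) hD hlow hemp hst hT hTD hTk
  have hd0 := weightedDeg_nonneg hq0.le (minNonmembers X k D) T
  have hinner : ∀ E ∈ (minNonmembers X k D).filter (T ⊆ ·),
      ∑ E' ∈ (minNonmembers X k D).filter (T ⊆ ·), q ^ (E \ T ∪ E' \ T).card ≤
        q ^ (E \ T).card * (weightedDeg q (minNonmembers X k D) T + 2 ^ k) := by
    intro E hE
    obtain ⟨hEG, hTE⟩ := mem_filter.1 hE
    have hEk := (mem_minNonmembers.1 hEG).2.2.1
    calc _ = q ^ (E \ T).card *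
          ∑ E' ∈ (minNonmembers X k D).filter (T ⊆ ·), q ^ (E' \ E).card := by
            rw [mul_sum]
            refine sum_congr rfl fun E' _ => ?_
            rw [← pow_add, ← card_union_of_disjoint]
            · congr 2
              ext x
              simp only [mem_union, Finset.mem_sdiff]
              have := @hTE x
              tauto
            · exact disjoint_left.2 fun x hx hx' =>
                (Finset.mem_sdiff.1 hx').2 (Finset.mem_sdiff.1 hx).1
      _ ≤ _ := by
        refine mul_le_mul_of_nonneg_left ?_ (pow_nonneg hq0.le _)
        calc _ ≤ ∑ E' ∈ (minNonmembers X k D).filter (T ⊆ ·),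
              ∑ T' ∈ E.powerset.filter (T ⊆ ·),
                (if T' ⊆ E' then q ^ (E' \ T').card else 0) := by
                refine sum_le_sum fun E' hE' => ?_
                have hmem : E' ∩ E ∈ E.powerset.filter (T ⊆ ·) := by
                  rw [mem_filter, mem_powerset]
                  exact ⟨inter_subset_right, subset_inter (mem_filter.1 hE').2 hTE⟩
                refine le_trans (le_of_eq ?_) (single_le_sum
                  (f := fun T' => if T' ⊆ E' then q ^ (E' \ T').card else 0) ?_ hmem)
                · simp only [inter_subset_left, if_true, sdiff_inter_self_left]
                · intro T' _
                  split_ifs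
                  · exact pow_nonneg hq0.le _
                  · exact le_rfl
          _ ≤ ∑ T' ∈ E.powerset.filter (T ⊆ ·), weightedDeg q (minNonmembers X k D) T' := by
                rw [sum_comm]
                refine sum_le_sum fun T' hT' => ?_
                rw [weightedDeg, sum_filter, sum_filter]
                refine sum_le_sum fun E' _ => ?_
                by_cases h1 : T ⊆ E'
                · simp [h1]
                · rw [if_neg h1]
                  split_ifs
                  · exact pow_nonneg hq0.le _
                  · exact le_rfl
          _ ≤ _ := by
                have hTmem : T ∈ E.powerset.filter (T ⊆ ·) := by simp [hTE]
                rw [← add_sum_erase _ _ hTmem]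
                refine add_le_add le_rfl ?_
                calc _ ≤ ∑ T' ∈ (E.powerset.filter (T ⊆ ·)).erase T, (1 : ℝ) := by
                      refine sum_le_sum fun T' hT' => ?_
                      obtain ⟨hne, h1⟩ := mem_erase.1 hT'
                      obtain ⟨h2, h3⟩ := mem_filter.1 h1
                      by_cases hG : T' ∈ minNonmembers X k D
                      · exact (weightedDeg_of_mem hG).le
                      · have hlt : T.card < T'.card :=
                          card_lt_card (h3.ssubset_of_ne (Ne.symm hne))
                        have hle : T'.card ≤ E.card := card_le_card (mem_powerset.1 h2)
                        exact (ih _ (by omega) T' (hT.mono h3) hG rfl).trans hδ1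
                  _ ≤ _ := by
                      rw [sum_const, nsmul_eq_mul, mul_one]
                      have h1 : ((E.powerset.filter (T ⊆ ·)).erase T).card ≤ 2 ^ E.card := by
                        rw [← card_powerset]
                        exact card_le_card ((erase_subset _ _).trans (filter_subset _ _))
                      have h2 : 2 ^ E.card ≤ 2 ^ k := Nat.pow_le_pow_right (by norm_num) hEk
                      exact_mod_cast h1.trans h2
  have hsum : ((1 - ε) * weightedDeg q (minNonmembers X k D) T) ^ 2 ≤
      ε * (weightedDeg q (minNonmembers X k D) T *
        (weightedDeg q (minNonmembers X k D) T + 2 ^ k)) := by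
    refine hsq.trans (mul_le_mul_of_nonneg_left ?_ hε0.le)
    refine (sum_le_sum hinner).trans (le_of_eq ?_)
    rw [← sum_mul]
    rfl
  set d := weightedDeg q (minNonmembers X k D) T
  by_contra hlt
  push Not at hlt
  have hdpos : 0 < d := hδ0.trans hlt
  have h1 : (1 - ε) ^ 2 * d ≤ ε * (d + 2 ^ k) := by
    refine le_of_mul_le_mul_left ?_ hdpos
    calc d * ((1 - ε) ^ 2 * d) = ((1 - ε) * d) ^ 2 := by ring
      _ ≤ _ := hsum
      _ = _ := by ring
  have h2 : (1 / 2) * d ≤ ((1 - ε) ^ 2 - ε) * d := by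
    refine mul_le_mul_of_nonneg_right ?_ hdpos.le
    nlinarith
  nlinarith

lemma sum_minNonmembers_le (hq0 : 0 < q) (hq1 : q < 1) (hδ0 : 0 < δ) (hδ1 : δ ≤ 1)
    (hD : D ⊆ X.powerset) (hlow : ∀ R ∈ D, ∀ R' ⊆ R, R' ∈ D) (hemp : ∅ ∈ D)
    (hst : LinkStable X q (δ / 2 ^ (k + 3)) k D) :
    ∑ E ∈ (minNonmembers X k D).filter (2 ≤ ·.card), q ^ E.card ≤ δ * q * X.card := by
  calc _ ≤ ∑ E ∈ (minNonmembers X k D).filter (2 ≤ ·.card),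
        ∑ v ∈ X.filter ({·} ∉ minNonmembers X k D),
          (if {v} ⊆ E then q * q ^ (E \ {v}).card else 0) := by
        refine sum_le_sum fun E hE => ?_
        obtain ⟨hEG, hE2⟩ := mem_filter.1 hE
        obtain ⟨hEX, hED, _, hmin⟩ := mem_minNonmembers.1 hEG
        obtain ⟨v, hv⟩ := card_pos.1 (show 0 < E.card by omega)
        have hvE : {v} ⊂ E := by
          refine (singleton_subset_iff.2 hv).ssubset_of_ne ?_
          rintro rfl
          simp at hE2
        have hmem : v ∈ X.filter ({·} ∉ minNonmembers X k D) :=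
          mem_filter.2 ⟨hEX hv, fun h => (mem_minNonmembers.1 h).2.1 (hmin _ hvE)⟩
        refine le_trans (le_of_eq ?_) (single_le_sum
          (f := fun v => if {v} ⊆ E then q * q ^ (E \ {v}).card else 0) ?_ hmem)
        · simp only [hvE.1, if_true]
          rw [← pow_succ', sdiff_singleton_eq_erase, card_erase_add_one hv]
        · intro v _
          split_ifs
          · positivity
          · exact le_rfl
    _ ≤ ∑ v ∈ X.filter ({·} ∉ minNonmembers X k D),
          q * weightedDeg q (minNonmembers X k D) {v} := by
        rw [sum_comm]
        refine sum_le_sum fun v _ => ?_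
        rw [weightedDeg, mul_sum, ← sum_filter]
        refine sum_le_sum_of_subset_of_nonneg (filter_subset_filter _ (filter_subset _ _)) ?_
        intros
        positivity
    _ ≤ ∑ v ∈ X.filter ({·} ∉ minNonmembers X k D), q * δ := by
        refine sum_le_sum fun v hv => mul_le_mul_of_nonneg_left ?_ hq0.le
        exact weightedDeg_le hq0 hq1 hδ0 hδ1 hD hlow hemp hst {v} (singleton_nonempty v)
          (mem_filter.1 hv).2
    _ ≤ _ := by
        rw [sum_const, nsmul_eq_mul]
        have : ((X.filter ({·} ∉ minNonmembers X k D)).card : ℝ) ≤ X.card := by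
          exact_mod_cast card_filter_le _ _
        calc _ ≤ (X.card : ℝ) * (q * δ) := by gcongr
          _ = _ := by ring

/-- A hypergraph container lemma: the members of a lower family `D` are covered by containers,
determined by small fingerprints, in each of which the small nonmembers of `D` have a cover of
small weight. -/
theorem exists_containers (k : ℕ) (hq0 : 0 < q) (hq1 : q ≤ 1 / 2) (hδ0 : 0 < δ) (hδ1 : δ ≤ 1)
    (hD : D ⊆ X.powerset) (hlow : ∀ R ∈ D, ∀ R' ⊆ R, R' ∈ D) :
    ∃ f : Finset V → Finset V, ∀ I ∈ D, ∃ S ⊆ I,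
      (S.card : ℝ) ≤ k * 2 ^ (k + 4) / δ * (q * X.card) ∧ I ⊆ f S ∧ f S ⊆ X ∧
      ∃ G : Finset (Finset V), (∀ E ∈ G, 2 ≤ E.card ∧ E ⊆ f S) ∧
        (∀ A ⊆ f S, A ∉ D → A.card ≤ k → ∃ E ∈ G, E ⊆ A) ∧
        ∑ E ∈ G, q ^ E.card ≤ δ * q * X.card := by
  have hε0 : 0 < δ / 2 ^ (k + 3) := by positivity
  have hε1 : δ / 2 ^ (k + 3) < 1 := by
    rw [div_lt_one (by positivity)]
    exact hδ1.trans_lt (one_lt_pow₀ (by norm_num) (by omega))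
  obtain ⟨f, hf⟩ := exists_linkStable_fingerprint (k := k) hq0 (by linarith) hε0 hε1 D hD hlow
  refine ⟨fun S => X.filter fun v => {v} ∈ f S, fun I hI => ?_⟩
  obtain ⟨S, hSI, hS, hfS⟩ := hf I hI
  obtain ⟨hIf, hfD, hflow, hst⟩ := hfS S subset_rfl hSI
  refine ⟨S, hSI, ?_, ?_, filter_subset _ _, ?_⟩
  · have h1 : Real.log (randMeas X q D) ≤ 0 := by
      refine Real.log_nonpos ?_ (randMeas_le_one hq0.le (by linarith) hD)
      exact sum_nonneg fun R _ => randWeight_nonneg hq0.le (by linarith) R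
    have h2 : -(2 * q) ≤ Real.log (1 - q) := by
      have h3 := Real.one_sub_inv_le_log_of_pos (show 0 < 1 - q by linarith)
      have h4 : (1 - q)⁻¹ ≤ 1 + 2 * q := by
        rw [inv_le_iff_one_le_mul₀ (by linarith)]
        nlinarith
      linarith
    rw [Real.log_pow] at hS
    have h5 : (X.card : ℝ) * -(2 * q) ≤ X.card * Real.log (1 - q) :=
      mul_le_mul_of_nonneg_left h2 (Nat.cast_nonneg _)
    have h6 : δ / 2 ^ (k + 3) * S.card ≤ k * (2 * (q * X.card)) :=
      hS.trans (mul_le_mul_of_nonneg_left (by linarith) (Nat.cast_nonneg _))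
    rw [div_mul_eq_mul_div, div_le_iff₀ (by positivity)] at h6
    rw [div_mul_eq_mul_div, le_div_iff₀ hδ0]
    calc (S.card : ℝ) * δ = δ * S.card := mul_comm _ _
      _ ≤ _ := h6
      _ = _ := by ring
  · intro v hv
    rw [mem_filter]
    exact ⟨mem_powerset.1 (hD hI) hv, hflow I hIf _ (singleton_subset_iff.2 hv)⟩
  · have hemp : ∅ ∈ f S := hflow I hIf _ (empty_subset _)
    have hmin : ∀ A ⊆ X.filter (fun v => {v} ∈ f S), A ∉ D → A.card ≤ k →
        ∃ E ⊆ A, E ∈ minNonmembers X k (f S) ∧ 2 ≤ E.card := by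
      intro A hA hAD hAk
      obtain ⟨E, hEA, hEmin⟩ := exists_minimal_le_of_wellFoundedLT (fun E => E ∉ f S) A
        (fun h => hAD (hfD h))
      have hEf := hEmin.1
      refine ⟨E, hEA, mem_minNonmembers.2 ⟨hEA.trans (hA.trans (filter_subset _ _)), hEf,
        (card_le_card hEA).trans hAk, fun E' hE' => ?_⟩, ?_⟩
      · by_contra h
        exact hE'.2 (hEmin.2 h hE'.1)
      · by_contra hlt
        have : E.card = 0 ∨ E.card = 1 := by omega
        rcases this with h0 | h1
        · rw [card_eq_zero.1 h0] at hEf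
          exact hEf hemp
        · obtain ⟨v, rfl⟩ := card_eq_one.1 h1
          exact hEf (mem_filter.1 (hA (hEA (mem_singleton_self v)))).2
    refine ⟨(minNonmembers X k (f S)).filter
      (fun E => 2 ≤ E.card ∧ E ⊆ X.filter fun v => {v} ∈ f S), ?_, ?_, ?_⟩
    · intro E hE
      exact (mem_filter.1 hE).2
    · intro A hA hAD hAk
      obtain ⟨E, hEA, hE, hE2⟩ := hmin A hA hAD hAk
      exact ⟨E, mem_filter.2 ⟨hE, hE2, hEA.trans hA⟩, hEA⟩
    · refine le_trans ?_ (sum_minNonmembers_le hq0 (by linarith) hδ0 hδ1 (hfD.trans hD) hflow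
        hemp hst)
      refine sum_le_sum_of_subset_of_nonneg ?_ fun _ _ _ => pow_nonneg hq0.le _
      intro E hE
      rw [mem_filter] at hE ⊢
      exact ⟨hE.1, hE.2.1⟩

end Container

section Supersaturation

lemma card_filter_superset_eq {n l : ℕ} (B : Finset (Fin n)) (hB : B.card ≤ l) :
    ((powersetCard l (univ : Finset (Fin n))).filter (B ⊆ ·)).card =
      (n - B.card).choose (l - B.card) := by
  have h : (n - B.card).choose (l - B.card) = (powersetCard (l - B.card) Bᶜ).card := by
    rw [card_powersetCard, card_compl, Fintype.card_fin]
  rw [h]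
  refine card_bij' (fun R _ => R \ B) (fun S _ => S ∪ B) ?_ ?_ ?_ ?_
  · intro R hR
    obtain ⟨h1, h2⟩ := mem_filter.1 hR
    rw [mem_powersetCard] at h1 ⊢
    refine ⟨fun x hx => mem_compl.2 (Finset.mem_sdiff.1 hx).2, ?_⟩
    rw [card_sdiff_of_subset h2, h1.2]
  · intro S hS
    rw [mem_powersetCard] at hS
    have hd : Disjoint S B := disjoint_left.2 fun x hx => mem_compl.1 (hS.1 hx)
    rw [mem_filter, mem_powersetCard, card_union_of_disjoint hd, hS.2]
    exact ⟨⟨subset_univ _, by omega⟩, subset_union_right⟩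
  · intro R hR
    exact sdiff_union_of_subset (mem_filter.1 hR).2
  · intro S hS
    rw [mem_powersetCard] at hS
    have hd : Disjoint S B := disjoint_left.2 fun x hx => mem_compl.1 (hS.1 hx)
    exact union_sdiff_cancel_right hd

lemma choose_sub_mul_pow_le {n l r : ℕ} (hln : l ≤ n) (j : ℕ) (hj : r + j ≤ l) :
    (n - (r + j)).choose (l - (r + j)) * n ^ j ≤ (n - r).choose (l - r) * l ^ j := by
  induction j with
  | zero => simp
  | succ j ih =>
    have ih := ih (by omega)
    obtain ⟨N, hN⟩ : ∃ N, n - (r + j) = N + 1 := ⟨n - (r + j) - 1, by omega⟩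
    obtain ⟨L, hL⟩ : ∃ L, l - (r + j) = L + 1 := ⟨l - (r + j) - 1, by omega⟩
    have h1 : n - (r + (j + 1)) = N := by omega
    have h2 : l - (r + (j + 1)) = L := by omega
    rw [hN, hL] at ih
    rw [h1, h2]
    have h3 := Nat.add_one_mul_choose_eq N L
    have h4 : (L + 1) * n ≤ l * (N + 1) := by
      have h5 : n = N + 1 + (r + j) := by omega
      have h6 : l = L + 1 + (r + j) := by omega
      have h7 : L ≤ N := by omega
      have h8 : (L + 1) * (r + j) ≤ (r + j) * (N + 1) := by
        rw [mul_comm]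
        exact Nat.mul_le_mul_left _ (by omega)
      rw [h5, h6]
      linarith
    refine Nat.le_of_mul_le_mul_left ?_ (Nat.succ_pos N)
    calc (N + 1) * (N.choose L * n ^ (j + 1))
        = ((N + 1) * N.choose L) * n ^ (j + 1) := by ring
      _ = ((N + 1).choose (L + 1) * n ^ j) * ((L + 1) * n) := by rw [h3]; ring
      _ ≤ ((n - r).choose (l - r) * l ^ j) * (l * (N + 1)) := Nat.mul_le_mul ih h4
      _ = (N + 1) * ((n - r).choose (l - r) * l ^ (j + 1)) := by ring

lemma choose_mul_pow_le {n l r : ℕ} (hr : 1 ≤ r) (hrl : r ≤ l) (hln : l ≤ n) (i : ℕ)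
    (hi : i ≤ r) :
    n.choose l * l ^ i ≤ (r * n) ^ i * (n - i).choose (l - i) := by
  induction i with
  | zero => simp
  | succ i ih =>
    have ih := ih (by omega)
    obtain ⟨N, hN⟩ : ∃ N, n - i = N + 1 := ⟨n - i - 1, by omega⟩
    obtain ⟨L, hL⟩ : ∃ L, l - i = L + 1 := ⟨l - i - 1, by omega⟩
    have h1 : n - (i + 1) = N := by omega
    have h2 : l - (i + 1) = L := by omega
    rw [hN, hL] at ih
    rw [h1, h2]
    have h3 := Nat.add_one_mul_choose_eq N L
    have h4 : l ≤ r * (L + 1) := by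
      obtain ⟨s, rfl⟩ : ∃ s, r = s + 1 := ⟨r - 1, by omega⟩
      have h5 : l ≤ L + 1 + s := by omega
      nlinarith [Nat.zero_le (s * L)]
    have h5 : N + 1 ≤ n := by omega
    refine Nat.le_of_mul_le_mul_left ?_ (Nat.succ_pos L)
    calc (L + 1) * (n.choose l * l ^ (i + 1))
        = (n.choose l * l ^ i) * ((L + 1) * l) := by ring
      _ ≤ ((r * n) ^ i * (N + 1).choose (L + 1)) * ((L + 1) * l) :=
          Nat.mul_le_mul_right _ ih
      _ = (r * n) ^ i * ((N + 1).choose (L + 1) * (L + 1)) * l := by ring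
      _ = (r * n) ^ i * N.choose L * ((N + 1) * l) := by rw [← h3]; ring
      _ ≤ (r * n) ^ i * N.choose L * (n * (r * (L + 1))) := by gcongr
      _ = (L + 1) * ((r * n) ^ (i + 1) * N.choose L) := by ring

variable {r h n : ℕ} {H : Finset (Finset (Fin h))}

lemma card_le_exN {m : ℕ} {G : Finset (Finset (Fin m))} (hG : UniformHG r G)
    (hf : HFree H G) : G.card ≤ exN r H m := by
  refine le_csSup ⟨Fintype.card (Finset (Fin m)), ?_⟩ ⟨G, hG, hf, rfl⟩
  rintro _ ⟨G', _, _, rfl⟩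
  exact card_le_univ G'

/-- An `H`-free hypergraph all of whose edges lie in a set `R` has at most `ex(|R|, H)` edges. -/
lemma card_le_exN_of_subset {G : Finset (Finset (Fin n))} (hG : UniformHG r G)
    (hf : HFree H G) (R : Finset (Fin n)) (hR : ∀ e ∈ G, e ⊆ R) :
    G.card ≤ exN r H R.card := by
  set g : Fin R.card ↪ Fin n := (R.orderEmbOfFin rfl).toEmbedding with hg
  have hrange : ∀ x ∈ R, ∃ i, g i = x := by
    intro x hx
    have : x ∈ Set.range (R.orderEmbOfFin rfl) := by
      rw [range_orderEmbOfFin]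
      exact hx
    exact this
  set G' : Finset (Finset (Fin R.card)) := univ.filter fun e => e.image g ∈ G with hG'
  have himg : G'.image (fun e => e.image g) = G := by
    ext e
    simp only [hG', mem_image, mem_filter, mem_univ, true_and]
    constructor
    · rintro ⟨a, ha, rfl⟩
      exact ha
    · intro he
      have : (univ.filter fun i => g i ∈ e).image g = e := by
        ext x
        simp only [mem_image, mem_filter, mem_univ, true_and]
        constructor
        · rintro ⟨i, hi, rfl⟩
          exact hi
        · intro hx
          obtain ⟨i, rfl⟩ := hrange x (hR e he hx)
          exact ⟨i, hx, rfl⟩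
      exact ⟨_, by rwa [this], this⟩
  have hcard : G'.card = G.card := by
    rw [← himg, card_image_of_injective _ (image_injective g.injective)]
  rw [← hcard]
  refine card_le_exN ?_ ?_
  · intro e he
    rw [← card_image_of_injective e g.injective]
    exact hG _ (mem_filter.1 he).2
  · rintro A ⟨f, hfinj, rfl, hA⟩
    refine hf _ ⟨g ∘ f, g.injective.comp hfinj, rfl, fun e he => ?_⟩
    obtain ⟨e', he', rfl⟩ := mem_image.1 he
    rw [← image_image]
    exact (mem_filter.1 (hA (mem_image_of_mem _ he'))).2

lemma vertsHG_image {V W : Type*} [DecidableEq V] [DecidableEq W] (f : V → W)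
    (F : Finset (Finset V)) :
    vertsHG (F.image fun e => e.image f) = (vertsHG F).image f := by
  ext x
  simp only [vertsHG, mem_biUnion, mem_image, id]
  constructor
  · rintro ⟨_, ⟨e, he, rfl⟩, hx⟩
    obtain ⟨v, hv, rfl⟩ := mem_image.1 hx
    exact ⟨v, ⟨e, he, hv⟩, rfl⟩
  · rintro ⟨v, ⟨e, he, hv⟩, rfl⟩
    exact ⟨_, ⟨e, he, rfl⟩, mem_image_of_mem _ hv⟩

lemma card_le_card_vertsHG {V : Type*} [DecidableEq V] {F : Finset (Finset V)}
    (hF : UniformHG r F) (hne : F.Nonempty) : r ≤ (vertsHG F).card := by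
  obtain ⟨e, he⟩ := hne
  rw [← hF e he]
  exact card_le_card (subset_biUnion_of_mem id he)

/-- A cover `G` of the copies of `H` in `C` leaves at most `ex(l, H)` edges uncovered in any
set of `l` vertices. -/
lemma card_filter_le_exN_add {C : Finset (Finset (Fin n))} {G : Finset (Finset (Finset (Fin n)))}
    (hC : UniformHG r C) (hGne : ∀ E ∈ G, E.Nonempty)
    (hcov : ∀ A, IsCopy H C A → ∃ E ∈ G, E ⊆ A) (R : Finset (Fin n)) :
    (C.filter (· ⊆ R)).card ≤ exN r H R.card + (G.filter (vertsHG · ⊆ R)).card := by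
  choose! e he using hGne
  set Dl := (G.filter (vertsHG · ⊆ R)).image e with hDl
  have hfree : HFree H (C.filter (· ⊆ R) \ Dl) := by
    rintro A ⟨f, hf, rfl, hA⟩
    obtain ⟨E, hE, hEA⟩ := hcov _ ⟨f, hf, rfl, hA.trans (sdiff_subset.trans (filter_subset _ _))⟩
    have h1 : vertsHG E ⊆ R := by
      refine biUnion_subset.2 fun x hx => ?_
      exact (mem_filter.1 (Finset.mem_sdiff.1 (hA (hEA hx))).1).2
    have h2 : e E ∈ Dl := mem_image_of_mem _ (mem_filter.2 ⟨hE, h1⟩)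
    exact (Finset.mem_sdiff.1 (hA (hEA (he E hE)))).2 h2
  have h1 : (C.filter (· ⊆ R) \ Dl).card ≤ exN r H R.card := by
    refine card_le_exN_of_subset (fun x hx => hC x ?_) hfree R fun x hx => ?_
    · exact (mem_filter.1 (Finset.mem_sdiff.1 hx).1).1
    · exact (mem_filter.1 (Finset.mem_sdiff.1 hx).1).2
  have h2 : (C.filter (· ⊆ R)).card ≤ (C.filter (· ⊆ R) \ Dl).card + Dl.card := by
    have := le_card_sdiff Dl (C.filter (· ⊆ R))
    omega
  have h3 : Dl.card ≤ (G.filter (vertsHG · ⊆ R)).card := card_image_le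
  omega

/-- Supersaturation: copies of `H` in a dense hypergraph have no cover of small weight. -/
lemma card_le_of_cover {θ q δ M : ℝ} (hHu : UniformHG r H)
    (hθ : ∀ F ⊆ H, F.Nonempty → θ * ((F.card : ℝ) - 1) ≤ ((vertsHG F).card : ℝ) - r)
    {l : ℕ} (hr : 1 ≤ r) (hrl : r ≤ l) (hln : l ≤ n) (hq0 : 0 < q)
    (hq : ((l : ℝ) / n) ^ θ ≤ q)
    {C : Finset (Finset (Fin n))} {G : Finset (Finset (Finset (Fin n)))}
    (hC : UniformHG r C) (hG2 : ∀ E ∈ G, E.Nonempty)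
    (hcov : ∀ A, IsCopy H C A → ∃ E ∈ G, E ⊆ A)
    (hw : ∑ E ∈ G, q ^ E.card ≤ δ * q * M) :
    (C.card : ℝ) - δ * M ≤ exN r H l * ((r : ℝ) * n / l) ^ r := by
  classical
  set G' := G.filter fun E => ∃ A, IsCopy H C A ∧ E ⊆ A with hG'
  have hcov' : ∀ A, IsCopy H C A → ∃ E ∈ G', E ⊆ A := by
    intro A hA
    obtain ⟨E, hE, hEA⟩ := hcov A hA
    exact ⟨E, mem_filter.2 ⟨hE, A, hA, hEA⟩, hEA⟩
  have hl0 : (0 : ℝ) < l := by exact_mod_cast hr.trans hrl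
  have hn0 : (0 : ℝ) < n := by exact_mod_cast (hr.trans hrl).trans hln
  have hp0 : (0 : ℝ) < (l : ℝ) / n := div_pos hl0 hn0
  have hp1 : (l : ℝ) / n ≤ 1 := by
    rw [div_le_one hn0]
    exact_mod_cast hln
  set P := powersetCard l (univ : Finset (Fin n)) with hP
  set c : ℝ := (((n - r).choose (l - r) : ℕ) : ℝ) with hc
  have hc0 : 0 < c := by
    rw [hc]
    exact_mod_cast Nat.choose_pos (by omega)
  have hcountC : ∑ R ∈ P, ((C.filter (· ⊆ R)).card : ℝ) = C.card * c := by
    simp only [card_filter, Nat.cast_sum]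
    rw [sum_comm]
    simp only [← Nat.cast_sum, ← card_filter]
    rw [Nat.cast_sum, sum_congr rfl (g := fun _ => c), sum_const, nsmul_eq_mul]
    intro e he
    rw [hP, card_filter_superset_eq e (by rw [hC e he]; exact hrl), hC e he]
  have hcountG : ∑ R ∈ P, ((G'.filter (vertsHG · ⊆ R)).card : ℝ) ≤ c * (δ * M) := by
    simp only [card_filter, Nat.cast_sum]
    rw [sum_comm]
    simp only [← Nat.cast_sum, ← card_filter]
    have hterm : ∀ E ∈ G', ((P.filter (vertsHG E ⊆ ·)).card : ℝ) ≤ c * q⁻¹ * q ^ E.card := by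
      intro E hE
      obtain ⟨hEG, A, ⟨f, hf, rfl, hA⟩, hEA⟩ := mem_filter.1 hE
      obtain ⟨F, hFH, rfl⟩ := subset_image_iff.1 hEA
      have hFne : F.Nonempty := by
        have := hG2 _ hEG
        simpa using this
      have hFv : (vertsHG (F.image fun e => e.image f)).card = (vertsHG F).card := by
        rw [vertsHG_image, card_image_of_injective _ hf]
      have hFc : (F.image fun e => e.image f).card = F.card :=
        card_image_of_injective _ (image_injective hf)
      have hrv := card_le_card_vertsHG (fun e he => hHu e (hFH he)) hFne
      have hdens := hθ F hFH hFne
      obtain ⟨j, hj⟩ := Nat.exists_eq_add_of_le hrv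
      rw [hFc]
      by_cases hvl : (vertsHG F).card ≤ l
      · rw [hP, card_filter_superset_eq _ (hFv ▸ hvl), hFv]
        have h1 := choose_sub_mul_pow_le hln j (hj ▸ hvl)
        rw [← hj] at h1
        have h2 : ((n - (vertsHG F).card).choose (l - (vertsHG F).card) : ℝ) ≤
            c * ((l : ℝ) / n) ^ j := by
          rw [div_pow, mul_div_assoc', le_div_iff₀ (by positivity), hc]
          exact_mod_cast h1
        refine h2.trans ?_
        rw [mul_assoc]
        refine mul_le_mul_of_nonneg_left ?_ hc0.le
        have h3 : q⁻¹ * q ^ F.card = q ^ (F.card - 1) := by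
          obtain ⟨s, hs⟩ : ∃ s, F.card = s + 1 := ⟨F.card - 1, by have := hFne.card_pos; omega⟩
          rw [hs, pow_succ', Nat.add_sub_cancel]
          field_simp
        rw [h3]
        calc ((l : ℝ) / n) ^ j = ((l : ℝ) / n) ^ (j : ℝ) := (Real.rpow_natCast _ _).symm
          _ ≤ ((l : ℝ) / n) ^ (θ * ((F.card - 1 : ℕ) : ℝ)) := by
              refine Real.rpow_le_rpow_of_exponent_ge hp0 hp1 ?_
              rw [Nat.cast_sub hFne.card_pos]
              push_cast
              rw [hj] at hdens
              push_cast at hdens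
              linarith
          _ = (((l : ℝ) / n) ^ θ) ^ (F.card - 1) := by
              rw [Real.rpow_mul hp0.le, Real.rpow_natCast]
          _ ≤ q ^ (F.card - 1) := pow_le_pow_left₀ (Real.rpow_nonneg hp0.le _) hq _
      · have h1 : P.filter (vertsHG (F.image fun e => e.image f) ⊆ ·) = ∅ := by
          refine filter_eq_empty_iff.2 fun R hR hsub => hvl ?_
          rw [← hFv, ← (mem_powersetCard.1 hR).2]
          exact card_le_card hsub
        rw [h1]
        simp only [card_empty, Nat.cast_zero]
        positivity
    rw [Nat.cast_sum]
    calc _ ≤ ∑ E ∈ G', c * q⁻¹ * q ^ E.card := sum_le_sum hterm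
      _ = c * q⁻¹ * ∑ E ∈ G', q ^ E.card := by rw [mul_sum]
      _ ≤ c * q⁻¹ * (δ * q * M) := by
          refine mul_le_mul_of_nonneg_left (le_trans ?_ hw) (by positivity)
          exact sum_le_sum_of_subset_of_nonneg (filter_subset _ _) fun _ _ _ =>
            pow_nonneg hq0.le _
      _ = c * (δ * M) := by field_simp
  have hmain : C.card * c ≤ (n.choose l : ℝ) * exN r H l + c * (δ * M) := by
    rw [← hcountC]
    calc _ ≤ ∑ R ∈ P, ((exN r H l : ℝ) + (G'.filter (vertsHG · ⊆ R)).card) := by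
          refine sum_le_sum fun R hR => ?_
          have := card_filter_le_exN_add hC (fun E hE => hG2 E (mem_filter.1 hE).1) hcov' R
          rw [(mem_powersetCard.1 hR).2] at this
          exact_mod_cast this
      _ ≤ _ := by
          rw [sum_add_distrib, sum_const, nsmul_eq_mul, hP, card_powersetCard, card_univ,
            Fintype.card_fin]
          exact add_le_add le_rfl hcountG
  have hchoose : (n.choose l : ℝ) ≤ ((r : ℝ) * n / l) ^ r * c := by
    have h1 := choose_mul_pow_le hr hrl hln r le_rfl
    rw [div_pow, div_mul_eq_mul_div, le_div_iff₀ (by positivity), hc]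
    exact_mod_cast h1
  refine le_of_mul_le_mul_right ?_ hc0
  calc ((C.card : ℝ) - δ * M) * c = C.card * c - c * (δ * M) := by ring
    _ ≤ n.choose l * exN r H l := by linarith
    _ ≤ ((r : ℝ) * n / l) ^ r * c * exN r H l :=
        mul_le_mul_of_nonneg_right hchoose (Nat.cast_nonneg _)
    _ = _ := by ring

end Supersaturation

section Counting

/-- The `H`-free subgraphs of `X`. -/
noncomputable def freeSubgraphs {h n : ℕ} (H : Finset (Finset (Fin h)))
    (X : Finset (Finset (Fin n))) : Finset (Finset (Finset (Fin n))) :=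
  open Classical in X.powerset.filter (HFree H)

lemma mem_freeSubgraphs {h n : ℕ} {H : Finset (Finset (Fin h))}
    {X I : Finset (Finset (Fin n))} : I ∈ freeSubgraphs H X ↔ I ⊆ X ∧ HFree H I := by
  classical
  simp [freeSubgraphs]

lemma HFree.mono {h n : ℕ} {H : Finset (Finset (Fin h))} {G G' : Finset (Finset (Fin n))}
    (hG : HFree H G) (hsub : G' ⊆ G) : HFree H G' := by
  rintro A ⟨f, hf, hA, hAG⟩
  exact hG A ⟨f, hf, hA, hAG.trans hsub⟩

/-- Every dense `r`-graph admits a family of containers of at most half its size. -/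
lemma exists_halving_containers {r h : ℕ} {H : Finset (Finset (Fin h))} (hHu : UniformHG r H)
    {α A θ : ℝ} (hA0 : 0 < A) (hr : 1 ≤ r) (hαr : α < r) (hθα : (r : ℝ) - α < θ)
    (hθ : ∀ F ⊆ H, F.Nonempty → θ * ((F.card : ℝ) - 1) ≤ ((vertsHG F).card : ℝ) - r)
    (hex : ∀ n : ℕ, (exN r H n : ℝ) ≤ A * (n : ℝ) ^ α) :
    ∃ C₀ D K s : ℝ, 0 < C₀ ∧ 0 < D ∧ 0 < K ∧ 1 < s ∧ ∀ n : ℕ, 1 ≤ n →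
      ∀ X : Finset (Finset (Fin n)), UniformHG r X → C₀ * (n : ℝ) ^ α < X.card →
      ∃ q : ℝ, 0 < q ∧ q ≤ 1 / 2 ∧ q ≤ D * ((n : ℝ) ^ α / X.card) ^ s ∧
        ∃ f : Finset (Finset (Fin n)) → Finset (Finset (Fin n)),
          ∀ I ∈ freeSubgraphs H X, ∃ S ⊆ I, (S.card : ℝ) ≤ K * (q * X.card) ∧ I ⊆ f S ∧
            f S ⊆ X ∧ ((f S).card : ℝ) ≤ X.card / 2 := by
  set β : ℝ := r - α with hβ
  have hβ0 : 0 < β := by linarith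
  have hθ0 : 0 < θ := hβ0.trans hθα
  set s : ℝ := θ / β with hs
  have hs1 : 1 < s := (one_lt_div hβ0).2 hθα
  have hs0 : 0 < s := by linarith
  have hr0 : (0 : ℝ) < r := by exact_mod_cast hr
  set B : ℝ := max r ((4 * A * (r : ℝ) ^ r) ^ (1 / β)) with hB
  have hBr : (r : ℝ) ≤ B := le_max_left _ _
  have hB0 : 0 < B := hr0.trans_le hBr
  have hB1 : 1 ≤ B := le_trans (by exact_mod_cast hr) hBr
  have hBβ : 4 * A * (r : ℝ) ^ r ≤ B ^ β := by
    calc _ = ((4 * A * (r : ℝ) ^ r) ^ (1 / β)) ^ β := by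
          rw [← Real.rpow_mul (by positivity), one_div_mul_cancel hβ0.ne', Real.rpow_one]
      _ ≤ _ := Real.rpow_le_rpow (by positivity) (le_max_right _ _) hβ0.le
  set D : ℝ := (2 * B) ^ θ with hD
  have hD0 : 0 < D := by positivity
  set C₀ : ℝ := (2 * D) ^ (1 / s) with hC₀
  have hC₀0 : 0 < C₀ := by positivity
  refine ⟨C₀, D, (H.card : ℝ) * 2 ^ (H.card + 4) / (1 / 4) + 1, s, hC₀0, hD0, by positivity, hs1,
    fun n hn X hX hXc => ?_⟩
  have hn0 : (0 : ℝ) < n := by exact_mod_cast hn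
  have hnα : 0 < (n : ℝ) ^ α := Real.rpow_pos_of_pos hn0 _
  have hX0 : (0 : ℝ) < X.card := (mul_pos hC₀0 hnα).trans hXc
  set t : ℝ := (n : ℝ) ^ α / X.card with ht
  have ht0 : 0 < t := div_pos hnα hX0
  have htC : t ≤ 1 / C₀ := by
    rw [ht, div_le_div_iff₀ hX0 hC₀0]
    linarith
  have hq2 : D * t ^ s ≤ 1 / 2 := by
    have h1 : t ^ s ≤ (1 / C₀) ^ s := Real.rpow_le_rpow ht0.le htC hs0.le
    have h2 : (1 / C₀) ^ s = 1 / (2 * D) := by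
      rw [Real.div_rpow zero_le_one hC₀0.le, Real.one_rpow, hC₀, ← Real.rpow_mul (by positivity),
        one_div_mul_cancel hs0.ne', Real.rpow_one]
    calc D * t ^ s ≤ D * (1 / (2 * D)) := by rw [← h2]; gcongr
      _ = _ := by field_simp
  set y : ℝ := n * (B * t ^ (1 / β)) with hy
  have hXn : (X.card : ℝ) ≤ (n : ℝ) ^ r := by
    have h1 : X ⊆ powersetCard r univ := fun e he => mem_powersetCard.2 ⟨subset_univ _, hX e he⟩
    have h2 := card_le_card h1
    rw [card_powersetCard, card_univ, Fintype.card_fin] at h2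
    exact_mod_cast h2.trans (Nat.choose_le_pow n r)
  have htn : (n : ℝ) ^ (-β) ≤ t := by
    rw [ht, le_div_iff₀ hX0]
    calc _ ≤ (n : ℝ) ^ (-β) * (n : ℝ) ^ r :=
          mul_le_mul_of_nonneg_left hXn (Real.rpow_nonneg hn0.le _)
      _ = _ := by
          rw [← Real.rpow_natCast, ← Real.rpow_add hn0]
          congr 1
          rw [hβ]
          ring
  have hyB : B ≤ y := by
    have h1 : ((n : ℝ) ^ (-β)) ^ (1 / β) ≤ t ^ (1 / β) :=
      Real.rpow_le_rpow (Real.rpow_nonneg hn0.le _) htn (by positivity)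
    rw [← Real.rpow_mul hn0.le, show -β * (1 / β) = -1 by field_simp, Real.rpow_neg_one] at h1
    calc B = n * (B * (n : ℝ)⁻¹) := by field_simp
      _ ≤ y := by rw [hy]; gcongr
  have hy0 : 0 < y := hB0.trans_le hyB
  set p : ℝ := 2 * B * t ^ (1 / β) with hp
  have hp0 : 0 < p := by positivity
  have hpθ : p ^ θ = D * t ^ s := by
    rw [hp, Real.mul_rpow (by positivity) (by positivity), ← Real.rpow_mul ht0.le, hs, hD]
    congr 2
    ring
  have hp1 : p ≤ 1 := by
    by_contra hlt
    push Not at hlt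
    have := Real.one_lt_rpow hlt hθ0
    linarith
  set l : ℕ := ⌈y⌉₊ with hl
  have hyl : y ≤ l := Nat.le_ceil y
  have hly : (l : ℝ) ≤ n * p := by
    have := (Nat.ceil_lt_add_one hy0.le).le
    calc (l : ℝ) ≤ y + 1 := this
      _ ≤ y + y := by linarith
      _ = _ := by rw [hy, hp]; ring
  have hln : l ≤ n := by
    have : (l : ℝ) ≤ n := hly.trans (mul_le_of_le_one_right hn0.le hp1)
    exact_mod_cast this
  have hrl : r ≤ l := by
    have : (r : ℝ) ≤ l := hBr.trans (hyB.trans hyl)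
    exact_mod_cast this
  have hl0 : (0 : ℝ) < l := hy0.trans_le hyl
  have hq0 : 0 < D * t ^ s := by positivity
  refine ⟨D * t ^ s, hq0, hq2, le_rfl, ?_⟩
  obtain ⟨f, hf⟩ := exists_containers (X := X) (D := freeSubgraphs H X) (δ := 1 / 4) H.card hq0 hq2
    (by norm_num) (by norm_num)
    (fun I hI => mem_powerset.2 (mem_freeSubgraphs.1 hI).1)
    (fun R hR R' hR' => mem_freeSubgraphs.2
      ⟨hR'.trans (mem_freeSubgraphs.1 hR).1, (mem_freeSubgraphs.1 hR).2.mono hR'⟩)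
  refine ⟨f, fun I hI => ?_⟩
  obtain ⟨S, hSI, hS, hIf, hfX, G, hG, hcov, hw⟩ := hf I hI
  refine ⟨S, hSI, hS.trans ?_, hIf, hfX, ?_⟩
  · refine mul_le_mul_of_nonneg_right (by linarith) (by positivity)
  have hsat := card_le_of_cover hHu hθ hr hrl hln hq0
    (hpθ ▸ Real.rpow_le_rpow (by positivity) ((div_le_iff₀ hn0).2 (by linarith)) hθ0.le)
    (C := f S) (G := G) (fun e he => hX e (hfX he))
    (fun E hE => card_pos.1 (by have := (hG E hE).1; omega)) ?_ hw
  · have h1 : (exN r H l : ℝ) * ((r : ℝ) * n / l) ^ r ≤ 1 / 4 * X.card := by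
      have h2 : (l : ℝ) ^ α * ((r : ℝ) * n / l) ^ r = (r : ℝ) ^ r * (n : ℝ) ^ r * (l : ℝ) ^ (-β) := by
        have h3 : (l : ℝ) ^ (-β) = (l : ℝ) ^ α / (l : ℝ) ^ r := by
          rw [← Real.rpow_natCast (l : ℝ) r, ← Real.rpow_sub hl0]
          congr 1
          rw [hβ]
          ring
        rw [h3, div_pow, mul_pow]
        ring
      have h4 : (l : ℝ) ^ (-β) ≤ y ^ (-β) :=
        Real.rpow_le_rpow_of_nonpos hy0 hyl (by linarith)
      have h5 : (n : ℝ) ^ r * y ^ (-β) = B ^ (-β) * X.card := by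
        rw [hy, Real.mul_rpow hn0.le (by positivity), Real.mul_rpow hB0.le (by positivity),
          ← Real.rpow_mul ht0.le, show 1 / β * -β = -1 by field_simp, Real.rpow_neg_one,
          ← Real.rpow_natCast (n : ℝ) r]
        have h6 : (n : ℝ) ^ (r : ℝ) * (n : ℝ) ^ (-β) = (n : ℝ) ^ α := by
          rw [← Real.rpow_add hn0]
          congr 1
          rw [hβ]
          ring
        calc _ = ((n : ℝ) ^ (r : ℝ) * (n : ℝ) ^ (-β)) * B ^ (-β) * t⁻¹ := by ring
          _ = _ := by
            rw [h6, ht]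
            field_simp
      have h7 : A * (r : ℝ) ^ r * B ^ (-β) ≤ 1 / 4 := by
        rw [Real.rpow_neg hB0.le, ← div_eq_mul_inv, div_le_iff₀ (by positivity)]
        linarith
      calc _ ≤ A * (l : ℝ) ^ α * ((r : ℝ) * n / l) ^ r :=
            mul_le_mul_of_nonneg_right (hex l) (by positivity)
        _ = A * (r : ℝ) ^ r * ((n : ℝ) ^ r * (l : ℝ) ^ (-β)) := by rw [mul_assoc, h2]; ring
        _ ≤ A * (r : ℝ) ^ r * ((n : ℝ) ^ r * y ^ (-β)) := by gcongr
        _ = A * (r : ℝ) ^ r * B ^ (-β) * X.card := by rw [h5]; ring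
        _ ≤ _ := by gcongr
    linarith
  · rintro A' ⟨g, hg, rfl, hA'⟩
    refine hcov _ hA' (fun hmem => ?_) card_image_le
    exact (mem_freeSubgraphs.1 hmem).2 _ ⟨g, hg, rfl, subset_rfl⟩

lemma card_filter_card_le_exp {V : Type*} (X : Finset V) {x s : ℝ} (hx0 : 0 < x) (hx1 : x ≤ 1) :
    ((X.powerset.filter fun S => (S.card : ℝ) ≤ s).card : ℝ) ≤
      Real.exp (x * X.card - s * Real.log x) := by
  have h1 : ((X.powerset.filter fun S => (S.card : ℝ) ≤ s).card : ℝ) * x ^ s ≤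
      Real.exp (x * X.card) := by
    calc _ = ∑ S ∈ X.powerset.filter (fun S => (S.card : ℝ) ≤ s), x ^ s := by
          rw [sum_const, nsmul_eq_mul]
      _ ≤ ∑ S ∈ X.powerset.filter (fun S => (S.card : ℝ) ≤ s), x ^ S.card := by
          refine sum_le_sum fun S hS => ?_
          rw [← Real.rpow_natCast]
          exact Real.rpow_le_rpow_of_exponent_ge hx0 hx1 (mem_filter.1 hS).2
      _ ≤ ∑ S ∈ X.powerset, x ^ S.card :=
          sum_le_sum_of_subset_of_nonneg (filter_subset _ _) fun _ _ _ => pow_nonneg hx0.le _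
      _ = (x + 1) ^ X.card := by
          rw [← Finset.sum_pow_mul_eq_add_pow]
          simp
      _ ≤ Real.exp x ^ X.card :=
          pow_le_pow_left₀ (by positivity) (Real.add_one_le_exp x) _
      _ = _ := by rw [← Real.exp_nat_mul, mul_comm]
  rw [Real.exp_sub, le_div_iff₀ (Real.exp_pos _)]
  rwa [Real.rpow_def_of_pos hx0, mul_comm (Real.log x)] at h1

/-- The number of `H`-free subgraphs is controlled by iterating halving containers. -/
lemma card_freeSubgraphs_halving {h n : ℕ} {H : Finset (Finset (Fin h))}
    {X : Finset (Finset (Fin n))} {q K N : ℝ} (hq0 : 0 < q) (hq1 : q ≤ 1)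
    {f : Finset (Finset (Fin n)) → Finset (Finset (Fin n))}
    (hf : ∀ I ∈ freeSubgraphs H X, ∃ S ⊆ I, (S.card : ℝ) ≤ K * (q * X.card) ∧ I ⊆ f S ∧
      f S ⊆ X ∧ ((f S).card : ℝ) ≤ X.card / 2) (hN0 : 0 ≤ N)
    (hN : ∀ Y ⊆ X, (Y.card : ℝ) ≤ X.card / 2 → ((freeSubgraphs H Y).card : ℝ) ≤ N) :
    ((freeSubgraphs H X).card : ℝ) ≤
      Real.exp (q * X.card - K * (q * X.card) * Real.log q) * N := by
  classical
  set P := X.powerset.filter fun S => (S.card : ℝ) ≤ K * (q * X.card) with hP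
  set P' := P.filter fun S => f S ⊆ X ∧ ((f S).card : ℝ) ≤ X.card / 2 with hP'
  have hsub : freeSubgraphs H X ⊆ P'.biUnion fun S => freeSubgraphs H (f S) := by
    intro I hI
    obtain ⟨S, hSI, hS, hIf, hfX, hfc⟩ := hf I hI
    obtain ⟨hIX, hIfree⟩ := mem_freeSubgraphs.1 hI
    refine mem_biUnion.2 ⟨S, ?_, mem_freeSubgraphs.2 ⟨hIf, hIfree⟩⟩
    exact mem_filter.2 ⟨mem_filter.2 ⟨mem_powerset.2 (hSI.trans hIX), hS⟩, hfX, hfc⟩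
  calc ((freeSubgraphs H X).card : ℝ) ≤ ∑ S ∈ P', ((freeSubgraphs H (f S)).card : ℝ) := by
        exact_mod_cast (card_le_card hsub).trans card_biUnion_le
    _ ≤ ∑ S ∈ P', N := by
        refine sum_le_sum fun S hS => ?_
        obtain ⟨_, h1, h2⟩ := mem_filter.1 hS
        exact hN _ h1 h2
    _ = P'.card * N := by rw [sum_const, nsmul_eq_mul]
    _ ≤ P.card * N := by
        refine mul_le_mul_of_nonneg_right ?_ hN0
        exact_mod_cast card_le_card (filter_subset _ _)
    _ ≤ _ := mul_le_mul_of_nonneg_right (card_filter_card_le_exp X hq0 hq1) hN0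

lemma fingerprint_exponent_le {q K D s a m : ℝ} (hq0 : 0 < q) (hq1 : q ≤ 1) (hK : 0 < K)
    (hD : 0 < D) (hs : 1 < s) (ha : 0 < a) (hm : 0 < m) (hq : q ≤ D * (a / m) ^ s) :
    q * m - K * (q * m) * Real.log q ≤
      (1 + K * (2 * s / (s - 1))) * D ^ ((s + 1) / (2 * s)) * (a * (a / m) ^ ((s - 1) / 2)) := by
  have hs0 : 0 < s := by linarith
  have hs1 : 0 < s - 1 := by linarith
  set η : ℝ := (s - 1) / (2 * s) with hη
  have hη0 : 0 < η := by positivity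
  have ht : 0 < a / m := div_pos ha hm
  have hη1 : 1 - η = (s + 1) / (2 * s) := by
    rw [hη]
    field_simp
    ring
  have hlog : -Real.log q ≤ q ^ (-η) * (2 * s / (s - 1)) := by
    have h1 := Real.log_le_rpow_div (inv_nonneg.2 hq0.le) hη0
    rw [Real.log_inv, Real.inv_rpow hq0.le, ← Real.rpow_neg hq0.le] at h1
    refine h1.trans (le_of_eq ?_)
    rw [hη]
    field_simp
  have h2 : q * q ^ (-η) = q ^ (1 - η) := by
    rw [sub_eq_add_neg, Real.rpow_add hq0, Real.rpow_one]
  have h3 : q ≤ q ^ (1 - η) := by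
    conv_lhs => rw [← Real.rpow_one q]
    exact Real.rpow_le_rpow_of_exponent_ge hq0 hq1 (by linarith)
  have h4 : q ^ (1 - η) ≤ D ^ (1 - η) * (a / m) ^ ((s + 1) / 2) := by
    have h5 : 0 ≤ 1 - η := by rw [hη1]; positivity
    calc _ ≤ (D * (a / m) ^ s) ^ (1 - η) := Real.rpow_le_rpow hq0.le hq h5
      _ = _ := by
        rw [Real.mul_rpow hD.le (by positivity), ← Real.rpow_mul ht.le, hη1]
        congr 2
        field_simp
  have h6 : m * (a / m) ^ ((s + 1) / 2) = a * (a / m) ^ ((s - 1) / 2) := by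
    rw [show (s + 1) / 2 = 1 + (s - 1) / 2 by ring, Real.rpow_add ht, Real.rpow_one]
    field_simp
  have h7 : 0 < K * (2 * s / (s - 1)) := by positivity
  calc q * m - K * (q * m) * Real.log q = q * m + K * (q * m) * (-Real.log q) := by ring
    _ ≤ q * m + K * (q * m) * (q ^ (-η) * (2 * s / (s - 1))) := by gcongr
    _ = q * m + K * (2 * s / (s - 1)) * (m * (q * q ^ (-η))) := by ring
    _ ≤ m * q ^ (1 - η) + K * (2 * s / (s - 1)) * (m * q ^ (1 - η)) := by
        rw [h2, mul_comm q m]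
        gcongr
    _ = (1 + K * (2 * s / (s - 1))) * (m * q ^ (1 - η)) := by ring
    _ ≤ (1 + K * (2 * s / (s - 1))) * (m * (D ^ (1 - η) * (a / m) ^ ((s + 1) / 2))) := by gcongr
    _ = (1 + K * (2 * s / (s - 1))) * D ^ (1 - η) * (m * (a / m) ^ ((s + 1) / 2)) := by ring
    _ = _ := by rw [h6, hη1]

lemma exists_card_freeSubgraphs_le_exp {r h : ℕ} {H : Finset (Finset (Fin h))}
    (hHu : UniformHG r H)
    {α A θ : ℝ} (hA0 : 0 < A) (hr : 1 ≤ r) (hαr : α < r) (hθα : (r : ℝ) - α < θ)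
    (hθ : ∀ F ⊆ H, F.Nonempty → θ * ((F.card : ℝ) - 1) ≤ ((vertsHG F).card : ℝ) - r)
    (hex : ∀ n : ℕ, (exN r H n : ℝ) ≤ A * (n : ℝ) ^ α) :
    ∃ C : ℝ, 0 < C ∧ ∀ n : ℕ, 1 ≤ n → ∀ X : Finset (Finset (Fin n)), UniformHG r X →
      ((freeSubgraphs H X).card : ℝ) ≤ Real.exp (C * (n : ℝ) ^ α) := by
  obtain ⟨C₀, D, K, s, hC₀, hD, hK, hs, hstep⟩ :=
    exists_halving_containers hHu hA0 hr hαr hθα hθ hex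
  set γ : ℝ := (s - 1) / 2 with hγ
  have hγ0 : 0 < γ := by rw [hγ]; linarith
  have hs1 : 0 < s - 1 := by linarith
  set C₁ : ℝ := (1 + K * (2 * s / (s - 1))) * D ^ ((s + 1) / (2 * s)) with hC₁
  have hC₁0 : 0 < C₁ := by positivity
  set ρ : ℝ := (2 : ℝ) ^ (-γ) with hρ
  have hρ0 : 0 < ρ := by positivity
  have hρ1 : ρ < 1 := Real.rpow_lt_one_of_one_lt_of_neg (by norm_num) (by linarith)
  set C₂ : ℝ := C₁ * C₀ ^ (-γ) with hC₂
  have hC₂0 : 0 < C₂ := by positivity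
  have hind : ∀ n : ℕ, 1 ≤ n → ∀ j : ℕ, ∀ X : Finset (Finset (Fin n)), UniformHG r X →
      (X.card : ℝ) ≤ 2 ^ j * (C₀ * (n : ℝ) ^ α) →
      ((freeSubgraphs H X).card : ℝ) ≤
        Real.exp ((C₀ + C₂ * ∑ i ∈ range j, ρ ^ i) * (n : ℝ) ^ α) := by
    intro n hn j
    have hn0 : (0 : ℝ) < n := by exact_mod_cast hn
    have hnα : 0 < (n : ℝ) ^ α := Real.rpow_pos_of_pos hn0 _
    induction j with
    | zero =>
      intro X _ hXc
      have h1 : ((freeSubgraphs H X).card : ℝ) ≤ 2 ^ X.card := by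
        have : freeSubgraphs H X ⊆ X.powerset := fun I hI =>
          mem_powerset.2 (mem_freeSubgraphs.1 hI).1
        have := card_le_card this
        rw [card_powerset] at this
        exact_mod_cast this
      have h2 : (2 : ℝ) ≤ Real.exp 1 := by
        have := Real.add_one_le_exp (1 : ℝ)
        linarith
      refine h1.trans ((pow_le_pow_left₀ (by norm_num) h2 _).trans ?_)
      rw [← Real.exp_nat_mul]
      refine Real.exp_le_exp.2 ?_
      simpa using hXc
    | succ j ih =>
      intro X hX hXc
      have hmono : (C₀ + C₂ * ∑ i ∈ range j, ρ ^ i) * (n : ℝ) ^ α ≤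
          (C₀ + C₂ * ∑ i ∈ range (j + 1), ρ ^ i) * (n : ℝ) ^ α := by
        rw [sum_range_succ]
        gcongr
        linarith [pow_pos hρ0 j]
      by_cases hsmall : (X.card : ℝ) ≤ 2 ^ j * (C₀ * (n : ℝ) ^ α)
      · exact (ih X hX hsmall).trans (Real.exp_le_exp.2 hmono)
      push Not at hsmall
      have h2j : (1 : ℝ) ≤ 2 ^ j := one_le_pow₀ (by norm_num)
      have hbase : C₀ * (n : ℝ) ^ α < X.card := by
        refine lt_of_le_of_lt ?_ hsmall
        exact le_mul_of_one_le_left (by positivity) h2j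
      have hX0 : (0 : ℝ) < X.card := (mul_pos hC₀ hnα).trans hbase
      obtain ⟨q, hq0, hq2, hq, f, hf⟩ := hstep n hn X hX hbase
      have h1 := card_freeSubgraphs_halving hq0 (by linarith) hf (Real.exp_pos _).le
        fun Y hY hYc => ih Y (fun e he => hX e (hY he)) (by
          rw [pow_succ] at hXc
          linarith)
      refine h1.trans ?_
      rw [← Real.exp_add]
      refine Real.exp_le_exp.2 ?_
      have h2 := fingerprint_exponent_le hq0 (by linarith) hK hD hs hnα hX0 hq
      have h3 : ((n : ℝ) ^ α / X.card) ^ γ ≤ C₀ ^ (-γ) * ρ ^ j := by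
        have h4 : (n : ℝ) ^ α / X.card ≤ (C₀ * 2 ^ j)⁻¹ := by
          rw [div_le_iff₀ hX0, inv_mul_eq_div, le_div_iff₀ (by positivity)]
          linarith
        calc _ ≤ ((C₀ * 2 ^ j)⁻¹) ^ γ := Real.rpow_le_rpow (by positivity) h4 hγ0.le
          _ = _ := by
            rw [Real.inv_rpow (by positivity), ← Real.rpow_neg (by positivity),
              Real.mul_rpow hC₀.le (by positivity), hρ, ← Real.rpow_natCast, ← Real.rpow_natCast,
              ← Real.rpow_mul (by norm_num), ← Real.rpow_mul (by norm_num), mul_comm (j : ℝ)]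
      have h5 : C₁ * ((n : ℝ) ^ α * ((n : ℝ) ^ α / X.card) ^ γ) ≤ C₂ * ρ ^ j * (n : ℝ) ^ α := by
        calc _ ≤ C₁ * ((n : ℝ) ^ α * (C₀ ^ (-γ) * ρ ^ j)) := by gcongr
          _ = _ := by rw [hC₂]; ring
      rw [sum_range_succ]
      calc _ ≤ C₂ * ρ ^ j * (n : ℝ) ^ α +
            (C₀ + C₂ * ∑ i ∈ range j, ρ ^ i) * (n : ℝ) ^ α :=
            add_le_add (h2.trans h5) le_rfl
        _ = _ := by ring
  have hρ2 : 0 < 1 - ρ := by linarith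
  refine ⟨C₀ + C₂ * (1 - ρ)⁻¹, by positivity, fun n hn X hX => ?_⟩
  have hn0 : (0 : ℝ) < n := by exact_mod_cast hn
  have hnα : 0 < (n : ℝ) ^ α := Real.rpow_pos_of_pos hn0 _
  obtain ⟨j, hj⟩ := pow_unbounded_of_one_lt ((X.card : ℝ) / (C₀ * (n : ℝ) ^ α)) one_lt_two
  rw [div_lt_iff₀ (by positivity)] at hj
  refine (hind n hn j X hX hj.le).trans (Real.exp_le_exp.2 ?_)
  have hgeom : ∑ i ∈ range j, ρ ^ i ≤ (1 - ρ)⁻¹ := by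
    rw [← tsum_geometric_of_lt_one hρ0.le hρ1]
    exact (summable_geometric_of_lt_one hρ0.le hρ1).sum_le_tsum _ fun i _ => pow_nonneg hρ0.le i
  gcongr

/-- The defining inequality of the `r`-density. -/
lemma card_sub_one_le_mDen_mul {r : ℕ} {V : Type*} [DecidableEq V] {H F : Finset (Finset V)}
    (hHu : UniformHG r H) (hFH : F ⊆ H) (hF : F.Nonempty) :
    (F.card : ℝ) - 1 ≤ mDen r H * (((vertsHG F).card : ℝ) - r) := by
  have hFu : UniformHG r F := fun e he => hHu e (hFH he)
  have hv := card_le_card_vertsHG hFu hF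
  rcases hv.lt_or_eq with hlt | heq
  · have hpos : (0 : ℝ) < ((vertsHG F).card : ℝ) - r := by
      rw [sub_pos]
      exact_mod_cast hlt
    rw [← div_le_iff₀ hpos]
    refine le_csSup ?_ ⟨F, hFH, hlt, rfl⟩
    refine Set.Finite.bddAbove ((H.powerset.finite_toSet.image fun F =>
      ((F.card : ℝ) - 1) / (((vertsHG F).card : ℝ) - (r : ℝ))).subset ?_)
    rintro _ ⟨F', hF', _, rfl⟩
    exact ⟨F', mem_coe.2 (mem_powerset.2 hF'), rfl⟩
  · have h1 : F.card ≤ 1 := by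
      refine card_le_one.2 fun a ha b hb => ?_
      have h2 : ∀ e ∈ F, e = vertsHG F := fun e he =>
        eq_of_subset_of_card_le (subset_biUnion_of_mem id he) (by rw [hFu e he, heq])
      rw [h2 a ha, h2 b hb]
    have h3 : (F.card : ℝ) ≤ 1 := by exact_mod_cast h1
    rw [← heq, sub_self, mul_zero]
    linarith

lemma ncard_eq_card_freeSubgraphs {r h n : ℕ} (H : Finset (Finset (Fin h))) :
    {G : Finset (Finset (Fin n)) | UniformHG r G ∧ HFree H G}.ncard =
      (freeSubgraphs H (powersetCard r (univ : Finset (Fin n)))).card := by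
  rw [← Set.ncard_coe_finset]
  congr 1
  ext G
  simp only [Set.mem_ofPred_eq, mem_coe, mem_freeSubgraphs, UniformHG]
  exact and_congr_left' ⟨fun h e he => mem_powersetCard.2 ⟨subset_univ _, h e he⟩,
    fun h e he => (mem_powersetCard.1 (h he)).2⟩

end Counting

/-- If `α > r − 1/m_r(H)` and `ex(n,H) ≤ A·n^α` for all `n`, then there
are at most `2^(C·n^α)` H-free `r`-uniform hypergraphs on `n` vertices. -/
theorem count_H_free_hypergraphs {r h : ℕ}
    (H : Finset (Finset (Fin h))) (hHu : UniformHG r H)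
    (α A : ℝ) (hα0 : 0 < α) (hA0 : 0 < A)
    (hαlow : (r : ℝ) - 1 / mDen r H < α)
    (hex : ∀ n : ℕ, (exN r H n : ℝ) ≤ A * (n : ℝ) ^ α) :
    ∃ C : ℝ, 0 < C ∧ ∀ n : ℕ,
      (({G : Finset (Finset (Fin n)) | UniformHG r G ∧ HFree H G}.ncard : ℝ)) ≤
        (2 : ℝ) ^ (C * (n : ℝ) ^ α) := by
  classical
  have hzero : ∀ C : ℝ, (({G : Finset (Finset (Fin 0)) | UniformHG r G ∧ HFree H G}.ncard : ℝ)) ≤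
      (2 : ℝ) ^ (C * ((0 : ℕ) : ℝ) ^ α) := by
    intro C
    have h0 := hex 0
    rw [Nat.cast_zero, Real.zero_rpow hα0.ne', mul_zero] at h0 ⊢
    rw [Real.rpow_zero]
    have h1 : {G : Finset (Finset (Fin 0)) | UniformHG r G ∧ HFree H G} ⊆ {∅} := by
      rintro G ⟨hG, hf⟩
      have h2 : (G.card : ℝ) ≤ exN r H 0 := by exact_mod_cast card_le_exN hG hf
      have h3 : (G.card : ℝ) ≤ 0 := h2.trans h0
      exact card_eq_zero.1 (Nat.le_zero.1 (by exact_mod_cast h3))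
    have h4 := Set.ncard_le_ncard h1
    rw [Set.ncard_singleton] at h4
    exact_mod_cast h4
  by_cases hαr : (r : ℝ) ≤ α
  · refine ⟨1, one_pos, fun n => ?_⟩
    rcases Nat.eq_zero_or_pos n with rfl | hn
    · exact hzero 1
    have h1 : (freeSubgraphs H (powersetCard r (univ : Finset (Fin n)))).card ≤ 2 ^ n ^ r := by
      have h2 : freeSubgraphs H (powersetCard r (univ : Finset (Fin n))) ⊆
          (powersetCard r univ).powerset := fun I hI => mem_powerset.2 (mem_freeSubgraphs.1 hI).1
      refine (card_le_card h2).trans ?_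
      rw [card_powerset, card_powersetCard, card_univ, Fintype.card_fin]
      exact Nat.pow_le_pow_right (by norm_num) (Nat.choose_le_pow n r)
    rw [ncard_eq_card_freeSubgraphs]
    calc _ ≤ ((2 ^ n ^ r : ℕ) : ℝ) := by exact_mod_cast h1
      _ = (2 : ℝ) ^ ((n : ℝ) ^ (r : ℝ)) := by
          rw [Real.rpow_natCast, ← Nat.cast_pow, Real.rpow_natCast]
          push_cast
          rfl
      _ ≤ _ := by
          refine Real.rpow_le_rpow_of_exponent_le (by norm_num) ?_
          rw [one_mul]
          exact Real.rpow_le_rpow_of_exponent_le (by exact_mod_cast hn) hαr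
  push Not at hαr
  have hr : 1 ≤ r := by
    have : (0 : ℝ) < r := hα0.trans hαr
    exact_mod_cast this
  have hθα : (r : ℝ) - α < 1 / mDen r H := by linarith
  have hM : 0 < mDen r H := one_div_pos.1 (lt_trans (by linarith) hθα)
  obtain ⟨C, hC0, hC⟩ := exists_card_freeSubgraphs_le_exp hHu hA0 hr hαr hθα
    (fun F hFH hF => by
      rw [one_div, inv_mul_le_iff₀ hM]
      exact card_sub_one_le_mDen_mul hHu hFH hF) hex
  have hlog : 0 < Real.log 2 := Real.log_pos one_lt_two
  refine ⟨C / Real.log 2, div_pos hC0 hlog, fun n => ?_⟩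
  rcases Nat.eq_zero_or_pos n with rfl | hn
  · exact hzero _
  rw [ncard_eq_card_freeSubgraphs]
  refine (hC n hn _ fun e he => (mem_powersetCard.1 he).2).trans (le_of_eq ?_)
  rw [Real.rpow_def_of_pos two_pos]
  congr 1
  field_simp
end

section
/- Let H be a bipartite graph with ℓ edges. Let α > 0, let C ≥ 1, and let ℓ ≥ 2. There exists ε > 0 (depending only on ℓ and C) such that the following holds for all n ∈ ℕ, k > 0 and β > 0. Suppose G is a graph with n vertices and k·n^α edges, and suppose G contains a non-empty family 𝓕 of copies of H satisfying d_𝓕(S) ≤ C·β^{|S|−1}·|𝓕|/e(G) for every S ⊆ E(G) with 1 ≤ |S| ≤ ℓ, and such that C·β^{ℓ−1}·|𝓕|/e(G) ≥ 1. Set μ = kβ/ε. Then there exists a function f_G mapping subgraphs of G to subgraphs of G such that for every H-free subgraph I ⊆ G: (a) there exists a subgraph T = T(I) ⊆ I with e(T) ≤ μ·n^α and I ⊆ f_G(T); and (b) e(f_G(T(I))) ≤ (1−ε)·e(G). -/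
set_option autoImplicit false

open Finset Filter MeasureTheory

/-- Every set with property `P` has a fingerprint `T I ⊆ I` of size at most `t` and a container
`g I ⊇ I` of size at most `M`, both unchanged when `I` is replaced by any set between `T I`
and `I`. -/
def HasContainers {V : Type*} (P : Finset V → Prop) (t M : ℝ) : Prop :=
  ∃ T g : Finset V → Finset V, ∀ I, P I →
    T I ⊆ I ∧ ((T I).card : ℝ) ≤ t ∧ I ⊆ g I ∧ ((g I).card : ℝ) ≤ M ∧
      ∀ J, T I ⊆ J → J ⊆ I → T J = T I ∧ g J = g I

namespace HasContainers

variable {V : Type*} {P Q : Finset V → Prop} {t t' M M' : ℝ}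

theorem mono (h : HasContainers P t M) (hQ : ∀ I, Q I → P I) (ht : t ≤ t') (hM : M ≤ M') :
    HasContainers Q t' M' := by
  obtain ⟨T, g, H⟩ := h
  refine ⟨T, g, fun I hI => ?_⟩
  obtain ⟨h1, h2, h3, h4, h5⟩ := H I (hQ I hI)
  exact ⟨h1, h2.trans ht, h3, h4.trans hM, h5⟩

theorem of_subset (g : Finset V) (ht : 0 ≤ t) (hg : ∀ I, P I → I ⊆ g)
    (hM : (g.card : ℝ) ≤ M) : HasContainers P t M :=
  ⟨fun _ => ∅, fun _ => g, fun I hI =>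
    ⟨empty_subset _, by simpa using ht, hg I hI, hM, fun _ _ _ => ⟨rfl, rfl⟩⟩⟩

theorem query [DecidableEq V] (v : V) (h1 : HasContainers (fun I => P I ∧ v ∈ I) (t - 1) M)
    (h0 : HasContainers (fun I => P I ∧ v ∉ I) t M) : HasContainers P t M := by
  obtain ⟨T1, g1, H1⟩ := h1
  obtain ⟨T0, g0, H0⟩ := h0
  refine ⟨fun I => if v ∈ I then insert v (T1 I) else T0 I,
    fun I => if v ∈ I then g1 I else g0 I, fun I hI => ?_⟩
  by_cases hv : v ∈ I
  · obtain ⟨a1, a2, a3, a4, a5⟩ := H1 I ⟨hI, hv⟩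
    simp only [hv, if_true]
    refine ⟨insert_subset hv a1, ?_, a3, a4, fun J hJ hJI => ?_⟩
    · have : ((insert v (T1 I)).card : ℝ) ≤ (T1 I).card + 1 := by
        exact_mod_cast card_insert_le _ _
      linarith
    · have hvJ : v ∈ J := hJ (mem_insert_self _ _)
      obtain ⟨b1, b2⟩ := a5 J ((subset_insert _ _).trans hJ) hJI
      simp only [hvJ, if_true, b1, b2, and_self]
  · obtain ⟨a1, a2, a3, a4, a5⟩ := H0 I ⟨hI, hv⟩
    simp only [hv, if_false]
    refine ⟨a1, a2, a3, a4, fun J hJ hJI => ?_⟩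
    have hvJ : v ∉ J := fun h => hv (hJI h)
    simpa only [hvJ, if_false] using a5 J hJ hJI

end HasContainers

section WeightedHypergraph

variable {V : Type*} [DecidableEq V] {G S : Finset V} {w w' : Finset V → ℝ}

/-- The degree of `S` in the hypergraph on `G` with edge weights `w`. -/
def weightDeg (G : Finset V) (w : Finset V → ℝ) (S : Finset V) : ℝ :=
  ∑ e ∈ G.powerset with S ⊆ e, w e

/-- The link of the vertex `v` in the hypergraph with edge weights `w`. -/
def weightLink (v : V) (w : Finset V → ℝ) (e : Finset V) : ℝ :=
  if v ∈ e then 0 else w (insert v e)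

/-- `I` contains no edge of nonzero weight. -/
def WeightIndep (w : Finset V → ℝ) (I : Finset V) : Prop :=
  ∀ e, e ⊆ I → w e = 0

/-- A nonzero `r`-uniform weighted hypergraph on `G` whose codegrees are bounded in terms of the
codegree ratio `β`. -/
structure WeightBalanced (G : Finset V) (r : ℕ) (C β : ℝ) (w : Finset V → ℝ) : Prop where
  nonneg : ∀ e, 0 ≤ w e
  uniform : ∀ e, w e ≠ 0 → e.card = r
  pos : 0 < weightDeg G w ∅
  codeg : ∀ S ⊆ G, S.Nonempty →
    weightDeg G w S * (G.card : ℝ) ≤ C * β ^ (S.card - 1) * weightDeg G w ∅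

theorem weightDeg_nonneg (hw : ∀ e, 0 ≤ w e) (S : Finset V) : 0 ≤ weightDeg G w S :=
  sum_nonneg fun e _ => hw e

theorem weightDeg_mono (h : ∀ e, w e ≤ w' e) (S : Finset V) :
    weightDeg G w S ≤ weightDeg G w' S :=
  sum_le_sum fun e _ => h e

theorem weightDeg_add (S : Finset V) :
    weightDeg G (fun e => w e + w' e) S = weightDeg G w S + weightDeg G w' S :=
  sum_add_distrib

theorem weightDeg_le_sum_of_cover (hw : ∀ e, 0 ≤ w e) (𝒮 : Finset (Finset V))
    (h : ∀ e ⊆ G, w e ≠ 0 → ∃ S ∈ 𝒮, S ⊆ e) :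
    weightDeg G w ∅ ≤ ∑ S ∈ 𝒮, weightDeg G w S := by
  simp only [weightDeg, sum_filter]
  rw [sum_comm]
  refine sum_le_sum fun e he => ?_
  simp only [empty_subset, if_true]
  by_cases h0 : w e = 0
  · simp [h0]
  obtain ⟨S, hS, hSe⟩ := h e (mem_powerset.1 he) h0
  have := single_le_sum (f := fun S => if S ⊆ e then w e else 0)
    (fun S _ => by split_ifs <;> simp [hw]) hS
  simpa [hSe] using this

theorem weightDeg_link_of_mem {v : V} (hv : v ∈ S) : weightDeg G (weightLink v w) S = 0 :=
  sum_eq_zero fun e he => by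
    simp [weightLink, (mem_filter.1 he).2 hv]

theorem weightDeg_link_of_notMem {v : V} (hvG : v ∈ G) (hv : v ∉ S) :
    weightDeg G (weightLink v w) S = weightDeg G w (insert v S) := by
  unfold weightDeg
  rw [← sum_filter_of_ne (p := fun e => v ∉ e)
    (fun e _ h => by contrapose! h; simp [weightLink, h])]
  refine sum_nbij' (fun e => insert v e) (fun e => e.erase v) ?_ ?_ ?_ ?_ ?_
  · intro e he
    simp only [mem_filter, mem_powerset] at he ⊢
    exact ⟨insert_subset hvG he.1.1, insert_subset_insert _ he.1.2⟩
  · intro e he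
    simp only [mem_filter, mem_powerset] at he ⊢
    refine ⟨⟨(erase_subset _ _).trans he.1, ?_⟩, notMem_erase _ _⟩
    exact subset_erase.2 ⟨(subset_insert _ _).trans he.2, hv⟩
  · intro e he
    exact erase_insert (mem_filter.1 he).2
  · intro e he
    exact insert_erase ((mem_filter.1 he).2 (mem_insert_self _ _))
  · intro e he
    simp [weightLink, (mem_filter.1 he).2]

theorem sum_weightDeg_eq {r : ℕ} (hu : ∀ e, w e ≠ 0 → e.card = r) :
    ∑ S ∈ G.powerset, weightDeg G w S = 2 ^ r * weightDeg G w ∅ := by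
  simp only [weightDeg, sum_filter]
  rw [sum_comm, mul_sum]
  refine sum_congr rfl fun e he => ?_
  simp only [empty_subset, if_true]
  rw [← sum_filter, sum_const, nsmul_eq_mul]
  by_cases h0 : w e = 0
  · simp [h0]
  have : G.powerset.filter (fun S => S ⊆ e) = e.powerset := by
    ext S
    simp only [mem_filter, mem_powerset]
    exact ⟨fun h => h.2, fun h => ⟨h.trans (mem_powerset.1 he), h⟩⟩
  rw [this, card_powerset, hu e h0]
  push_cast
  rfl

namespace WeightBalanced

variable {r : ℕ} {C β : ℝ}

theorem codeg_singleton (h : WeightBalanced G r C β w) {v : V} (hv : v ∈ G) :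
    weightDeg G w {v} * (G.card : ℝ) ≤ C * weightDeg G w ∅ := by
  simpa using h.codeg {v} (singleton_subset_iff.2 hv) (singleton_nonempty v)

theorem sum_singleton_le (h : WeightBalanced G r C β w) {A : Finset V} (hA : A ⊆ G) :
    (∑ S ∈ A.image singleton, weightDeg G w S) * (G.card : ℝ) ≤
      A.card * (C * weightDeg G w ∅) := by
  rw [sum_image fun x _ y _ hxy => singleton_injective hxy, sum_mul]
  refine (sum_le_sum fun v hv => h.codeg_singleton (hA hv)).trans ?_
  simp

theorem card_le_of_indep (h : WeightBalanced G r C β w) (hC : 0 < C) {I : Finset V} (hI : I ⊆ G)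
    (hi : WeightIndep w I) : (I.card : ℝ) ≤ (1 - 1 / C) * G.card := by
  have h1 := weightDeg_le_sum_of_cover (G := G) h.nonneg ((G \ I).image singleton) fun e he h0 => by
    have : ¬ e ⊆ I := fun hs => h0 (hi e hs)
    obtain ⟨x, hx, hxI⟩ := not_subset.1 this
    exact ⟨{x}, mem_image_of_mem _ (mem_sdiff.2 ⟨he hx, hxI⟩), singleton_subset_iff.2 hx⟩
  have h2 := h.sum_singleton_le (A := G \ I) sdiff_subset
  have h3 : ((G \ I).card : ℝ) = G.card - I.card := by
    rw [card_sdiff_of_subset hI, Nat.cast_sub (card_le_card hI)]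
  have h4 := (mul_le_mul_of_nonneg_right h1 (Nat.cast_nonneg G.card)).trans h2
  have h5 : (G.card : ℝ) ≤ (G \ I).card * C :=
    le_of_mul_le_mul_left (by linarith) h.pos
  have h6 : (G.card : ℝ) / C ≤ (G \ I).card := (div_le_iff₀ hC).2 h5
  have : (1 - 1 / C) * (G.card : ℝ) = G.card - G.card / C := by ring
  linarith

theorem one_le_mul_card (h : WeightBalanced G r C β w) (hr : 2 ≤ r) (hC : 0 ≤ C) (hβ : 0 ≤ β) :
    1 ≤ C * β * G.card := by
  have h1 := weightDeg_le_sum_of_cover (G := G) h.nonneg (G.powersetCard 2) fun e he h0 => by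
    obtain ⟨S, hS, hc⟩ := exists_subset_card_eq (hr.trans_eq (h.uniform e h0).symm)
    exact ⟨S, mem_powersetCard.2 ⟨hS.trans he, hc⟩, hS⟩
  have h2 : (∑ S ∈ G.powersetCard 2, weightDeg G w S) * G.card ≤
      (G.card * G.card : ℝ) * (C * β * weightDeg G w ∅) := by
    rw [sum_mul]
    have : ∀ S ∈ G.powersetCard 2, weightDeg G w S * G.card ≤ C * β * weightDeg G w ∅ := by
      intro S hS
      obtain ⟨hSG, hc⟩ := mem_powersetCard.1 hS
      simpa [hc] using h.codeg S hSG (card_pos.1 (by omega))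
    refine (sum_le_sum this).trans ?_
    rw [sum_const, nsmul_eq_mul, card_powersetCard]
    have h3 : ((G.card.choose 2 : ℕ) : ℝ) ≤ G.card * G.card := by
      rw [← sq]
      exact_mod_cast Nat.choose_le_pow _ _
    exact mul_le_mul_of_nonneg_right h3 (mul_nonneg (mul_nonneg hC hβ) h.pos.le)
  have hG : 0 < (G.card : ℝ) := by
    rcases G.eq_empty_or_nonempty with rfl | hne
    · have h0 : weightDeg (∅ : Finset V) w ∅ ≤ 0 := by
        rwa [powersetCard_eq_empty.2 (by simp), sum_empty] at h1
      exact absurd h0 (not_le.2 h.pos)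
    · exact_mod_cast hne.card_pos
  have h4 := (mul_le_mul_of_nonneg_right h1 hG.le).trans h2
  refine le_of_mul_le_mul_left (a := weightDeg G w ∅ * G.card) ?_ (mul_pos h.pos hG)
  linarith

theorem card_pos (h : WeightBalanced G r C β w) (hr : r ≠ 0) : 0 < (G.card : ℝ) := by
  rcases G.eq_empty_or_nonempty with rfl | hne
  · have h1 := weightDeg_le_sum_of_cover (G := ∅) h.nonneg ∅ fun e he h0 => by
      have := h.uniform e h0
      rw [subset_empty.1 he, card_empty] at this
      exact absurd this.symm hr
    exact absurd (by simpa using h1) (not_le.2 h.pos)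
  · exact_mod_cast hne.card_pos

end WeightBalanced

end WeightedHypergraph

section ContainerAlgorithm

variable {V : Type*} [DecidableEq V] {G : Finset V} {r : ℕ} {C β c : ℝ} {w : Finset V → ℝ}

open Classical in
/-- The restriction of the weights `w` to the edges inside `A` none of whose nonempty subsets has
large degree with respect to `w'`. -/
noncomputable def unsaturated (G A : Finset V) (β : ℝ) (w w' : Finset V → ℝ) (e : Finset V) : ℝ :=
  if e ⊆ A ∧ ∀ S ⊆ e, S.Nonempty →
    weightDeg G w' S * (G.card : ℝ) < β ^ S.card * weightDeg G w ∅ then w e else 0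

theorem unsaturated_nonneg (hw : ∀ e, 0 ≤ w e) (A : Finset V) (w' : Finset V → ℝ) (e : Finset V) :
    0 ≤ unsaturated G A β w w' e := by
  unfold unsaturated
  split_ifs <;> simp [hw]

theorem unsaturated_le (hw : ∀ e, 0 ≤ w e) (A : Finset V) (w' : Finset V → ℝ) (e : Finset V) :
    unsaturated G A β w w' e ≤ w e := by
  unfold unsaturated
  split_ifs <;> simp [hw]

theorem weightLink_nonneg (hw : ∀ e, 0 ≤ w e) (v : V) (e : Finset V) : 0 ≤ weightLink v w e := by
  unfold weightLink
  split_ifs <;> simp [hw]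

/-- If few vertices have been selected and the remaining unsaturated edges have small maximum
degree, then the available and the selected vertices form a small set. -/
theorem card_union_le_of_unsaturated_degree_lt (hb : WeightBalanced G (r + 1) C β w) (hC : 1 ≤ C)
    (hβ : 0 < β) (hβ1 : β ≤ 1) (hc : c = 1 / (16 * C * 2 ^ r))
    {A T : Finset V} {w' : Finset V → ℝ} (hA : A ⊆ G) (hw' : ∀ e, 0 ≤ w' e)
    (hu : ∀ e, w' e ≠ 0 → e.card = r)
    (hT : (T.card : ℝ) ≤ 4 * c * β * G.card)
    (hlt : weightDeg G w' ∅ < c * β * weightDeg G w ∅)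
    (hdeg : ∀ v ∈ A, 4 * G.card * weightDeg G (unsaturated G A β w w') {v} < weightDeg G w ∅) :
    ((A ∪ T).card : ℝ) ≤ (1 - 1 / (4 * C)) * G.card := by
  classical
  have hN := hb.card_pos (Nat.succ_ne_zero r)
  set N : ℝ := (G.card : ℝ)
  set W := weightDeg G w ∅ with hW
  have hWpos : 0 < W := hb.pos
  set wg := unsaturated G A β w w' with hwg
  have hC0 : 0 < C := by linarith
  have hgood : weightDeg G wg ∅ ≤ W / 4 := by
    have h1 := weightDeg_le_sum_of_cover (G := G)
      (unsaturated_nonneg (β := β) (G := G) hb.nonneg A w')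
      (A.image singleton) fun e he h0 => by
        have h2 : e ⊆ A ∧ w e ≠ 0 := by
          unfold unsaturated at h0
          split_ifs at h0 with h3
          · exact ⟨h3.1, h0⟩
          · exact absurd rfl h0
        have : e.Nonempty := Finset.card_pos.1 (by have := hb.uniform e h2.2; omega)
        obtain ⟨x, hx⟩ := this
        exact ⟨{x}, mem_image_of_mem _ (h2.1 hx), singleton_subset_iff.2 hx⟩
    rw [sum_image fun x _ y _ hxy => singleton_injective hxy] at h1
    have h2 : 4 * N * weightDeg G wg ∅ ≤ N * W := by
      calc 4 * N * weightDeg G wg ∅ ≤ 4 * N * ∑ v ∈ A, weightDeg G wg {v} :=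
            mul_le_mul_of_nonneg_left h1 (by positivity)
        _ = ∑ v ∈ A, 4 * N * weightDeg G wg {v} := mul_sum _ _ _
        _ ≤ ∑ v ∈ A, W := sum_le_sum fun v hv => (hdeg v hv).le
        _ = A.card * W := by simp
        _ ≤ N * W := mul_le_mul_of_nonneg_right (Nat.cast_le.2 (card_le_card hA)) hWpos.le
    have h3 : 4 * weightDeg G wg ∅ ≤ W := le_of_mul_le_mul_left (by linarith) hN
    linarith
  set Sat := G.powerset.filter fun S => S.Nonempty ∧ β ^ S.card * W ≤ weightDeg G w' S * N
  have hsat : ∑ S ∈ Sat, weightDeg G w S ≤ W / 16 := by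
    have h1 : ∀ S ∈ Sat, β * weightDeg G w S ≤ C * weightDeg G w' S := by
      intro S hS
      obtain ⟨hSG, hne, hS⟩ := mem_filter.1 hS
      have h2 := hb.codeg S (mem_powerset.1 hSG) hne
      obtain ⟨m, hm⟩ := Nat.exists_eq_succ_of_ne_zero (Finset.card_pos.2 hne).ne'
      rw [hm] at h2 hS
      simp only [Nat.succ_eq_add_one, Nat.add_sub_cancel, pow_succ] at h2 hS
      have h3 := mul_le_mul_of_nonneg_left h2 hβ.le
      have h4 := mul_le_mul_of_nonneg_left hS hC0.le
      refine le_of_mul_le_mul_right (a := N) ?_ hN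
      linarith
    have h2 : β * ∑ S ∈ Sat, weightDeg G w S ≤ C * (2 ^ r * weightDeg G w' ∅) := by
      rw [mul_sum, ← sum_weightDeg_eq hu, mul_sum]
      refine (sum_le_sum h1).trans (sum_le_sum_of_subset_of_nonneg (filter_subset _ _) ?_)
      exact fun S _ _ => mul_nonneg hC0.le (weightDeg_nonneg hw' S)
    have h3 : C * (2 ^ r * weightDeg G w' ∅) ≤ C * (2 ^ r * (c * β * W)) := by gcongr
    have h4 : C * (2 ^ r * (c * β * W)) = β * (W / 16) := by
      rw [hc]
      field_simp
    exact le_of_mul_le_mul_left (by linarith) hβ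
  have hbad : W - weightDeg G wg ∅ ≤
      ∑ S ∈ Sat, weightDeg G w S + ∑ S ∈ (G \ A).image singleton, weightDeg G w S := by
    have hsub : W = weightDeg G (fun e => w e - wg e) ∅ + weightDeg G wg ∅ := by
      rw [← weightDeg_add]
      simp [hW]
    have hnn : ∀ e, 0 ≤ w e - wg e := fun e => sub_nonneg.2 (unsaturated_le hb.nonneg A w' e)
    have h1 := weightDeg_le_sum_of_cover (G := G) hnn
      (Sat ∪ (G \ A).image singleton) fun e he h0 => by
        have h2 : ¬ (e ⊆ A ∧ ∀ S ⊆ e, S.Nonempty → weightDeg G w' S * N < β ^ S.card * W) := by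
          intro h3
          exact h0 (by simp only [hwg, unsaturated]; rw [if_pos h3, sub_self])
        by_cases heA : e ⊆ A
        · have h3 : ∃ S ⊆ e, S.Nonempty ∧ β ^ S.card * W ≤ weightDeg G w' S * N := by
            by_contra! h4
            exact h2 ⟨heA, h4⟩
          obtain ⟨S, hSe, hne, hS⟩ := h3
          exact ⟨S, mem_union_left _ (mem_filter.2 ⟨mem_powerset.2 (hSe.trans he), hne, hS⟩), hSe⟩
        · obtain ⟨x, hx, hxA⟩ := not_subset.1 heA
          exact ⟨{x}, mem_union_right _ (mem_image_of_mem _ (Finset.mem_sdiff.2 ⟨he hx, hxA⟩)),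
            singleton_subset_iff.2 hx⟩
    have h2 := sum_union_inter (s₁ := Sat) (s₂ := (G \ A).image singleton)
      (f := fun S => weightDeg G (fun e => w e - wg e) S)
    have h3 : 0 ≤ ∑ S ∈ Sat ∩ (G \ A).image singleton, weightDeg G (fun e => w e - wg e) S :=
      sum_nonneg fun S _ => weightDeg_nonneg hnn S
    have h4 : ∀ S, weightDeg G (fun e => w e - wg e) S ≤ weightDeg G w S :=
      weightDeg_mono fun e => sub_le_self _ (unsaturated_nonneg hb.nonneg A w' e)
    have h5 := sum_le_sum fun S (_ : S ∈ Sat) => h4 S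
    have h6 := sum_le_sum fun S (_ : S ∈ (G \ A).image singleton) => h4 S
    linarith
  have hrem := hb.sum_singleton_le (A := G \ A) sdiff_subset
  have hcard : ((G \ A).card : ℝ) = N - A.card := by
    rw [card_sdiff_of_subset hA, Nat.cast_sub (card_le_card hA)]
  rw [hcard] at hrem
  have hremoved : N / (2 * C) ≤ N - A.card := by
    rw [div_le_iff₀ (by positivity)]
    have h1 : W / 2 ≤ ∑ S ∈ (G \ A).image singleton, weightDeg G w S := by linarith
    have h2 := (mul_le_mul_of_nonneg_right h1 hN.le).trans hrem
    refine le_of_mul_le_mul_left (a := W) ?_ hWpos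
    linarith
  have hTsmall : (T.card : ℝ) ≤ N / (4 * C) := by
    refine hT.trans ?_
    have h1 : c ≤ 1 / (16 * C) := by
      rw [hc]
      apply one_div_le_one_div_of_le (by positivity)
      exact le_mul_of_one_le_right (by positivity) (one_le_pow₀ one_le_two)
    have hc0 : 0 ≤ c := by rw [hc]; positivity
    calc 4 * c * β * N ≤ 4 * (1 / (16 * C)) * 1 * N := by gcongr
      _ = N / (4 * C) := by field_simp; norm_num
  have hunion : ((A ∪ T).card : ℝ) ≤ A.card + T.card := by exact_mod_cast card_union_le _ _
  have h1 : (1 - 1 / (4 * C)) * N = N - N / (2 * C) + N / (4 * C) := by field_simp; ring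
  linarith

/-- The main recursion: `A` is the set of available vertices, `T` the set of vertices of `I`
selected so far and `w'` the weights accumulated from the links of the selected vertices. -/
theorem hasContainers_of_partial_link (hb : WeightBalanced G (r + 1) C β w) (hC : 1 ≤ C)
    (hβ : 0 < β) (hβ1 : β ≤ 1) (hc : c = 1 / (16 * C * 2 ^ r)) {t M : ℝ} (ht : 0 ≤ t)
    (hM : (1 - 1 / (4 * C)) * G.card ≤ M)
    (ih : ∀ w', WeightBalanced G r ((1 + C) / c) β w' →
      HasContainers (fun I => I ⊆ G ∧ WeightIndep w' I) t M)
    {A T : Finset V} {w' : Finset V → ℝ} (hA : A ⊆ G) (hAT : Disjoint A T)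
    (hw' : ∀ e, 0 ≤ w' e) (hu : ∀ e, w' e ≠ 0 → e.card = r)
    (hsupp : ∀ e, w' e ≠ 0 → ∃ v ∈ T, w (insert v e) ≠ 0)
    (hdeg : ∀ S ⊆ G, S.Nonempty →
      weightDeg G w' S * (G.card : ℝ) ≤ (1 + C) * β ^ S.card * weightDeg G w ∅)
    (hTw : T.card * weightDeg G w ∅ ≤ 4 * G.card * weightDeg G w' ∅)
    (hT : (T.card : ℝ) ≤ 4 * c * β * G.card + 1) :
    HasContainers (fun I => (I ⊆ G ∧ WeightIndep w I) ∧ I \ A = T)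
      (t + 4 * c * β * G.card + 1 - T.card) M := by
  have hWpos : 0 < weightDeg G w ∅ := hb.pos
  have hC0 : 0 < C := by linarith
  have hc0 : 0 < c := by rw [hc]; positivity
  by_cases hbig : c * β * weightDeg G w ∅ ≤ weightDeg G w' ∅
  · have hb' : WeightBalanced G r ((1 + C) / c) β w' := by
      refine ⟨hw', hu, lt_of_lt_of_le (by positivity) hbig, fun S hS hne => ?_⟩
      refine (hdeg S hS hne).trans ?_
      obtain ⟨m, hm⟩ := Nat.exists_eq_succ_of_ne_zero (Finset.card_pos.2 hne).ne'
      rw [hm]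
      simp only [Nat.succ_eq_add_one, Nat.add_sub_cancel]
      calc (1 + C) * β ^ (m + 1) * weightDeg G w ∅
          = (1 + C) / c * β ^ m * (c * β * weightDeg G w ∅) := by
            rw [pow_succ]
            field_simp
        _ ≤ _ := by gcongr
    refine (ih w' hb').mono (fun I hI => ⟨hI.1.1, fun e he => ?_⟩) (by linarith) le_rfl
    by_contra h0
    obtain ⟨v, hv, hve⟩ := hsupp e h0
    rw [← hI.2] at hv
    exact hve (hI.1.2 _ (insert_subset (Finset.mem_sdiff.1 hv).1 he))
  have hlt := not_le.1 hbig
  have hTsmall : (T.card : ℝ) ≤ 4 * c * β * G.card := by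
    refine le_of_mul_le_mul_right (a := weightDeg G w ∅) (hTw.trans ?_) hWpos
    calc 4 * G.card * weightDeg G w' ∅ ≤ 4 * G.card * (c * β * weightDeg G w ∅) := by gcongr
      _ = _ := by ring
  by_cases hex : ∃ v ∈ A,
      weightDeg G w ∅ ≤ 4 * G.card * weightDeg G (unsaturated G A β w w') {v}
  · obtain ⟨v, hvA, hv⟩ := hex
    have hwg0 : ∀ e, 0 ≤ unsaturated G A β w w' e := unsaturated_nonneg hb.nonneg A w'
    have herase : A.erase v ⊆ G := (erase_subset _ _).trans hA
    have hins : ((insert v T).card : ℝ) = T.card + 1 := by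
      exact_mod_cast card_insert_of_notMem (disjoint_left.1 hAT hvA)
    have hlink : ∀ e, weightLink v (unsaturated G A β w w') e ≠ 0 →
        v ∉ e ∧ w (insert v e) ≠ 0 := by
      intro e he
      unfold weightLink unsaturated at he
      split_ifs at he with h1 h2
      · exact absurd rfl he
      · exact ⟨h1, he⟩
      · exact absurd rfl he
    have hor : ∀ e, w' e + weightLink v (unsaturated G A β w w') e ≠ 0 →
        w' e ≠ 0 ∨ weightLink v (unsaturated G A β w w') e ≠ 0 := by
      intro e he
      by_contra! h
      exact he (by rw [h.1, h.2, add_zero])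
    have hyes := hasContainers_of_partial_link hb hC hβ hβ1 hc ht hM ih (A := A.erase v)
      (T := insert v T) (w' := fun e => w' e + weightLink v (unsaturated G A β w w') e) herase
      (disjoint_insert_right.2 ⟨notMem_erase v A, hAT.mono_left (erase_subset _ _)⟩)
      (fun e => add_nonneg (hw' e) (weightLink_nonneg hwg0 v e))
      (fun e he => by
        rcases hor e he with h | h
        · exact hu e h
        · obtain ⟨h1, h2⟩ := hlink e h
          have := hb.uniform _ h2
          rw [card_insert_of_notMem h1] at this
          omega)
      (fun e he => by
        rcases hor e he with h | h
        · obtain ⟨x, hx, hxe⟩ := hsupp e h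
          exact ⟨x, mem_insert_of_mem hx, hxe⟩
        · exact ⟨v, mem_insert_self _ _, (hlink e h).2⟩)
      (fun S hS hne => by
        rw [weightDeg_add]
        by_cases hvS : v ∈ S
        · rw [weightDeg_link_of_mem hvS, add_zero]
          exact hdeg S hS hne
        rw [weightDeg_link_of_notMem (hA hvA) hvS]
        by_cases h0 : weightDeg G (unsaturated G A β w w') (insert v S) = 0
        · rw [h0, add_zero]
          exact hdeg S hS hne
        obtain ⟨e, he, he0⟩ := exists_ne_zero_of_sum_ne_zero h0
        have hSe := (subset_insert _ _).trans (mem_filter.1 he).2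
        have h1 : weightDeg G w' S * (G.card : ℝ) < β ^ S.card * weightDeg G w ∅ := by
          unfold unsaturated at he0
          split_ifs at he0 with h2
          · exact h2.2 S hSe hne
          · exact absurd rfl he0
        have h2 := hb.codeg (insert v S) (insert_subset (hA hvA) hS) (insert_nonempty _ _)
        rw [card_insert_of_notMem hvS, Nat.add_sub_cancel] at h2
        have h3 := mul_le_mul_of_nonneg_right
          (weightDeg_mono (G := G) (unsaturated_le (G := G) (β := β) hb.nonneg A w') (insert v S))
          (Nat.cast_nonneg (α := ℝ) G.card)
        linarith)
      (by
        rw [weightDeg_add, weightDeg_link_of_notMem (hA hvA) (notMem_empty v), insert_empty_eq]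
        have := mul_le_mul_of_nonneg_right hins.le hWpos.le
        linarith)
      (by linarith)
    have hno := hasContainers_of_partial_link hb hC hβ hβ1 hc ht hM ih herase
      (hAT.mono_left (erase_subset _ _)) hw' hu hsupp hdeg hTw hT
    refine HasContainers.query v (hyes.mono ?_ (by linarith) le_rfl) (hno.mono ?_ le_rfl le_rfl)
    · rintro I ⟨⟨hI, rfl⟩, hvI⟩
      exact ⟨hI, sdiff_erase hvI⟩
    · rintro I ⟨⟨hI, rfl⟩, hvI⟩
      refine ⟨hI, ?_⟩
      ext x
      simp only [Finset.mem_sdiff, mem_erase, not_and]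
      exact ⟨fun h => ⟨h.1, h.2 fun hx => hvI (hx ▸ h.1)⟩, fun h => ⟨h.1, fun _ => h.2⟩⟩
  · push Not at hex
    refine HasContainers.of_subset (A ∪ T) (by linarith) ?_
      ((card_union_le_of_unsaturated_degree_lt hb hC hβ hβ1 hc hA hw' hu hTsmall hlt hex).trans hM)
    rintro I ⟨-, rfl⟩
    exact subset_union_right.trans (union_sdiff_self_eq_union (s := A) (t := I)).ge
termination_by A.card
decreasing_by
  all_goals exact card_erase_lt_of_mem hvA

/-- The container lemma for `r`-uniform weighted hypergraphs with bounded codegrees. -/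
theorem exists_hasContainers (r : ℕ) (hr : 1 ≤ r) : ∀ C : ℝ, 1 ≤ C →
    ∃ ε K : ℝ, 0 < ε ∧ 0 ≤ K ∧ ∀ (V : Type) [DecidableEq V] (G : Finset V) (β : ℝ)
      (w : Finset V → ℝ), 0 < β → β ≤ 1 → WeightBalanced G r C β w →
        HasContainers (fun I => I ⊆ G ∧ WeightIndep w I) (K * β * G.card)
          ((1 - ε) * G.card) := by
  induction r, hr using Nat.le_induction with
  | base =>
    intro C hC
    refine ⟨1 / C, 0, by positivity, le_rfl, fun V _ G β w hβ hβ1 hb => ?_⟩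
    classical
    refine HasContainers.of_subset (G.filter fun v => w {v} = 0) (by simp) ?_
      (hb.card_le_of_indep (by linarith) (filter_subset _ _) ?_)
    · intro I hI x hx
      exact mem_filter.2 ⟨hI.1 hx, hI.2 _ (singleton_subset_iff.2 hx)⟩
    · intro e he
      by_contra h0
      obtain ⟨x, rfl⟩ := card_eq_one.1 (hb.uniform e h0)
      exact h0 (mem_filter.1 (he (mem_singleton_self x))).2
  | succ r hr ih =>
    intro C hC
    have hC0 : 0 < C := by linarith
    obtain ⟨c, hc⟩ : ∃ c : ℝ, c = 1 / (16 * C * 2 ^ r) := ⟨_, rfl⟩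
    have hc0 : 0 < c := by rw [hc]; positivity
    have hc1 : c ≤ 1 := by
      rw [hc, div_le_one (by positivity)]
      exact one_le_mul_of_one_le_of_one_le (by linarith) (one_le_pow₀ one_le_two)
    obtain ⟨ε, K, hε, hK, H⟩ := ih ((1 + C) / c) (by rw [le_div_iff₀ hc0]; linarith)
    refine ⟨min ε (1 / (4 * C)), K + 4 * c + C, by positivity, by positivity,
      fun V _ G β w hβ hβ1 hb => ?_⟩
    have h1 := hb.one_le_mul_card (by omega) hC0.le hβ.le
    have hzero : ∀ S, weightDeg G (fun _ => 0) S = 0 := fun S => sum_const_zero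
    have := hasContainers_of_partial_link hb hC hβ hβ1 hc (t := K * β * G.card)
      (M := (1 - min ε (1 / (4 * C))) * G.card) (by positivity)
      (by gcongr; exact min_le_right _ _)
      (fun w' hb' => (H V G β w' hβ hβ1 hb').mono (fun _ h => h) le_rfl
        (by gcongr; exact min_le_left _ _))
      (A := G) (T := ∅) (w' := fun _ => 0) Subset.rfl (disjoint_empty_right G) (fun _ => le_rfl)
      (fun _ h => absurd rfl h) (fun _ h => absurd rfl h)
      (fun S _ _ => by rw [hzero, zero_mul]; have := hb.pos; positivity)
      (by simp [hzero]) (by rw [card_empty]; push_cast; positivity)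
    refine this.mono (fun I hI => ⟨hI, sdiff_eq_empty_iff_subset.2 hI.1⟩) ?_ le_rfl
    rw [card_empty]
    push_cast
    linarith

end ContainerAlgorithm

/-- The container step: there is `ε > 0` depending only on `ℓ` and `C`
such that, given a graph `G` with `k·n^α` edges and a nonempty balanced family `𝓕` of
copies of a bipartite `H` with `ℓ` edges and codegree ratio `β`, every `H`-free subgraph
`I ⊆ G` has a fingerprint `T(I) ⊆ I` with at most `(kβ/ε)·n^α` edges whose container
`f_G(T(I))` has at most `(1−ε)·e(G)` edges. -/
theorem container_step (ℓ : ℕ) (hℓ : 2 ≤ ℓ) (C : ℝ) (hC : 1 ≤ C) :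
    ∃ ε : ℝ, 0 < ε ∧
      ∀ {h : ℕ} (H : Finset (Finset (Fin h))),
        UniformHG 2 H → MultipartiteHG 2 H → H.card = ℓ →
      ∀ α : ℝ, 0 < α →
      ∀ (n : ℕ) (k β : ℝ), 0 < k → 0 < β →
      ∀ G : Finset (Finset (Fin n)), UniformHG 2 G → (G.card : ℝ) = k * (n : ℝ) ^ α →
      ∀ 𝓕 : Finset (Finset (Finset (Fin n))), 𝓕.Nonempty →
        (∀ B ∈ 𝓕, IsCopy H G B) →
        (∀ S : Finset (Finset (Fin n)), S ⊆ G → 1 ≤ S.card → S.card ≤ ℓ →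
          (degF 𝓕 S : ℝ) ≤ C * β ^ (S.card - 1) * (𝓕.card : ℝ) / (G.card : ℝ)) →
        1 ≤ C * β ^ (ℓ - 1) * (𝓕.card : ℝ) / (G.card : ℝ) →
        ∃ (fG T : Finset (Finset (Fin n)) → Finset (Finset (Fin n))),
          (∀ J, J ⊆ G → fG J ⊆ G) ∧
          ∀ I, I ⊆ G → HFree H I →
            T I ⊆ I ∧ ((T I).card : ℝ) ≤ (k * β / ε) * (n : ℝ) ^ α ∧
            I ⊆ fG (T I) ∧ ((fG (T I)).card : ℝ) ≤ (1 - ε) * (G.card : ℝ) := by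
  obtain ⟨ε₀, K, hε₀, hK, H⟩ := exists_hasContainers ℓ (by omega) C hC
  have hC0 : 0 < C := by linarith
  refine ⟨min (min ε₀ (1 / C)) (1 / (K + 1)), by positivity, ?_⟩
  set ε := min (min ε₀ (1 / C)) (1 / (K + 1))
  have hε : 0 < ε := by positivity
  have hε1 : ε ≤ ε₀ := (min_le_left _ _).trans (min_le_left _ _)
  have hε2 : ε ≤ 1 / C := (min_le_left _ _).trans (min_le_right _ _)
  have hε3 : ε ≤ 1 / (K + 1) := min_le_right _ _
  intro h Hg _ _ hHcard α _ n k β _ hβ G _ hGcard 𝓕 hne hcopy hdeg _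
  have hBcard : ∀ B ∈ 𝓕, B.card = ℓ := by
    intro B hB
    obtain ⟨f, hf, rfl, -⟩ := hcopy B hB
    rw [card_image_of_injective _ (image_injective hf), hHcard]
  have hBG : ∀ B ∈ 𝓕, B ⊆ G := by
    intro B hB
    obtain ⟨_, _, _, h⟩ := hcopy B hB
    exact h
  let w : Finset (Finset (Fin n)) → ℝ := fun e => if e ∈ 𝓕 then 1 else 0
  have hwdeg : ∀ S, weightDeg G w S = degF 𝓕 S := by
    intro S
    simp only [weightDeg, w, degF, sum_ite_mem, sum_const, nsmul_eq_mul, mul_one]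
    congr 2
    ext B
    simp only [mem_inter, mem_filter, mem_powerset]
    exact ⟨fun h => ⟨h.2, h.1.2⟩, fun h => ⟨⟨hBG B h.1, h.2⟩, h.1⟩⟩
  have hwempty : weightDeg G w ∅ = 𝓕.card := by
    rw [hwdeg]
    simp [degF]
  have hGpos : 0 < (G.card : ℝ) := by
    obtain ⟨B, hB⟩ := hne
    have h1 := card_le_card (hBG B hB)
    have h2 := hBcard B hB
    exact_mod_cast (show 0 < G.card by omega)
  have hb : WeightBalanced G ℓ C β w := by
    refine ⟨fun e => ?_, fun e he => ?_, ?_, fun S hS hSne => ?_⟩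
    · dsimp only [w]
      split_ifs <;> norm_num
    · exact hBcard e (by by_contra h0; exact he (if_neg h0))
    · rw [hwempty]
      exact_mod_cast hne.card_pos
    · rw [hwempty]
      by_cases hle : S.card ≤ ℓ
      · rw [hwdeg, ← le_div_iff₀ hGpos]
        exact hdeg S hS (Finset.card_pos.2 hSne) hle
      · have h0 : degF 𝓕 S = 0 := by
          refine card_eq_zero.2 (filter_eq_empty_iff.2 fun B hB hSB => hle ?_)
          exact (card_le_card hSB).trans_eq (hBcard B hB)
        rw [hwdeg, h0, Nat.cast_zero, zero_mul]
        positivity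
  have hindep : ∀ I, HFree Hg I → WeightIndep w I := by
    intro I hI e he
    refine if_neg fun heF => ?_
    obtain ⟨f, hf, hef, -⟩ := hcopy e heF
    exact hI e ⟨f, hf, hef, he⟩
  have hbound : k * β / ε * (n : ℝ) ^ α = β * G.card / ε := by
    rw [hGcard]
    ring
  rw [hbound]
  rcases le_total β 1 with hβ1 | hβ1
  · obtain ⟨T, g, hTg⟩ := H (Finset (Fin n)) G β w hβ hβ1 hb
    refine ⟨fun J => g J ∩ G, T, fun J _ => inter_subset_right, fun I hIG hI => ?_⟩
    obtain ⟨h1, h2, h3, h4, h5⟩ := hTg I ⟨hIG, hindep I hI⟩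
    have h6 := (h5 (T I) Subset.rfl h1).2
    refine ⟨h1, h2.trans ?_, ?_, ?_⟩
    · rw [le_div_iff₀ hε]
      have h7 : K * ε ≤ 1 := by
        rw [le_div_iff₀ (by positivity)] at hε3
        linarith
      calc K * β * G.card * ε = K * ε * (β * G.card) := by ring
        _ ≤ 1 * (β * G.card) := by gcongr
        _ = β * G.card := one_mul _
    · dsimp only
      rw [h6]
      exact subset_inter h3 hIG
    · dsimp only
      rw [h6]
      have h7 : ((g I ∩ G).card : ℝ) ≤ (g I).card := by
        exact_mod_cast card_le_card inter_subset_left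
      refine (h7.trans h4).trans ?_
      gcongr
  · refine ⟨id, id, fun J hJ => hJ, fun I hIG hI => ?_⟩
    have hI' := hb.card_le_of_indep hC0 hIG (hindep I hI)
    refine ⟨Subset.rfl, ?_, Subset.rfl, hI'.trans (by gcongr)⟩
    rw [le_div_iff₀ hε]
    have h1 : (I.card : ℝ) ≤ G.card := by exact_mod_cast card_le_card hIG
    have h2 : ε ≤ 1 := hε2.trans (by rw [div_le_one hC0]; exact hC)
    calc (I.card : ℝ) * ε ≤ G.card * 1 := by gcongr
      _ = 1 * G.card := by ring
      _ ≤ β * G.card := by gcongr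
end
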